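/- Let K and K' be number fields with absolute Galois groups 𝒢_K = Gal(K̄/K) and 𝒢_{K'} = Gal(K̄'/K'). If there exists an isomorphism of topological groups 𝒢_K ≅ 𝒢_{K'}, then K and K' are isomorphic as fields. -/

import Mathlib

namespace NU

/-- Multiplicative data of a rigid subgroup containing the squares. -/
structure SqLike {L : Type*} [Field L] (T : L → Prop) : Prop where
  ne0 : ∀ x, T x → x ≠ 0
  mul : ∀ x y, T x → T y → T (x * y)
  neg1 : T (-1)
  sq : ∀ x, x ≠ 0 → T (x * x)
  rig : ∀ x, x ≠ 0 → ¬ T x → T (1 + x) ∨ T (x * (1 + x))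

namespace SqLike
variable {L : Type*} [Field L] {T : L → Prop}

theorem one (h : SqLike T) : T 1 := by simpa using h.sq 1 one_ne_zero

theorem comb (h : SqLike T) {a b c : L} (u : L) (ha : T a) (hb : T b) (hu : u ≠ 0)
    (e : a * b = c * (u * u)) : T c := by
  have h1 := h.mul _ _ (h.mul _ _ ha hb) (h.sq u⁻¹ (inv_ne_zero hu))
  have : a * b * (u⁻¹ * u⁻¹) = c := by rw [e]; field_simp
  rwa [this] at h1

theorem inv (h : SqLike T) {a : L} (ha : T a) : T a⁻¹ :=
  h.comb a ha h.one (h.ne0 _ ha) (by field_simp [h.ne0 _ ha])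

theorem neg (h : SqLike T) {a : L} (ha : T a) : T (-a) := by simpa using h.mul _ _ h.neg1 ha

theorem rg (h : SqLike T) {x s t : L} (hx : x ≠ 0) (hT : ¬ T x) (hs : T s) (ht : T t) :
    T (s + x * t) ∨ T (x * (s + x * t)) := by
  have s0 := h.ne0 _ hs
  have t0 := h.ne0 _ ht
  have key : s + x * t = s * (1 + x * (t * s⁻¹)) := by field_simp
  have hts : T (t * s⁻¹) := h.mul _ _ ht (h.inv hs)
  rcases h.rig (x * (t * s⁻¹)) (mul_ne_zero hx (h.ne0 _ hts))
    (fun h' => hT (h.comb (t * s⁻¹) h' hts (h.ne0 _ hts) (by ring))) with h1 | h1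
  · left; rw [key]; exact h.mul _ _ hs h1
  · right
    have := h.mul _ _ (h.mul _ _ hs h1) hts
    rw [key]
    exact h.comb (t * s⁻¹) (h.mul _ _ hs h1) hts (h.ne0 _ hts) (by ring)

def O1 (T : L → Prop) (x : L) : Prop := x ≠ 0 ∧ ¬ T x ∧ T (1 + x)

theorem prod_side (h : SqLike T) {x y : L} (hx : x ≠ 0) (hxT : ¬ T x) (h1x : T (1 + x)) (h1y : T (1 + y)) :
    T (1 - x * y) ∨ T (x * (1 - x * y)) := by
  have := h.rg hx hxT h1x (h.neg h1y)
  have e : 1 + x + x * -(1 + y) = 1 - x * y := by ring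
  rwa [e] at this

theorem prod_diff (h : SqLike T) {x y : L} (hx : O1 T x) (hy : O1 T y) (hxy : ¬ T (x * y)) :
    T (1 - x * y) := by
  rcases h.prod_side hx.1 hx.2.1 hx.2.2 hy.2.2 with h1 | h1
  · exact h1
  rcases h.prod_side hy.1 hy.2.1 hy.2.2 hx.2.2 with h2 | h2
  · rwa [mul_comm y x] at h2
  exfalso
  apply hxy
  have := right_ne_zero_of_mul (h.ne0 _ h1)
  exact h.comb (1 - x * y) h1 h2 this (by ring)

def bad (T : L → Prop) (x : L) : Prop :=
  ∃ y z, O1 T y ∧ O1 T z ∧ T (x * y) ∧ T (x * z) ∧ ¬ T (1 - y * z)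

theorem bad_unique (h : SqLike T) {a b : L} (ha : bad T a) (hb : bad T b) : T (a * b) := by
  obtain ⟨x, y, hx, hy, hax, hay, hc⟩ := ha
  obtain ⟨z, w, hz, hw, hbz, hbw, hd⟩ := hb
  by_contra hab
  have a0 := left_ne_zero_of_mul (h.ne0 _ hax)
  have b0 := left_ne_zero_of_mul (h.ne0 _ hbz)
  have hxy : T (x * y) := h.comb a hax hay a0 (by ring)
  have hzw : T (z * w) := h.comb b hbz hbw b0 (by ring)
  have hxz : ¬ T (x * z) := fun h' => hab (by
    have := h.mul _ _ hax hbz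
    exact h.comb (x * z) this h' (mul_ne_zero hx.1 hz.1) (by ring))
  have hyz : ¬ T (y * z) := fun h' => hxz (h.comb y hxy h' hy.1 (by ring))
  have hwx : ¬ T (w * x) := fun h' => hxz (h.comb w h' hzw hw.1 (by ring))
  have hcz' : ¬ T (x * y * z) := fun h' => hz.2.1 (h.comb (x * y) h' hxy (mul_ne_zero hx.1 hy.1) (by ring))
  have hdx' : ¬ T (z * w * x) := fun h' => hx.2.1 (h.comb (z * w) h' hzw (mul_ne_zero hz.1 hw.1) (by ring))
  have hcz0 : x * y * z ≠ 0 := mul_ne_zero (mul_ne_zero hx.1 hy.1) hz.1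
  have hdx0 : z * w * x ≠ 0 := mul_ne_zero (mul_ne_zero hz.1 hw.1) hx.1
  have hcz : T (1 + x * y * z) := by
    rcases h.rig _ hcz0 hcz' with h1 | h1
    · exact h1
    have := h.rg hx.1 hx.2.1 hx.2.2 (h.neg (h.prod_diff hy hz hyz))
    rw [show 1 + x + x * -(1 - y * z) = 1 + x * y * z by ring] at this
    rcases this with h2 | h2
    · exact h2
    exfalso; apply hyz
    exact h.comb (x * (1 + x * y * z)) h1 h2 (h.ne0 _ h2) (by ring)
  have hdx : T (1 + z * w * x) := by
    rcases h.rig _ hdx0 hdx' with h1 | h1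
    · exact h1
    have := h.rg hz.1 hz.2.1 hz.2.2 (h.neg (h.prod_diff hw hx hwx))
    rw [show 1 + z + z * -(1 - w * x) = 1 + z * w * x by ring] at this
    rcases this with h2 | h2
    · exact h2
    exfalso; apply hwx
    exact h.comb (z * (1 + z * w * x)) h1 h2 (h.ne0 _ h2) (by ring)
  have h1c := (h.prod_side hx.1 hx.2.1 hx.2.2 hy.2.2).resolve_left hc
  have h1d := (h.prod_side hz.1 hz.2.1 hz.2.2 hw.2.2).resolve_left hd
  have e1 := h.rg (x := x * z) (mul_ne_zero hx.1 hz.1) hxz h1c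
    (t := x * y * (z * (1 - z * w)) * (z⁻¹ * z⁻¹))
    (h.mul _ _ (h.mul _ _ hxy h1d) (h.sq _ (inv_ne_zero hz.1)))
  have A := h.prod_side hcz0 hcz' hcz hw.2.2
  have B := h.prod_side hdx0 hdx' hdx hy.2.2
  have eA : 1 - x * y * z * w = 1 - (x * y) * (z * w) := by ring
  have eB : 1 - z * w * x * y = 1 - (x * y) * (z * w) := by ring
  rw [eA] at A
  rw [eB] at B
  have hz0 := hz.1
  have e2 : x * (1 - x * y) + x * z * (x * y * (z * (1 - z * w)) * (z⁻¹ * z⁻¹)) =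
      x * (1 - (x * y) * (z * w)) := by field_simp; ring
  rw [e2] at e1
  generalize 1 - (x * y) * (z * w) = E at A B e1
  rcases e1 with h1 | h1
  · have E0 := right_ne_zero_of_mul (h.ne0 _ h1)
    rcases A with h2 | h2
    · exact hx.2.1 (h.comb E h1 h2 E0 (by ring))
    · have h3 := h.comb (x * y) h2 hxy (mul_ne_zero hx.1 hy.1) (c := z * E) (by ring)
      exact hxz (h.comb E h1 h3 E0 (by ring))
  · have E0 := right_ne_zero_of_mul (right_ne_zero_of_mul (h.ne0 _ h1))
    have h1' := h.comb x h1 h.one hx.1 (c := z * E) (by ring)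
    rcases B with h2 | h2
    · exact hz.2.1 (h.comb E h1' h2 E0 (by ring))
    · have h3 := h.comb (z * w) h2 hzw (mul_ne_zero hz.1 hw.1) (c := x * E) (by ring)
      exact hxz (h.comb E h1' h3 E0 (by ring))

def H0 (T : L → Prop) (z : L) : Prop := z ≠ 0 ∧ (T z ∨ bad T z)

theorem bad_mul (h : SqLike T) {a b : L} (ha : T a) (hb : bad T b) : bad T (a * b) := by
  obtain ⟨y, z, hy, hz, h1, h2, h3⟩ := hb
  exact ⟨y, z, hy, hz, by rw [mul_assoc]; exact h.mul _ _ ha h1, by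
    rw [mul_assoc]; exact h.mul _ _ ha h2, h3⟩

theorem H0_mul (h : SqLike T) {a b : L} (ha : H0 T a) (hb : H0 T b) : H0 T (a * b) := by
  refine ⟨mul_ne_zero ha.1 hb.1, ?_⟩
  rcases ha.2 with h1 | h1 <;> rcases hb.2 with h2 | h2
  · exact Or.inl (h.mul _ _ h1 h2)
  · exact Or.inr (h.bad_mul h1 h2)
  · rw [mul_comm]; exact Or.inr (h.bad_mul h2 h1)
  · exact Or.inl (h.bad_unique h1 h2)

theorem H0_of (h : SqLike T) {a : L} (ha : T a) : H0 T a := ⟨h.ne0 _ ha, Or.inl ha⟩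

theorem H0_comb (h : SqLike T) {a b c : L} (u : L) (ha : H0 T a) (hb : H0 T b) (hu : u ≠ 0)
    (e : a * b = c * (u * u)) : H0 T c := by
  have h1 := h.H0_mul (h.H0_mul ha hb) (h.H0_of (h.sq u⁻¹ (inv_ne_zero hu)))
  have : a * b * (u⁻¹ * u⁻¹) = c := by rw [e]; field_simp
  rwa [this] at h1

theorem H0_inv (h : SqLike T) {a : L} (ha : H0 T a) : H0 T a⁻¹ :=
  h.H0_comb a ha (h.H0_of h.one) ha.1 (by field_simp [ha.1])

theorem H0_cancel (h : SqLike T) {a b : L} (ha : H0 T a) (hb : H0 T (a * b)) : H0 T b :=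
  h.H0_comb a ha hb ha.1 (by ring)

def A1 (T : L → Prop) (z : L) : Prop := z ≠ 0 ∧ ¬ H0 T z ∧ T (1 + z)

theorem A1_O1 (h : SqLike T) {z : L} (hz : A1 T z) : O1 T z :=
  ⟨hz.1, fun h' => hz.2.1 (h.H0_of h'), hz.2.2⟩

theorem star (h : SqLike T) {z w : L} (hz : A1 T z) (hw : A1 T w) : T (1 - z * w) := by
  by_cases hzw : T (z * w)
  · by_contra hc
    exact hz.2.1 ⟨hz.1, Or.inr ⟨z, w, h.A1_O1 hz, h.A1_O1 hw, h.sq _ hz.1, hzw, hc⟩⟩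
  · exact h.prod_diff (h.A1_O1 hz) (h.A1_O1 hw) hzw

theorem A1_of (h : SqLike T) {z c : L} (hz : A1 T z) (hc : T c) (h1 : T (1 + c * z)) :
    A1 T (c * z) :=
  ⟨mul_ne_zero (h.ne0 _ hc) hz.1, fun h' => hz.2.1 (h.H0_cancel (h.H0_of hc) h'), h1⟩

theorem A1_neg (h : SqLike T) {z : L} (hz : A1 T z) : A1 T (-z) := by
  have := h.A1_of hz h.neg1 (by
    have h1 := h.star hz hz
    exact h.comb (1 + z) h1 hz.2.2 (h.ne0 _ hz.2.2) (by ring))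
  simpa using this

theorem A1_div_self (h : SqLike T) {z : L} (hz : A1 T z) : A1 T ((1 + z)⁻¹ * z) := by
  have h0 := h.ne0 _ hz.2.2
  have := h.A1_of (c := -(1 + z)⁻¹) hz (h.neg (h.inv hz.2.2)) (by
    have := h.inv hz.2.2
    convert this using 1
    field_simp; ring)
  have := h.A1_neg this
  simpa using this

theorem star' (h : SqLike T) {z w : L} (hz : A1 T z) (hw : A1 T w) : T (1 + z * w) := by
  simpa using h.star (h.A1_neg hz) hw

theorem A1_mul1 (h : SqLike T) {z w : L} (hz : A1 T z) (hw : A1 T w) : A1 T ((1 + w) * z) := by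
  refine h.A1_of hz hw.2.2 ?_
  have h0 := h.ne0 _ hz.2.2
  have h1 := h.mul _ _ hz.2.2 (h.star' (h.A1_div_self hz) hw)
  convert h1 using 1
  field_simp; ring

theorem A1_div1 (h : SqLike T) {z w : L} (hz : A1 T z) (hw : A1 T w) : A1 T ((1 + w)⁻¹ * z) := by
  have h0 := h.ne0 _ hw.2.2
  have h1 := h.A1_mul1 hz (h.A1_neg (h.A1_div_self hw))
  convert h1 using 1
  field_simp; ring

theorem T_add (h : SqLike T) {z w : L} (hz : A1 T z) (hw : A1 T w) : T (1 + z + w) := by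
  have h0 := h.ne0 _ hz.2.2
  have h1 := h.mul _ _ hz.2.2 (h.A1_div1 hw hz).2.2
  convert h1 using 1
  field_simp

theorem A1_add (h : SqLike T) {z w : L} (hz : A1 T z) (hw : A1 T w) (h0 : z + w ≠ 0)
    (hH : ¬ H0 T (z + w)) : A1 T (z + w) :=
  ⟨h0, hH, by rw [← add_assoc]; exact h.T_add hz hw⟩

def O2 (T : L → Prop) (x : L) : Prop := H0 T x ∧ ∀ z, A1 T z → A1 T (x * z)

theorem A1_mul_O2 (h : SqLike T) {z w : L} (hz : A1 T z) (hw : A1 T w) (hH : H0 T (z * w)) :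
    O2 T (z * w) := by
  refine ⟨hH, fun y hy => ?_⟩
  have a := h.A1_mul1 (h.A1_div_self hz) hw
  have b := h.A1_mul1 (h.A1_mul1 hy hz) (h.A1_neg a)
  have c := h.A1_neg b
  have h0 := h.ne0 _ hz.2.2
  have e : y + -((1 + -((1 + w) * ((1 + z)⁻¹ * z))) * ((1 + z) * y)) = z * w * y := by
    field_simp; ring
  rw [← e]
  apply h.A1_add hy c
  · rw [e]; exact mul_ne_zero hH.1 hy.1
  · rw [e]; exact fun h' => hy.2.1 (h.H0_cancel hH h')

def OO (T : L → Prop) (x : L) : Prop := x = 0 ∨ A1 T x ∨ O2 T x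

theorem A1_dich (h : SqLike T) {y : L} (h0 : y ≠ 0) (hy : ¬ H0 T y) : A1 T y ∨ A1 T y⁻¹ := by
  rcases h.rig y h0 (fun h' => hy (h.H0_of h')) with h1 | h1
  · exact Or.inl ⟨h0, hy, h1⟩
  · refine Or.inr ⟨inv_ne_zero h0, fun h' => hy (by simpa using h.H0_inv h'), ?_⟩
    exact h.comb y h1 h.one h0 (by field_simp; ring)

theorem OO_mul (h : SqLike T) {x y : L} (hx : OO T x) (hy : OO T y) : OO T (x * y) := by
  rcases hx with rfl | hx | hx
  · exact Or.inl (by simp)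
  · rcases hy with rfl | hy | hy
    · exact Or.inl (by simp)
    · by_cases hH : H0 T (x * y)
      · exact Or.inr (Or.inr (h.A1_mul_O2 hx hy hH))
      · exact Or.inr (Or.inl ⟨mul_ne_zero hx.1 hy.1, hH, h.star' hx hy⟩)
    · rw [mul_comm]; exact Or.inr (Or.inl (hy.2 _ hx))
  · rcases hy with rfl | hy | hy
    · exact Or.inl (by simp)
    · exact Or.inr (Or.inl (hx.2 _ hy))
    · refine Or.inr (Or.inr ⟨h.H0_mul hx.1 hy.1, fun z hz => ?_⟩)
      rw [mul_assoc]; exact hx.2 _ (hy.2 _ hz)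

theorem OO_inv (h : SqLike T) (x : L) : OO T x ∨ OO T x⁻¹ := by
  by_cases h0 : x = 0
  · exact Or.inl (Or.inl h0)
  by_cases hH : H0 T x
  · by_cases hO : O2 T x
    · exact Or.inl (Or.inr (Or.inr hO))
    · right; right; right
      unfold O2 at hO
      push Not at hO
      obtain ⟨z, hz, hxz⟩ := hO hH
      have hz0 := hz.1
      have : ¬ H0 T (x * z) := fun h' => hz.2.1 (h.H0_cancel hH h')
      have h1 := (h.A1_dich (mul_ne_zero h0 hz.1) this).resolve_left hxz
      have e : (x * z)⁻¹ * z = x⁻¹ := by field_simp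
      rw [← e]
      exact h.A1_mul_O2 h1 hz (by rw [e]; exact h.H0_inv hH)
  · rcases h.A1_dich h0 hH with h1 | h1
    · exact Or.inl (Or.inr (Or.inl h1))
    · exact Or.inr (Or.inr (Or.inl h1))

theorem OO_one_add (h : SqLike T) {x : L} (hx : OO T x) : OO T (1 + x) := by
  have h1 : O2 T 1 := ⟨h.H0_of h.one, fun z hz => by simpa using hz⟩
  rcases hx with rfl | hx | hx
  · rw [add_zero]; exact Or.inr (Or.inr h1)
  · exact Or.inr (Or.inr ⟨h.H0_of hx.2.2, fun z hz => h.A1_mul1 hz hx⟩)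
  · by_cases h0 : 1 + x = 0
    · exact Or.inl h0
    by_cases hH : H0 T (1 + x)
    · refine Or.inr (Or.inr ⟨hH, fun z hz => ?_⟩)
      have e : (1 + x) * z = z + x * z := by ring
      rw [e]
      apply h.A1_add hz (hx.2 _ hz)
      · rw [← e]; exact mul_ne_zero h0 hz.1
      · rw [← e]; exact fun h' => hz.2.1 (h.H0_cancel hH h')
    · rcases h.A1_dich h0 hH with h2 | h2
      · exact Or.inr (Or.inl h2)
      · exfalso
        have h3 := (h.A1_neg h2).2.2
        have h4 := (hx.2 _ h2).2.1
        apply h4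
        have e : x * (1 + x)⁻¹ = 1 + -(1 + x)⁻¹ := by field_simp; ring
        rw [e]; exact h.H0_of h3

theorem OO_add (h : SqLike T) {x y : L} (hx : OO T x) (hy : OO T y) : OO T (x + y) := by
  by_cases hx0 : x = 0
  · simpa [hx0] using hy
  by_cases hy0 : y = 0
  · simpa [hy0] using hx
  rcases h.OO_inv (y / x) with h1 | h1
  · have := h.OO_mul hx (h.OO_one_add h1)
    convert this using 1
    field_simp
  · have := h.OO_mul hy (h.OO_one_add h1)
    convert this using 1
    field_simp; ring

/-- Rigid subgroups come from valuations. -/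
theorem exists_valuationSubring (h : SqLike T) {x y : L} (hx : x ≠ 0) (hy : y ≠ 0)
    (hxT : ¬ T x) (hyT : ¬ T y) (hxy : ¬ T (x * y)) :
    ∃ O : ValuationSubring L, O ≠ ⊤ ∧ ∀ z ∈ O, (z = 0 ∨ z⁻¹ ∉ O) → T (1 + z) := by
  have hone : OO T 1 := by simpa using h.OO_one_add (Or.inl rfl)
  have hneg1 : OO T (-1) := Or.inr (Or.inr ⟨h.H0_of h.neg1, fun z hz => by
    simpa using h.A1_neg hz⟩)
  let O : ValuationSubring L :=
    { carrier := {x | OO T x}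
      mul_mem' := fun ha hb => h.OO_mul ha hb
      one_mem' := hone
      add_mem' := fun ha hb => h.OO_add ha hb
      zero_mem' := Or.inl rfl
      neg_mem' := fun {a} ha => by
        have := h.OO_mul hneg1 ha
        simpa using this
      mem_or_inv_mem' := h.OO_inv }
  have memO : ∀ z, z ∈ O ↔ OO T z := fun z => Iff.rfl
  refine ⟨O, ?_, ?_⟩
  · have key : ∃ z, z ≠ 0 ∧ ¬ H0 T z := by
      by_contra hc
      push Not at hc
      exact hxy (h.bad_unique ((hc x hx).2.resolve_left hxT) ((hc y hy).2.resolve_left hyT))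
    obtain ⟨z, hz0, hzH⟩ := key
    have : ∃ z, A1 T z := by
      rcases h.A1_dich hz0 hzH with h1 | h1
      exacts [⟨_, h1⟩, ⟨_, h1⟩]
    obtain ⟨z, hz⟩ := this
    intro htop
    have : z⁻¹ ∈ O := by rw [htop]; trivial
    rw [memO] at this
    rcases this with h1 | h1 | h1
    · exact inv_ne_zero hz.1 h1
    · have := h.ne0 _ (h.star hz h1)
      rw [mul_inv_cancel₀ hz.1] at this
      simp at this
    · exact hz.2.1 (by simpa using h.H0_inv h1.1)
  · intro z hz hz'
    rw [memO] at hz hz'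
    rcases hz' with rfl | hz'
    · simpa using h.one
    rcases hz with rfl | hz | hz
    · simpa using h.one
    · exact hz.2.2
    · have hH := h.H0_inv hz.1
      have : ¬ O2 T z⁻¹ := fun h' => hz' (Or.inr (Or.inr h'))
      unfold O2 at this
      push Not at this
      obtain ⟨w, hw, hzw⟩ := this hH
      have h1 : ¬ H0 T (z⁻¹ * w) := fun h' => hw.2.1 (h.H0_cancel hH h')
      have h2 := (h.A1_dich (mul_ne_zero hH.1 hw.1) h1).resolve_left hzw
      have hw0 := hw.1
      have hz0 := hz.1.1
      have e : (z⁻¹ * w)⁻¹ * w = z := by field_simp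
      rw [← e]
      exact h.star' h2 hw

end SqLike
end NU


namespace NU
open Polynomial
set_option linter.unusedSectionVars false

variable {Ω : Type*} [Field Ω] [CharZero Ω]

/-- `p` is the residue characteristic of `A`. -/
def Over (A : ValuationSubring Ω) (p : ℕ) : Prop := p.Prime ∧ A.valuation (p : Ω) < 1

theorem v_int_le (A : ValuationSubring Ω) (n : ℤ) : A.valuation (n : Ω) ≤ 1 :=
  (A.valuation_le_one_iff _).2 (by exact_mod_cast intCast_mem A n)

theorem v_nat_le (A : ValuationSubring Ω) (n : ℕ) : A.valuation (n : Ω) ≤ 1 := by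
  exact_mod_cast v_int_le A n

theorem mem_of_int {A : ValuationSubring Ω} {x : Ω} (hx : IsIntegral ℤ x) : A.valuation x ≤ 1 := by
  have h1 : IsIntegral A x := hx.tower_top
  have hI : A.valuation.Integers A :=
    ⟨Subtype.val_injective, fun a => A.valuation_le_one a,
      fun {r} hr => ⟨⟨r, (A.valuation_le_one_iff r).1 hr⟩, rfl⟩⟩
  exact hI.mem_of_integral h1

theorem v_pos {A : ValuationSubring Ω} {x : Ω} (hx : x ≠ 0) : 0 < A.valuation x :=
  zero_lt_iff.2 ((A.valuation.ne_zero_iff).2 hx)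

theorem Over.ne_top {A : ValuationSubring Ω} {p : ℕ} (h : Over A p) : A ≠ ⊤ := by
  intro ht
  have hp0 : (p : Ω) ≠ 0 := by exact_mod_cast h.1.ne_zero
  have : (p : Ω)⁻¹ ∈ A := by rw [ht]; trivial
  rw [← A.valuation_le_one_iff, map_inv₀] at this
  exact absurd h.2 (not_lt.2 ((inv_le_one₀ (v_pos hp0)).1 this))

theorem Over.coprime {A : ValuationSubring Ω} {p : ℕ} (h : Over A p) {n : ℤ} (hn : ¬ (p : ℤ) ∣ n) :
    A.valuation (n : Ω) = 1 := by
  refine le_antisymm (v_int_le A n) ?_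
  by_contra hc
  push Not at hc
  have hcop : IsCoprime (p : ℤ) n :=
    (Nat.prime_iff_prime_int.1 h.1).coprime_iff_not_dvd.2 hn
  obtain ⟨a, b, hab⟩ := hcop
  have h1 : A.valuation ((a * p + b * n : ℤ) : Ω) < 1 := by
    push_cast
    refine A.valuation.map_add_lt ?_ ?_
    · rw [map_mul]; exact mul_lt_one_of_nonneg_of_lt_one_right (v_int_le A a) zero_le h.2
    · rw [map_mul]; exact mul_lt_one_of_nonneg_of_lt_one_right (v_int_le A b) zero_le hc
  rw [hab] at h1
  simp at h1

theorem Over.unique {A : ValuationSubring Ω} {p q : ℕ} (h : Over A p) (h' : Over A q) : p = q := by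
  by_contra hne
  have : ¬ (p : ℤ) ∣ (q : ℤ) := by
    rw [Int.natCast_dvd_natCast, Nat.prime_dvd_prime_iff_eq h.1 h'.1]
    exact hne
  have := h.coprime this
  have h2 := h'.2
  rw [show ((q : ℤ) : Ω) = (q : Ω) by push_cast; rfl] at this
  rw [this] at h2
  exact lt_irrefl _ h2

theorem Over.vint {A : ValuationSubring Ω} {p : ℕ} (h : Over A p) {n : ℤ} (hn : n ≠ 0) :
    ∃ k : ℕ, A.valuation (n : Ω) = A.valuation (p : Ω) ^ k := by
  have hfin : FiniteMultiplicity (p : ℤ) n :=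
    Int.finiteMultiplicity_iff.2 ⟨by simpa using h.1.ne_one, hn⟩
  obtain ⟨c, hc, hd⟩ := hfin.exists_eq_pow_mul_and_not_dvd
  refine ⟨multiplicity (p : ℤ) n, ?_⟩
  rw [hc]
  push_cast
  rw [map_mul, h.coprime hd, mul_one, map_pow, ← hc]

theorem Over.vrat {A : ValuationSubring Ω} {p : ℕ} (h : Over A p) {q : ℚ} (hq : q ≠ 0) :
    ∃ k : ℤ, A.valuation (q : Ω) = A.valuation (p : Ω) ^ k := by
  obtain ⟨a, ha⟩ := h.vint (Rat.num_ne_zero.2 hq)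
  obtain ⟨b, hb⟩ := h.vint (n := q.den) (by exact_mod_cast q.den_ne_zero)
  refine ⟨a - b, ?_⟩
  have hp0 : A.valuation (p : Ω) ≠ 0 := (v_pos (by exact_mod_cast h.1.ne_zero)).ne'
  rw [zpow_sub₀ hp0, zpow_natCast, zpow_natCast, ← ha, ← hb, ← map_div₀]
  congr 1
  push_cast
  exact Rat.cast_def q

theorem exists_over [Algebra.IsAlgebraic ℚ Ω] {A : ValuationSubring Ω} (hA : A ≠ ⊤) : ∃ p, Over A p := by
  by_contra hc
  push Not at hc
  apply hA
  have h1 : ∀ n : ℕ, n ≠ 0 → A.valuation (n : Ω) = 1 := by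
    intro n
    induction n using Nat.recOnMul with
    | zero => simp
    | one => simp
    | prime p hp =>
      intro _
      refine le_antisymm (v_nat_le A p) ?_
      by_contra h'
      exact hc p ⟨hp, not_le.1 h'⟩
    | mul a b iha ihb =>
      intro hab
      push_cast
      rw [map_mul, iha (left_ne_zero_of_mul hab), ihb (right_ne_zero_of_mul hab), one_mul]
  rw [eq_top_iff]
  intro x _
  have : IsAlgebraic ℤ x := (IsFractionRing.isAlgebraic_iff ℤ ℚ Ω).2 (Algebra.IsAlgebraic.isAlgebraic x)
  obtain ⟨n, hn, hi⟩ := this.exists_integral_multiple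
  have h2 := mem_of_int (A := A) hi
  rw [zsmul_eq_mul, map_mul] at h2
  have h3 := h1 n.natAbs (by simpa using hn)
  have h4 : A.valuation (n : Ω) = 1 := by
    rcases Int.natAbs_eq n with h | h
    · rw [h, Int.cast_natCast]; exact h3
    · rw [h, Int.cast_neg, Int.cast_natCast, Valuation.map_neg]; exact h3
  rw [h4, one_mul] at h2
  exact (A.valuation_le_one_iff x).1 h2

/-- Tie: a power of every element has the valuation of a power of `p`. -/
theorem Over.tie [Algebra.IsAlgebraic ℚ Ω] {A : ValuationSubring Ω} {p : ℕ} (h : Over A p)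
    {x : Ω} (hx : x ≠ 0) :
    ∃ j : ℕ, 1 ≤ j ∧ j ≤ (minpoly ℚ x).natDegree ∧ ∃ k : ℤ, A.valuation x ^ j = A.valuation (p : Ω) ^ k := by
  classical
  set f := minpoly ℚ x with hf
  have hIntegral : IsIntegral ℚ x := (Algebra.IsAlgebraic.isAlgebraic x).isIntegral
  have hp0 : A.valuation (p : Ω) ≠ 0 := (v_pos (by exact_mod_cast h.1.ne_zero)).ne'
  have hvx : A.valuation x ≠ 0 := (v_pos hx).ne'
  set t : ℕ → Ω := fun i => (f.coeff i : Ω) * x ^ i with ht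
  have hsum : ∑ i ∈ Finset.range (f.natDegree + 1), t i = 0 := by
    have := minpoly.aeval ℚ x
    rw [aeval_eq_sum_range] at this
    simpa [Algebra.smul_def, ht] using this
  obtain ⟨i, hi, hmax⟩ := Finset.exists_max_image (Finset.range (f.natDegree + 1))
    (fun i => A.valuation (t i)) ⟨0, by simp⟩
  have hne : A.valuation (t i) ≠ 0 := by
    intro h0
    have := hmax f.natDegree (by simp)
    rw [h0] at this
    have h2 : t f.natDegree = 0 := by simpa using this
    have h3 : f.coeff f.natDegree = 1 := (minpoly.monic hIntegral).coeff_natDegree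
    simp [ht, h3, hx] at h2
  have : ∃ j ∈ Finset.range (f.natDegree + 1), j ≠ i ∧ A.valuation (t j) = A.valuation (t i) := by
    by_contra hc
    push Not at hc
    have := A.valuation.map_sum_eq_of_lt (s := Finset.range (f.natDegree + 1)) (f := t) hi
      (fun j hj => by
        rw [Finset.mem_sdiff, Finset.mem_singleton] at hj
        exact lt_of_le_of_ne (hmax j hj.1) (hc j hj.1 hj.2))
    rw [hsum, map_zero] at this
    exact hne this.symm
  obtain ⟨j, hj, hji, hv⟩ := this
  have main : ∀ a b : ℕ, a < b → b ∈ Finset.range (f.natDegree + 1) →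
      A.valuation (t a) = A.valuation (t b) → A.valuation (t b) ≠ 0 →
      ∃ j : ℕ, 1 ≤ j ∧ j ≤ f.natDegree ∧ ∃ k : ℤ, A.valuation x ^ j = A.valuation (p : Ω) ^ k := by
    intro a b hab hb hv hne
    have hca : f.coeff a ≠ 0 := by
      intro h0
      rw [← hv] at hne
      simp [ht, h0] at hne
    have hcb : f.coeff b ≠ 0 := by
      intro h0
      simp [ht, h0] at hne
    obtain ⟨k, hk⟩ := h.vrat hca
    obtain ⟨l, hl⟩ := h.vrat hcb
    refine ⟨b - a, by omega, by have := Finset.mem_range.1 hb; omega, k - l, ?_⟩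
    simp only [ht, map_mul, map_pow] at hv
    rw [hk, hl] at hv
    rw [zpow_sub₀ hp0, eq_div_iff (zpow_ne_zero _ hp0)]
    have : A.valuation x ^ b = A.valuation x ^ (b - a) * A.valuation x ^ a := by
      rw [← pow_add]; congr 1; omega
    rw [this] at hv
    have hxa : A.valuation x ^ a ≠ 0 := pow_ne_zero _ hvx
    apply mul_right_cancel₀ hxa
    rw [hv, mul_comm (A.valuation x ^ (b - a)), mul_assoc]
  rcases lt_or_gt_of_ne hji with hlt | hlt
  · exact main j i hlt hi hv hne
  · exact main i j hlt hj hv.symm (by rw [hv]; exact hne)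

theorem Over.zpow_lt {A : ValuationSubring Ω} {p : ℕ} (h : Over A p) {k l : ℤ} :
    A.valuation (p : Ω) ^ k < A.valuation (p : Ω) ^ l ↔ l < k := by
  have hp0 : (p : Ω) ≠ 0 := by exact_mod_cast h.1.ne_zero
  exact zpow_lt_zpow_iff_right_of_lt_one₀ (v_pos hp0) h.2

theorem Over.zpow_inj {A : ValuationSubring Ω} {p : ℕ} (h : Over A p) {k l : ℤ}
    (e : A.valuation (p : Ω) ^ k = A.valuation (p : Ω) ^ l) : k = l := by
  rcases lt_trichotomy k l with h1 | h1 | h1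
  · exact absurd e (h.zpow_lt.2 h1).ne'
  · exact h1
  · exact absurd e (h.zpow_lt.2 h1).ne

/-- Archimedean property. -/
theorem Over.arch [Algebra.IsAlgebraic ℚ Ω] {A : ValuationSubring Ω} {p : ℕ} (h : Over A p)
    {r : Ω} (hr : A.valuation r < 1) (y : Ω) :
    ∃ n : ℕ, ∀ m, n ≤ m → A.valuation y * A.valuation r ^ m < 1 := by
  by_cases hr0 : r = 0
  · refine ⟨1, fun m hm => ?_⟩
    rw [hr0, map_zero, zero_pow (by omega), mul_zero]; exact zero_lt_one
  by_cases hy0 : y = 0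
  · refine ⟨0, fun m _ => ?_⟩
    rw [hy0, map_zero, zero_mul]; exact zero_lt_one
  obtain ⟨j, hj, -, k, hk⟩ := h.tie hr0
  obtain ⟨i, hi, -, l, hl⟩ := h.tie hy0
  have hkpos : 0 < k := by
    rw [← h.zpow_lt (A := A), ← hk, zpow_zero]
    exact pow_lt_one₀ zero_le hr (by omega)
  refine ⟨l.natAbs * j + 1, fun m hm => ?_⟩
  have key : (A.valuation y * A.valuation r ^ m) ^ (i * j) < 1 := by
    have : (A.valuation y * A.valuation r ^ m) ^ (i * j) = A.valuation (p : Ω) ^ (l * j + k * (m * i)) := by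
      rw [mul_pow, pow_mul, hl, ← pow_mul, show m * (i * j) = j * (m * i) by ring, pow_mul, hk,
        zpow_add₀ (v_pos (by exact_mod_cast h.1.ne_zero)).ne', zpow_mul, zpow_mul]
      norm_cast
    rw [this, ← zpow_zero (A.valuation (p : Ω)), h.zpow_lt]
    have h1 : -(l.natAbs : ℤ) ≤ l := by omega
    have h2 : ((l.natAbs * j + 1 : ℕ) : ℤ) ≤ m := by exact_mod_cast hm
    push_cast at h2
    have h3 : (m : ℤ) ≤ k * (m * i) := by
      have : (1 : ℤ) ≤ k * i := by
        have : (1 : ℤ) ≤ i := by exact_mod_cast hi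
        nlinarith
      have hm0 : (0 : ℤ) ≤ m := by positivity
      nlinarith
    have h4 : -((l.natAbs : ℤ) * j) ≤ l * j := by
      have : (0 : ℤ) ≤ j := by positivity
      nlinarith
    rw [Int.natCast_natAbs] at *
    linarith
  by_contra hc
  push Not at hc
  exact absurd key (not_lt.2 (one_le_pow₀ hc))

end NU


namespace NU
open Polynomial
set_option linter.unusedSectionVars false

section loc
variable {E : Type*} [Field E] [CharZero E]

theorem loc_aux (B : ValuationSubring E) {x : E} (hx : B.valuation x ≤ 1) (n : ℕ) :
    ∀ f : (integralClosure ℤ E)[X], f.natDegree ≤ n → aeval x f = 0 →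
      (∃ i, B.valuation (f.coeff i : E) = 1) →
      ∃ b : E, IsIntegral ℤ b ∧ B.valuation b = 1 ∧ IsIntegral ℤ (b * x) := by
  induction n with
  | zero =>
    intro f hf h0 ⟨i, hi⟩
    exfalso
    rw [eq_C_of_natDegree_le_zero hf] at h0 hi
    rw [aeval_C] at h0
    have h1 : ((f.coeff 0 : integralClosure ℤ E) : E) = 0 := h0
    rcases Nat.eq_zero_or_pos i with rfl | hi0
    · rw [coeff_C_zero, h1] at hi
      simp at hi
    · rw [coeff_C_of_ne_zero hi0.ne'] at hi
      simp at hi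
  | succ n ih =>
    intro f hf h0 ⟨i, hi⟩
    by_cases hdeg : f.natDegree ≤ n
    · exact ih f hdeg h0 ⟨i, hi⟩
    have hd : f.natDegree = n + 1 := by omega
    have hIntegral : IsIntegral ℤ ((f.leadingCoeff : E) * x) :=
      isIntegral_trans (R := ℤ) (A := integralClosure ℤ E) _ (by
        have := isIntegral_leadingCoeff_smul (R := integralClosure ℤ E) (S := E) f x h0
        exact this)
    rcases (mem_of_int (A := B) f.leadingCoeff.2).lt_or_eq with hl | hl
    · set y : integralClosure ℤ E := ⟨(f.leadingCoeff : E) * x, hIntegral⟩ with hy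
      have hvy : B.valuation (y : E) < 1 := by
        rw [hy]; simp only [map_mul]
        exact mul_lt_one_of_nonneg_of_lt_one_left zero_le hl hx
      refine ih (f.eraseLead + C y * X ^ n) ?_ ?_ ?_
      · refine (natDegree_add_le _ _).trans (max_le ?_ (natDegree_C_mul_X_pow_le _ _))
        have := eraseLead_natDegree_le f
        omega
      · have h1 : f = f.eraseLead + C f.leadingCoeff * X ^ (n + 1) := by
          conv_lhs => rw [← eraseLead_add_C_mul_X_pow f, hd]
        rw [h1] at h0
        simp only [map_add, map_mul, aeval_C, map_pow, aeval_X] at h0 ⊢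
        rw [← h0]
        simp only [pow_succ]
        have h2 : algebraMap (integralClosure ℤ E) E y = algebraMap (integralClosure ℤ E) E f.leadingCoeff * x := rfl
        rw [h2]; ring
      · have hne : i ≠ n + 1 := by
          rintro rfl
          rw [leadingCoeff, hd] at hl
          exact hl.ne hi
        refine ⟨i, ?_⟩
        rw [coeff_add, eraseLead_coeff_of_ne _ (by rw [hd]; exact hne), coeff_C_mul_X_pow]
        split_ifs
        · push_cast
          rw [Valuation.map_add_eq_of_lt_left _ (by rw [hi]; exact hvy), hi]
        · simpa using hi
    · exact ⟨_, f.leadingCoeff.2, hl, hIntegral⟩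

theorem exists_prim [Algebra.IsAlgebraic ℚ E] (x : E) : ∃ f : ℤ[X], f.IsPrimitive ∧ aeval x f = 0 := by
  have : IsAlgebraic ℤ x := (IsFractionRing.isAlgebraic_iff ℤ ℚ E).2 (Algebra.IsAlgebraic.isAlgebraic x)
  obtain ⟨f, hf, hx⟩ := this
  exact ⟨f.primPart, f.isPrimitive_primPart, aeval_primPart_eq_zero hf hx⟩

theorem loc [Algebra.IsAlgebraic ℚ E] {B : ValuationSubring E} {p : ℕ} (hp : Over B p) {x : E} (hx : B.valuation x ≤ 1) :
    ∃ b : E, IsIntegral ℤ b ∧ B.valuation b = 1 ∧ IsIntegral ℤ (b * x) := by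
  obtain ⟨f, hf, h0⟩ := exists_prim x
  refine loc_aux B hx f.natDegree (f.map (algebraMap ℤ (integralClosure ℤ E))) natDegree_map_le
    (by rw [aeval_map_algebraMap]; exact h0) ?_
  by_contra hc
  push Not at hc
  have : ∀ i, (p : ℤ) ∣ f.coeff i := by
    intro i
    by_contra hd
    apply hc i
    rw [coeff_map]
    exact hp.coprime hd
  have h1 := hf (p : ℤ) ((C_dvd_iff_dvd_coeff _ _).2 this)
  have := Int.isUnit_iff.1 h1
  have := hp.1.two_le
  omega

end loc

variable {Ω : Type*} [Field Ω] [CharZero Ω]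

/-- Restriction of a place to a subfield. -/
abbrev res (F : IntermediateField ℚ Ω) (A : ValuationSubring Ω) : ValuationSubring F :=
  A.comap (algebraMap F Ω)

theorem res_le {F : IntermediateField ℚ Ω} {A : ValuationSubring Ω} (x : F) :
    (res F A).valuation x ≤ 1 ↔ A.valuation (x : Ω) ≤ 1 := by
  rw [ValuationSubring.valuation_le_one_iff, ValuationSubring.valuation_le_one_iff]
  rfl

theorem res_lt {F : IntermediateField ℚ Ω} {A : ValuationSubring Ω} (x : F) :
    (res F A).valuation x < 1 ↔ A.valuation (x : Ω) < 1 := by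
  by_cases hx : x = 0
  · simp [hx]
  have hx' : (x : Ω) ≠ 0 := by simpa using hx
  have h1 := res_le (A := A) x⁻¹
  rw [map_inv₀, IntermediateField.coe_inv, map_inv₀, inv_le_one₀ (v_pos hx), inv_le_one₀ (v_pos hx')] at h1
  rw [← not_le, ← not_le, h1]

theorem res_eq {F : IntermediateField ℚ Ω} {A : ValuationSubring Ω} (x : F) :
    (res F A).valuation x = 1 ↔ A.valuation (x : Ω) = 1 := by
  rw [eq_iff_le_not_lt, eq_iff_le_not_lt, res_le, res_lt]

theorem Over.res {A : ValuationSubring Ω} {p : ℕ} (h : Over A p) (F : IntermediateField ℚ Ω) :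
    Over (res F A) p := ⟨h.1, by
  rw [res_lt]; exact_mod_cast h.2⟩

variable [Algebra.IsAlgebraic ℚ Ω]

instance instAlgF (F : IntermediateField ℚ Ω) : @Algebra.IsAlgebraic ℚ F _ _ DivisionRing.toRatAlgebra := by
  refine ⟨fun x => ?_⟩
  have h := Algebra.IsAlgebraic.isAlgebraic (R := ℚ) (x : Ω)
  obtain ⟨f, hf, h0⟩ := h
  refine ⟨f, hf, ?_⟩
  apply (algebraMap F Ω).injective
  rw [map_zero, ← h0]
  simp only [aeval_def, hom_eval₂]
  congr 1

theorem Over.locF {A : ValuationSubring Ω} {p : ℕ} (h : Over A p) {F : IntermediateField ℚ Ω} {x : Ω}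
    (hxF : x ∈ F) (hx : A.valuation x ≤ 1) :
    ∃ b ∈ F, IsIntegral ℤ b ∧ A.valuation b = 1 ∧ IsIntegral ℤ (b * x) := by
  obtain ⟨b, h1, h2, h3⟩ := loc (h.res F) (x := ⟨x, hxF⟩) ((res_le _).2 hx)
  have hinj : Function.Injective (algebraMap F Ω) := (algebraMap F Ω).injective
  refine ⟨b, b.2, ?_, (res_eq b).1 h2, ?_⟩
  · exact h1.map (IsScalarTower.toAlgHom ℤ F Ω)
  · exact h3.map (IsScalarTower.toAlgHom ℤ F Ω)

theorem res_finite {E : Type*} [Field E] [NumberField E] {B : ValuationSubring E} {p : ℕ} (h : Over B p) :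
    Finite (IsLocalRing.ResidueField B) := by
  let φ : NumberField.RingOfIntegers E →+* B :=
    { toFun := fun x => ⟨x, (B.valuation_le_one_iff _).1 (mem_of_int x.2)⟩
      map_one' := rfl
      map_mul' := fun _ _ => rfl
      map_zero' := rfl
      map_add' := fun _ _ => rfl }
  let ψ := (IsLocalRing.residue B).comp φ
  have hker : RingHom.ker ψ ≠ ⊥ := by
    intro hb
    have : (p : NumberField.RingOfIntegers E) ∈ RingHom.ker ψ := by
      rw [RingHom.mem_ker]
      change IsLocalRing.residue B (φ p) = 0
      rw [IsLocalRing.residue_eq_zero_iff, ValuationSubring.valuation_lt_one_iff]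
      have := h.2
      simpa using this
    rw [hb] at this
    have h0 : (p : NumberField.RingOfIntegers E) = 0 := by simpa using this
    exact h.1.ne_zero (by exact_mod_cast h0)
  have hfin : Finite (NumberField.RingOfIntegers E ⧸ RingHom.ker ψ) :=
    Ideal.finiteQuotientOfFreeOfNeBot _ hker
  have hr : Finite ψ.range := Finite.of_equiv _ (RingHom.quotientKerEquivRange ψ).toEquiv
  refine Finite.of_surjective (fun q : ψ.range × ψ.range => (q.1 : IsLocalRing.ResidueField B) * (q.2 : IsLocalRing.ResidueField B)⁻¹) ?_
  intro z
  obtain ⟨x, rfl⟩ := IsLocalRing.residue_surjective z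
  obtain ⟨b, hb, hvb, hbx⟩ := loc h (x := (x : E)) (B.valuation_le_one x)
  refine ⟨⟨⟨ψ ⟨b * x, hbx⟩, _, rfl⟩, ⟨ψ ⟨b, hb⟩, _, rfl⟩⟩, ?_⟩
  have hne : ψ ⟨b, hb⟩ ≠ 0 := by
    change IsLocalRing.residue B (φ _) ≠ 0
    rw [ne_eq, IsLocalRing.residue_eq_zero_iff, ValuationSubring.valuation_lt_one_iff]
    change ¬ B.valuation b < 1
    rw [hvb]; exact lt_irrefl _
  change ψ ⟨b * x, hbx⟩ * (ψ ⟨b, hb⟩)⁻¹ = _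
  rw [← div_eq_mul_inv, div_eq_iff hne]
  change IsLocalRing.residue B (φ _) = IsLocalRing.residue B x * IsLocalRing.residue B (φ _)
  rw [← map_mul]
  congr 1
  apply Subtype.ext
  change b * x = x * b
  ring

/-- The residue field of a number field is finite: a generator of its units. -/
theorem Over.gen {A : ValuationSubring Ω} {p : ℕ} (h : Over A p) (F : IntermediateField ℚ Ω)
    [FiniteDimensional ℚ F] :
    ∃ c ∈ F, A.valuation c = 1 ∧ (∃ N : ℕ, 1 ≤ N ∧ A.valuation (c ^ N - 1) < 1) ∧
      ∀ u ∈ F, A.valuation u = 1 → ∃ i : ℕ, A.valuation (u - c ^ i) < 1 := by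
  have : NumberField F := ⟨⟩
  have := res_finite (h.res F)
  set k := IsLocalRing.ResidueField (NU.res F A)
  obtain ⟨g, hg⟩ := IsCyclic.exists_generator (α := kˣ)
  obtain ⟨c, hc⟩ := IsLocalRing.residue_surjective (R := NU.res F A) (g : k)
  have key : ∀ z : NU.res F A, IsLocalRing.residue _ z = 0 ↔ A.valuation ((z : F) : Ω) < 1 := by
    intro z
    rw [IsLocalRing.residue_eq_zero_iff, ValuationSubring.valuation_lt_one_iff, res_lt]
  have mem : ∀ z : NU.res F A, A.valuation ((z : F) : Ω) ≤ 1 := fun z =>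
    (A.valuation_le_one_iff _).2 z.2
  have hc1 : A.valuation ((c : F) : Ω) = 1 := by
    refine le_antisymm (mem c) ?_
    by_contra hlt
    push Not at hlt
    rw [← key, hc] at hlt
    exact g.ne_zero hlt
  refine ⟨(c : F), (c : F).2, hc1, ⟨orderOf g, orderOf_pos g, ?_⟩, ?_⟩
  · have := (key (c ^ orderOf g - 1)).1 (by
      rw [map_sub, map_pow, hc, map_one, ← Units.val_pow_eq_pow_val, pow_orderOf_eq_one]; simp)
    exact_mod_cast this
  · intro u hu hv
    let z : NU.res F A := ⟨⟨u, hu⟩, (A.valuation_le_one_iff _).1 hv.le⟩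
    have hz : IsLocalRing.residue _ z ≠ 0 := by
      rw [ne_eq, key]; change ¬ A.valuation u < 1; rw [hv]; exact lt_irrefl _
    obtain ⟨i, hi⟩ := (mem_powers_iff_mem_zpowers.2 (hg (Units.mk0 _ hz)) : Units.mk0 _ hz ∈ Submonoid.powers g)
    refine ⟨i, ?_⟩
    have := (key (z - c ^ i)).1 (by
      rw [map_sub, map_pow, hc, ← Units.val_pow_eq_pow_val]
      have := congrArg Units.val hi
      simp only at this
      rw [this]; simp)
    exact_mod_cast this

/-- Torsion of residue units. -/
theorem Over.fin {A : ValuationSubring Ω} {p : ℕ} (h : Over A p) {u : Ω} (hu : A.valuation u = 1) :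
    ∃ N : ℕ, 1 ≤ N ∧ A.valuation (u ^ N - 1) < 1 := by
  have hIntegral : IsIntegral ℚ u := (Algebra.IsAlgebraic.isAlgebraic u).isIntegral
  have : FiniteDimensional ℚ (IntermediateField.adjoin ℚ {u}) := IntermediateField.adjoin.finiteDimensional hIntegral
  obtain ⟨c, -, hc, ⟨N, hN, hcN⟩, hall⟩ := h.gen (IntermediateField.adjoin ℚ {u})
  obtain ⟨i, hi⟩ := hall u (IntermediateField.mem_adjoin_simple_self ℚ u) hu
  refine ⟨N, hN, ?_⟩
  have e : u ^ N - 1 = (u ^ N - (c ^ i) ^ N) + ((c ^ N) ^ i - 1 ^ i) := by ring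
  rw [e]
  have key : ∀ (x y : Ω) (m : ℕ), A.valuation x ≤ 1 → A.valuation y ≤ 1 → A.valuation (x - y) < 1 →
      A.valuation (x ^ m - y ^ m) < 1 := by
    intro x y m hx hy hxy
    obtain ⟨d, hd⟩ := sub_dvd_pow_sub_pow (⟨x, (A.valuation_le_one_iff x).1 hx⟩ : A)
      ⟨y, (A.valuation_le_one_iff y).1 hy⟩ m
    have hd' : x ^ m - y ^ m = (x - y) * d := congrArg Subtype.val hd
    rw [hd', map_mul]
    exact mul_lt_one_of_nonneg_of_lt_one_left zero_le hxy (A.valuation_le_one d)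
  refine A.valuation.map_add_lt (key _ _ _ hu.le ?_ hi) (key _ _ _ ?_ ?_ hcN)
  · rw [map_pow, hc, one_pow]
  · rw [map_pow, hc, one_pow]
  · simp

end NU


namespace NU
open Polynomial
open scoped Pointwise
set_option linter.unusedSectionVars false

variable {Ω : Type*} [Field Ω] [CharZero Ω]

theorem mul_lt_one' {A : ValuationSubring Ω} {x y : Ω} (hx : A.valuation x < 1) (hy : A.valuation y ≤ 1) :
    A.valuation (x * y) < 1 := by
  rw [map_mul]; exact mul_lt_one_of_nonneg_of_lt_one_left zero_le hx hy

theorem pow_sub_lt {A : ValuationSubring Ω} {x y : Ω} (m : ℕ) (hx : A.valuation x ≤ 1)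
    (hy : A.valuation y ≤ 1) (hxy : A.valuation (x - y) < 1) : A.valuation (x ^ m - y ^ m) < 1 := by
  obtain ⟨d, hd⟩ := sub_dvd_pow_sub_pow (⟨x, (A.valuation_le_one_iff x).1 hx⟩ : A)
    ⟨y, (A.valuation_le_one_iff y).1 hy⟩ m
  have hd' : x ^ m - y ^ m = (x - y) * d := congrArg Subtype.val hd
  rw [hd']
  exact mul_lt_one' hxy (A.valuation_le_one d)

/-- congruent to a unit -/
theorem eq_one_of_sub_lt {A : ValuationSubring Ω} {x y : Ω} (hy : A.valuation y = 1)
    (h : A.valuation (x - y) < 1) : A.valuation x = 1 := by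
  have : x = y + (x - y) := by ring
  rw [this, Valuation.map_add_eq_of_lt_left _ (by rwa [hy]), hy]

variable [Algebra.IsAlgebraic ℚ Ω]

theorem max_le {A B : ValuationSubring Ω} (hA : A ≠ ⊤) (hB : B ≠ ⊤) (L : IntermediateField ℚ Ω)
    (h : ∀ x ∈ L, A.valuation x ≤ 1 → B.valuation x ≤ 1) :
    ∀ x ∈ L, B.valuation x ≤ 1 → A.valuation x ≤ 1 := by
  intro x hx hBx
  by_contra hAx
  push Not at hAx
  obtain ⟨q, hq⟩ := exists_over hA
  obtain ⟨p, hp⟩ := exists_over hB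
  have hx0 : x ≠ 0 := by rintro rfl; simp at hAx
  have hr : A.valuation x⁻¹ < 1 := by
    rw [map_inv₀]; exact inv_lt_one_of_one_lt₀ hAx
  obtain ⟨n, hn⟩ := hq.arch hr ((p : Ω)⁻¹)
  have h1 := (hn n le_rfl).le
  rw [← map_pow, ← map_mul] at h1
  have h2 := h _ (mul_mem (inv_mem (natCast_mem L p)) (pow_mem (inv_mem hx) n)) h1
  have h3 : B.valuation ((p : Ω)⁻¹ * x⁻¹ ^ n * x ^ n) ≤ 1 := by
    rw [map_mul]; exact mul_le_one' h2 (by rw [map_pow]; exact pow_le_one₀ zero_le hBx)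
  rw [mul_assoc, ← mul_pow, inv_mul_cancel₀ hx0, one_pow, mul_one, map_inv₀,
    inv_le_one₀ (v_pos (by exact_mod_cast hp.1.ne_zero))] at h3
  exact absurd hp.2 (not_lt.2 h3)

/-- Same restriction to `L`. -/
def Same (L : IntermediateField ℚ Ω) (A B : ValuationSubring Ω) : Prop :=
  ∀ x ∈ L, A.valuation x ≤ 1 ↔ B.valuation x ≤ 1

theorem Same.symm {L : IntermediateField ℚ Ω} {A B : ValuationSubring Ω} (h : Same L A B) :
    Same L B A := fun x hx => (h x hx).symm

theorem Same.trans {L : IntermediateField ℚ Ω} {A B C : ValuationSubring Ω} (h : Same L A B)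
    (h' : Same L B C) : Same L A C := fun x hx => (h x hx).trans (h' x hx)

theorem Same.mono {L M : IntermediateField ℚ Ω} {A B : ValuationSubring Ω} (h : Same L A B)
    (hM : M ≤ L) : Same M A B := fun x hx => h x (hM hx)

theorem Same.lt {L : IntermediateField ℚ Ω} {A B : ValuationSubring Ω} (h : Same L A B) {x : Ω}
    (hx : x ∈ L) : A.valuation x < 1 ↔ B.valuation x < 1 := by
  by_cases hx0 : x = 0
  · simp [hx0]
  have h1 := h _ (inv_mem hx)
  rw [map_inv₀, map_inv₀, inv_le_one₀ (v_pos hx0), inv_le_one₀ (v_pos hx0)] at h1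
  rw [← not_le, ← not_le, h1]

theorem Same.over {L : IntermediateField ℚ Ω} {A B : ValuationSubring Ω} (h : Same L A B) {p : ℕ}
    (hp : Over A p) : Over B p := ⟨hp.1, (h.lt (natCast_mem L p)).1 hp.2⟩

/-- Approximation for two distinct places. -/
theorem approx {A B : ValuationSubring Ω} (hA : A ≠ ⊤) (hB : B ≠ ⊤) {L : IntermediateField ℚ Ω}
    (h : ¬ Same L A B) {a : Ω} (ha : a ∈ L) (ha0 : a ≠ 0) :
    ∃ b ∈ L, A.valuation (b / a - 1) < 1 ∧ B.valuation (b - 1) < 1 := by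
  have h1 : ∃ s ∈ L, A.valuation s ≤ 1 ∧ 1 < B.valuation s := by
    by_contra hc
    push Not at hc
    exact h fun x hx => ⟨hc x hx, max_le hA hB L hc x hx⟩
  have h2 : ∃ t ∈ L, B.valuation t ≤ 1 ∧ 1 < A.valuation t := by
    by_contra hc
    push Not at hc
    exact h fun x hx => ⟨max_le hB hA L hc x hx, hc x hx⟩
  obtain ⟨s, hs, hsA, hsB⟩ := h1
  obtain ⟨t, ht, htB, htA⟩ := h2
  have ht0 : t ≠ 0 := by rintro rfl; simp at htA
  have hs0 : s ≠ 0 := by rintro rfl; simp at hsB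
  obtain ⟨q, hq⟩ := exists_over hA
  obtain ⟨p, hp⟩ := exists_over hB
  set r := s / t with hrdef
  have hr0 : r ≠ 0 := div_ne_zero hs0 ht0
  have hrL : r ∈ L := div_mem hs ht
  have hrA : A.valuation r < 1 := by
    rw [hrdef, map_div₀, div_lt_one₀ (v_pos ht0)]; exact hsA.trans_lt htA
  have hrB : B.valuation r⁻¹ < 1 := by
    rw [hrdef, inv_div, map_div₀, div_lt_one₀ (v_pos hs0)]; exact htB.trans_lt hsB
  obtain ⟨n1, hn1⟩ := hq.arch hrA (1 / a - 1)
  obtain ⟨n2, hn2⟩ := hp.arch hrB (a - 1)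
  set n := max (max n1 n2) 1
  have hnA := hn1 n ((le_max_left _ _).trans (le_max_left _ _))
  have hnB := hn2 n ((le_max_right _ _).trans (le_max_left _ _))
  have hn : n ≠ 0 := by have := le_max_right (max n1 n2) 1; omega
  have hrnA : A.valuation (r ^ n) < 1 := by rw [map_pow]; exact pow_lt_one₀ zero_le hrA hn
  have hrnB : B.valuation (r⁻¹ ^ n) < 1 := by rw [map_pow]; exact pow_lt_one₀ zero_le hrB hn
  have h1r : A.valuation (1 + r ^ n) = 1 := A.valuation.map_one_add_of_lt hrnA
  have h1r' : B.valuation (1 + r⁻¹ ^ n) = 1 := B.valuation.map_one_add_of_lt hrnB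
  have hne : 1 + r ^ n ≠ 0 := by intro h0; rw [h0] at h1r; simp at h1r
  have hne' : 1 + r⁻¹ ^ n ≠ 0 := by intro h0; rw [h0] at h1r'; simp at h1r'
  refine ⟨a * (1 + r ^ n)⁻¹ + (1 - (1 + r ^ n)⁻¹), ?_, ?_, ?_⟩
  · have : (1 + r ^ n)⁻¹ ∈ L := inv_mem (add_mem (one_mem L) (pow_mem hrL n))
    exact add_mem (mul_mem ha this) (sub_mem (one_mem L) this)
  · have e : (a * (1 + r ^ n)⁻¹ + (1 - (1 + r ^ n)⁻¹)) / a - 1 = (1 / a - 1) * r ^ n / (1 + r ^ n) := by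
      field_simp; ring
    rw [e, map_div₀, h1r, div_one, map_mul, map_pow]; exact hnA
  · have e : a * (1 + r ^ n)⁻¹ + (1 - (1 + r ^ n)⁻¹) - 1 = (a - 1) * r⁻¹ ^ n / (1 + r⁻¹ ^ n) := by
      have hrn : r ^ n ≠ 0 := pow_ne_zero _ hr0
      rw [inv_pow] at hne' ⊢
      have : 1 + (r ^ n)⁻¹ = (1 + r ^ n) / r ^ n := by field_simp; ring
      rw [this]; field_simp; ring
    rw [e, map_div₀, h1r', div_one, map_mul, map_pow]; exact hnB

/-- Uniformizer of a number field. -/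
theorem Over.unif {A : ValuationSubring Ω} {p : ℕ} (h : Over A p) (F : IntermediateField ℚ Ω)
    [FiniteDimensional ℚ F] :
    ∃ π ∈ F, π ≠ 0 ∧ A.valuation π < 1 ∧ ∀ x ∈ F, x ≠ 0 → ∃ k : ℤ, A.valuation x = A.valuation π ^ k := by
  classical
  set N := (Module.finrank ℚ F).factorial with hN
  have hNpos : 0 < N := Nat.factorial_pos _
  have hp0 : A.valuation (p : Ω) ≠ 0 := (v_pos (by exact_mod_cast h.1.ne_zero)).ne'
  have key : ∀ x ∈ F, x ≠ 0 → ∃ k : ℤ, A.valuation x ^ N = A.valuation (p : Ω) ^ k := by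
    intro x hx hx0
    obtain ⟨j, hj, hjd, k, hk⟩ := h.tie hx0
    have hdeg : (minpoly ℚ x).natDegree ≤ Module.finrank ℚ F := by
      have := minpoly.natDegree_le (A := ℚ) (⟨x, hx⟩ : F)
      rwa [← minpoly.algebraMap_eq (algebraMap F Ω).injective (⟨x, hx⟩ : F)] at this
    obtain ⟨m, hm⟩ : j ∣ N := Nat.dvd_factorial (by omega) (hjd.trans hdeg)
    refine ⟨k * m, ?_⟩
    rw [hm, pow_mul, hk, zpow_mul, zpow_natCast]
  have hex : ∃ k : ℕ, 0 < k ∧ ∃ x ∈ F, x ≠ 0 ∧ A.valuation x ^ N = A.valuation (p : Ω) ^ k :=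
    ⟨N, hNpos, p, natCast_mem F p, by exact_mod_cast h.1.ne_zero, rfl⟩
  obtain ⟨hk, π, hπ, hπ0, hπk⟩ := Nat.find_spec hex
  set k := Nat.find hex with hkdef
  have hv0 := (v_pos (A := A) hπ0).ne'
  refine ⟨π, hπ, hπ0, ?_, ?_⟩
  · by_contra hc
    push Not at hc
    have h1 : 1 ≤ A.valuation π ^ N := one_le_pow₀ hc
    rw [hπk] at h1
    exact absurd (pow_lt_one₀ zero_le h.2 hk.ne') (not_lt.2 h1)
  · intro x hx hx0
    obtain ⟨l, hl⟩ := key x hx hx0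
    refine ⟨l / k, ?_⟩
    have hy0 : x / π ^ (l / k) ≠ 0 := div_ne_zero hx0 (zpow_ne_zero _ hπ0)
    have hyv : A.valuation (x / π ^ (l / k)) ^ N = A.valuation (p : Ω) ^ (l % k) := by
      rw [map_div₀, map_zpow₀, div_pow, hl, ← zpow_natCast, ← zpow_mul, mul_comm, zpow_mul, zpow_natCast, hπk,
        ← zpow_natCast, ← zpow_mul, ← zpow_sub₀ hp0, Int.emod_def]
    have hnn : 0 ≤ l % k := Int.emod_nonneg _ (by omega)
    have hlt : l % k < k := Int.emod_lt_of_pos _ (by omega)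
    have hz : l % k = 0 := by
      by_contra hne
      have hmin := Nat.find_min hex (m := (l % k).toNat) (by omega)
      apply hmin
      refine ⟨by omega, _, div_mem hx (zpow_mem hπ _), hy0, ?_⟩
      rw [hyv, ← zpow_natCast, Int.toNat_of_nonneg hnn]
    rw [hz, zpow_zero] at hyv
    have h1 : A.valuation (x / π ^ (l / k)) = 1 := (pow_eq_one_iff_of_nonneg zero_le hNpos.ne').1 hyv
    rw [map_div₀, map_zpow₀, div_eq_one_iff_eq (zpow_ne_zero _ hv0)] at h1
    exact h1

end NU


namespace NU
open Polynomial
open scoped Pointwise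
set_option linter.unusedSectionVars false
set_option linter.style.haveILetI false
set_option linter.unusedVariables false

variable {Ω : Type*} [Field Ω] [CharZero Ω]

theorem smul_le {g : Gal(Ω/ℚ)} {A : ValuationSubring Ω} {x : Ω} :
    (g • A).valuation x ≤ 1 ↔ A.valuation (g⁻¹ x) ≤ 1 := by
  rw [ValuationSubring.valuation_le_one_iff, ValuationSubring.valuation_le_one_iff,
    ValuationSubring.mem_pointwise_smul_iff_inv_smul_mem]; rfl

theorem smul_lt {g : Gal(Ω/ℚ)} {A : ValuationSubring Ω} {x : Ω} :
    (g • A).valuation x < 1 ↔ A.valuation (g⁻¹ x) < 1 := by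
  by_cases hx : x = 0
  · simp [hx]
  have hx' : g⁻¹ x ≠ 0 := by simpa using hx
  have h1 := smul_le (g := g) (A := A) (x := x⁻¹)
  rw [map_inv₀, map_inv₀ g⁻¹, map_inv₀, inv_le_one₀ (v_pos hx), inv_le_one₀ (v_pos hx')] at h1
  rw [← not_le, ← not_le, h1]

theorem smul_lt' {g : Gal(Ω/ℚ)} {A : ValuationSubring Ω} {x : Ω} :
    (g • A).valuation (g x) < 1 ↔ A.valuation x < 1 := by
  rw [smul_lt, ← AlgEquiv.mul_apply]; simp

theorem smul_le' {g : Gal(Ω/ℚ)} {A : ValuationSubring Ω} {x : Ω} :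
    (g • A).valuation (g x) ≤ 1 ↔ A.valuation x ≤ 1 := by
  rw [smul_le, ← AlgEquiv.mul_apply]; simp

theorem Over.smul {A : ValuationSubring Ω} {p : ℕ} (h : Over A p) (g : Gal(Ω/ℚ)) : Over (g • A) p :=
  ⟨h.1, by rw [smul_lt]; simpa using h.2⟩

theorem Over.of_smul {A : ValuationSubring Ω} {p : ℕ} {g : Gal(Ω/ℚ)} (h : Over (g • A) p) : Over A p := by
  simpa using h.smul g⁻¹

/-- decomposition group -/
abbrev Dec (A : ValuationSubring Ω) : Subgroup Gal(Ω/ℚ) := MulAction.stabilizer Gal(Ω/ℚ) A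

theorem Dec.le {A : ValuationSubring Ω} {g : Gal(Ω/ℚ)} (hg : g ∈ Dec A) {x : Ω} :
    A.valuation (g x) ≤ 1 ↔ A.valuation x ≤ 1 := by
  have := smul_le' (g := g) (A := A) (x := x)
  rwa [MulAction.mem_stabilizer_iff.1 hg] at this

theorem Dec.lt {A : ValuationSubring Ω} {g : Gal(Ω/ℚ)} (hg : g ∈ Dec A) {x : Ω} :
    A.valuation (g x) < 1 ↔ A.valuation x < 1 := by
  have := smul_lt' (g := g) (A := A) (x := x)
  rwa [MulAction.mem_stabilizer_iff.1 hg] at this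

theorem mem_Dec {A : ValuationSubring Ω} {g : Gal(Ω/ℚ)} (h : ∀ x, A.valuation (g x) ≤ 1 ↔ A.valuation x ≤ 1) :
    g ∈ Dec A := by
  rw [MulAction.mem_stabilizer_iff]
  ext x
  rw [← ValuationSubring.valuation_le_one_iff, ← ValuationSubring.valuation_le_one_iff, smul_le, ← h,
    ← AlgEquiv.mul_apply]
  simp

theorem Dec_smul (A : ValuationSubring Ω) (g h : Gal(Ω/ℚ)) : h ∈ Dec (g • A) ↔ g⁻¹ * h * g ∈ Dec A := by
  rw [MulAction.mem_stabilizer_iff, MulAction.mem_stabilizer_iff, mul_smul, mul_smul, inv_smul_eq_iff]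

variable [Algebra.IsAlgebraic ℚ Ω]

theorem Dec.val {A : ValuationSubring Ω} (hA : A ≠ ⊤) {g : Gal(Ω/ℚ)} (hg : g ∈ Dec A) (x : Ω) :
    A.valuation (g x) = A.valuation x := by
  by_cases hx : x = 0
  · simp [hx]
  obtain ⟨p, hp⟩ := exists_over hA
  obtain ⟨j, hj, -, k, hk⟩ := hp.tie hx
  have h1 : A.valuation (x ^ j / (p : Ω) ^ k) = 1 := by
    rw [map_div₀, map_pow, map_zpow₀, hk, div_self]
    exact zpow_ne_zero _ (v_pos (by exact_mod_cast hp.1.ne_zero)).ne'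
  have h2 : A.valuation (g (x ^ j / (p : Ω) ^ k)) = 1 := by
    rw [eq_iff_le_not_lt, Dec.le hg, Dec.lt hg, ← eq_iff_le_not_lt, h1]
  rw [map_div₀, map_zpow₀, map_pow, map_natCast, map_div₀, map_zpow₀,
    div_eq_one_iff_eq (zpow_ne_zero _ (v_pos (by exact_mod_cast hp.1.ne_zero)).ne'), ← hk, map_pow] at h2
  exact (pow_left_inj₀ zero_le zero_le (by omega)).1 h2

theorem det {A B : ValuationSubring Ω} (hA : A ≠ ⊤) (hB : B ≠ ⊤)
    (h : ∀ x, IsIntegral ℤ x → (A.valuation x < 1 ↔ B.valuation x < 1)) : A = B := by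
  have key : ∀ {A B : ValuationSubring Ω}, A ≠ ⊤ →
      (∀ x, IsIntegral ℤ x → (A.valuation x < 1 ↔ B.valuation x < 1)) → A ≤ B := by
    intro A B hA h x hx
    obtain ⟨p, hp⟩ := exists_over hA
    obtain ⟨b, hb, hvb, hbx⟩ := loc hp ((A.valuation_le_one_iff x).2 hx)
    have h1 : B.valuation b = 1 := by
      refine le_antisymm (mem_of_int hb) (not_lt.1 fun h' => ?_)
      rw [← h b hb, hvb] at h'
      exact lt_irrefl _ h'
    have h2 := mem_of_int (A := B) hbx
    rw [map_mul, h1, one_mul] at h2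
    exact (B.valuation_le_one_iff x).1 h2
  exact le_antisymm (key hA h) (key hB fun x hx => (h x hx).symm)

/-- the prime of the ring of all algebraic integers below a place -/
def PP (A : ValuationSubring Ω) : Ideal (integralClosure ℤ Ω) where
  carrier := {x | A.valuation (x : Ω) < 1}
  add_mem' := fun {a b} ha hb => A.valuation.map_add_lt ha hb
  zero_mem' := by simp
  smul_mem' := fun c x hx => by
    have := mul_lt_one' hx (mem_of_int (A := A) c.2)
    rw [mul_comm] at this
    exact this

theorem mem_PP {A : ValuationSubring Ω} {x : integralClosure ℤ Ω} : x ∈ PP A ↔ A.valuation (x : Ω) < 1 := Iff.rfl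

instance (A : ValuationSubring Ω) : (PP A).IsPrime := by
  refine ⟨?_, ?_⟩
  · rw [Ideal.ne_top_iff_one, mem_PP]; simp
  · intro x y hxy
    rw [mem_PP] at hxy ⊢
    rw [mem_PP]
    by_contra hc
    push Not at hc
    have hx := le_antisymm (mem_of_int (A := A) x.2) hc.1
    have hy := le_antisymm (mem_of_int (A := A) y.2) hc.2
    simp [hx, hy] at hxy

/-- one-sided containment implies equality, elementwise -/
theorem one_side {A B : ValuationSubring Ω} (hB : B ≠ ⊤) {L : IntermediateField ℚ Ω}
    (h : ∀ x ∈ L, IsIntegral ℤ x → A.valuation x < 1 → B.valuation x < 1) (hA : A ≠ ⊤) :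
    ∀ x ∈ L, IsIntegral ℤ x → (A.valuation x < 1 ↔ B.valuation x < 1) := by
  intro x hx hi
  refine ⟨h x hx hi, fun hBx => ?_⟩
  by_contra hAx
  push Not at hAx
  obtain ⟨p, hp⟩ := exists_over hA
  obtain ⟨N, hN, h1⟩ := hp.fin (le_antisymm (mem_of_int (A := A) hi) hAx)
  have h2 := h _ (sub_mem (pow_mem hx N) (one_mem L)) ((hi.pow N).sub isIntegral_one) h1
  have h3 : B.valuation (x ^ N - (x ^ N - 1)) < 1 :=
    B.valuation.map_sub_lt (by rw [map_pow]; exact pow_lt_one₀ zero_le hBx (by omega)) h2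
  simp at h3

variable [IsAlgClosed Ω]

instance instGalois : IsGalois ℚ Ω := by
  have : IsAlgClosure ℚ Ω := ⟨inferInstance, inferInstance⟩
  have := IsAlgClosure.normal ℚ Ω
  exact ⟨⟩

theorem trans_int {A B : ValuationSubring Ω} (hA : A ≠ ⊤) (hB : B ≠ ⊤) {U : Subgroup Gal(Ω/ℚ)}
    (hU : IsClosed (U : Set Gal(Ω/ℚ)))
    (h : ∀ x ∈ IntermediateField.fixedField U, IsIntegral ℤ x → A.valuation x < 1 → B.valuation x < 1) :
    ∃ g ∈ U, g • A = B := by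
  have hiff := one_side hB h hA
  let R := integralClosure ℤ Ω
  letI : TopologicalSpace R := ⊥
  haveI : DiscreteTopology R := ⟨rfl⟩
  haveI : CompactSpace U := isCompact_iff_compactSpace.1 hU.isCompact
  haveI : ContinuousSMul U R := by
    rw [continuousSMul_iff_stabilizer_isOpen]
    intro x
    have := (stabilizer_isOpen_of_isIntegral (K := ℚ) (x : Ω)).preimage (continuous_subtype_val (p := fun g => g ∈ U))
    convert this using 1
    ext g
    simp only [SetLike.mem_coe, MulAction.mem_stabilizer_iff, Set.mem_preimage]
    rw [Subtype.ext_iff]; rfl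
  haveI : TotallyDisconnectedSpace U := inferInstance
  let R0 := FixedPoints.subalgebra ℤ R U
  haveI : SMulCommClass U R0 R := ⟨fun g a b => by
    rw [Algebra.smul_def, Algebra.smul_def, smul_mul']
    congr 1
    exact a.2 g⟩
  haveI : Algebra.IsInvariant R0 R U := ⟨fun b hb => ⟨⟨b, hb⟩, rfl⟩⟩
  have hPQ : (PP A).under R0 = (PP B).under R0 := by
    ext x
    change ((x : R) ∈ PP A ↔ (x : R) ∈ PP B)
    rw [mem_PP, mem_PP]
    refine hiff _ ?_ (x : R).2
    rw [IntermediateField.mem_fixedField_iff]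
    intro g hg
    exact congrArg Subtype.val (x.2 ⟨g, hg⟩)
  obtain ⟨g, hg⟩ := Algebra.IsInvariant.exists_smul_of_under_eq_of_profinite (A := R0) (G := U)
    (PP A) (PP B) hPQ
  refine ⟨g, g.2, ?_⟩
  obtain ⟨p, hp⟩ := exists_over hA
  refine det (hp.smul g).ne_top hB fun x hx => ?_
  rw [smul_lt]
  have h1 : ∀ y : R, y ∈ PP B ↔ g⁻¹ • y ∈ PP A := fun y => by
    rw [hg]; exact Ideal.mem_pointwise_smul_iff_inv_smul_mem
  exact (h1 ⟨x, hx⟩).symm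

theorem mem_fix {U : Subgroup Gal(Ω/ℚ)} {x : Ω} :
    x ∈ IntermediateField.fixedField U ↔ ∀ g ∈ U, g x = x := IntermediateField.mem_fixedField_iff _ _

theorem trans {A B : ValuationSubring Ω} (hA : A ≠ ⊤) (hB : B ≠ ⊤) {U : Subgroup Gal(Ω/ℚ)}
    (hU : IsClosed (U : Set Gal(Ω/ℚ))) (h : Same (IntermediateField.fixedField U) A B) :
    ∃ g ∈ U, g • A = B :=
  trans_int hA hB hU fun x hx _ => (h.lt hx).1

theorem same_smul {A : ValuationSubring Ω} {L : IntermediateField ℚ Ω} {g : Gal(Ω/ℚ)}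
    (hg : ∀ x ∈ L, g x = x) : Same L A (g • A) := by
  intro x hx
  rw [← smul_le' (g := g), hg x hx]

theorem closed_fixing (L : IntermediateField ℚ Ω) : IsClosed (L.fixingSubgroup : Set Gal(Ω/ℚ)) :=
  InfiniteGalois.fixingSubgroup_isClosed L

theorem fixing_fix {U : Subgroup Gal(Ω/ℚ)} (hU : IsClosed (U : Set Gal(Ω/ℚ))) :
    (IntermediateField.fixedField U).fixingSubgroup = U :=
  InfiniteGalois.fixingSubgroup_fixedField ⟨U, hU⟩

theorem fix_fixing (L : IntermediateField ℚ Ω) : IntermediateField.fixedField L.fixingSubgroup = L :=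
  InfiniteGalois.fixedField_fixingSubgroup L

theorem Dec_closed {A : ValuationSubring Ω} : IsClosed (Dec A : Set Gal(Ω/ℚ)) := by
  have : (Dec A : Set Gal(Ω/ℚ)) = ⋂ x : Ω, {g | A.valuation (g x) ≤ 1 ↔ A.valuation x ≤ 1} := by
    ext g
    simp only [Set.mem_iInter, Set.mem_ofPred_eq]
    exact ⟨fun hg x => Dec.le hg, fun h => mem_Dec h⟩
  rw [this]
  refine isClosed_iInter fun x => ?_
  letI : TopologicalSpace Ω := ⊥
  haveI : DiscreteTopology Ω := ⟨rfl⟩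
  have hc : Continuous fun g : Gal(Ω/ℚ) => g x := by
    have : ContinuousSMul Gal(Ω/ℚ) Ω := by
      rw [continuousSMul_iff_stabilizer_isOpen]
      exact fun y => stabilizer_isOpen_of_isIntegral (K := ℚ) y
    exact continuous_id.smul (continuous_const (y := x))
  exact (isClosed_discrete {y : Ω | A.valuation y ≤ 1 ↔ A.valuation x ≤ 1}).preimage hc

end NU


namespace NU
open Polynomial
open scoped Pointwise
set_option linter.unusedSectionVars false
set_option linter.style.haveILetI false
set_option linter.unusedVariables false

variable {Ω : Type*} [Field Ω] [CharZero Ω]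

/-- fixed field -/
abbrev fx (U : Subgroup Gal(Ω/ℚ)) : IntermediateField ℚ Ω := IntermediateField.fixedField U

/-- relatively open subgroup -/
def OpenIn (U D : Subgroup Gal(Ω/ℚ)) : Prop :=
  U ≤ D ∧ IsClosed (U : Set Gal(Ω/ℚ)) ∧ U.relIndex D ≠ 0

/-- stabilizer of an element -/
def st (U : Subgroup Gal(Ω/ℚ)) (s : Ω) : Subgroup Gal(Ω/ℚ) := U ⊓ MulAction.stabilizer Gal(Ω/ℚ) s

theorem mem_st {U : Subgroup Gal(Ω/ℚ)} {s : Ω} {g : Gal(Ω/ℚ)} : g ∈ st U s ↔ g ∈ U ∧ g s = s := by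
  rw [st, Subgroup.mem_inf, MulAction.mem_stabilizer_iff]; rfl

theorem st_le {U : Subgroup Gal(Ω/ℚ)} {s : Ω} : st U s ≤ U := inf_le_left

theorem OpenIn.trans {U V D : Subgroup Gal(Ω/ℚ)} (h : OpenIn U V) (h' : OpenIn V D) : OpenIn U D :=
  ⟨h.1.trans h'.1, h.2.1, Subgroup.relIndex_ne_zero_trans h.2.2 h'.2.2⟩

theorem OpenIn.refl {U : Subgroup Gal(Ω/ℚ)} (h : IsClosed (U : Set Gal(Ω/ℚ))) : OpenIn U U :=
  ⟨le_rfl, h, by simp⟩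

theorem OpenIn.sub {U V D : Subgroup Gal(Ω/ℚ)} (h : OpenIn U D) (h1 : U ≤ V) (h2 : V ≤ D) : OpenIn U V :=
  ⟨h1, h.2.1, fun h0 => h.2.2 (by rw [← Subgroup.relIndex_mul_relIndex U V D h1 h2, h0, zero_mul])⟩

theorem OpenIn.inf {U V D : Subgroup Gal(Ω/ℚ)} (h : OpenIn U D) (h' : OpenIn V D) : OpenIn (U ⊓ V) D :=
  ⟨inf_le_left.trans h.1, h.2.1.inter h'.2.1, Subgroup.relIndex_inf_ne_zero h.2.2 h'.2.2⟩

variable [Algebra.IsAlgebraic ℚ Ω]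

theorem open_stab (s : Ω) : IsOpen (MulAction.stabilizer Gal(Ω/ℚ) s : Set Gal(Ω/ℚ)) :=
  stabilizer_isOpen_of_isIntegral (K := ℚ) s

variable [IsAlgClosed Ω]

theorem fi_of_open {V : Subgroup Gal(Ω/ℚ)} (h : IsOpen (V : Set Gal(Ω/ℚ))) : V.index ≠ 0 := by
  haveI := Subgroup.quotient_finite_of_isOpen V h
  haveI := Subgroup.finiteIndex_of_finite_quotient (H := V)
  exact Subgroup.FiniteIndex.index_ne_zero

theorem rel_of_open {V : Subgroup Gal(Ω/ℚ)} (h : IsOpen (V : Set Gal(Ω/ℚ))) (U : Subgroup Gal(Ω/ℚ)) :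
    V.relIndex U ≠ 0 := by
  have := fi_of_open h
  rw [← Subgroup.relIndex_top_right] at this
  exact fun h0 => this (Subgroup.relIndex_eq_zero_of_le_right le_top h0)

theorem openIn_inf {U V : Subgroup Gal(Ω/ℚ)} (hU : IsClosed (U : Set Gal(Ω/ℚ)))
    (hV : IsOpen (V : Set Gal(Ω/ℚ))) : OpenIn (U ⊓ V) U :=
  ⟨inf_le_left, hU.inter (V.isClosed_of_isOpen hV), by
    rw [Subgroup.inf_relIndex_left]; exact rel_of_open hV U⟩

theorem openIn_st {U : Subgroup Gal(Ω/ℚ)} (hU : IsClosed (U : Set Gal(Ω/ℚ))) (s : Ω) : OpenIn (st U s) U :=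
  openIn_inf hU (open_stab s)

theorem le_of_fx {U V : Subgroup Gal(Ω/ℚ)} (hV : IsClosed (V : Set Gal(Ω/ℚ))) (h : fx V ≤ fx U) : U ≤ V := by
  rw [← fixing_fix hV]
  intro g hg
  rw [IntermediateField.mem_fixingSubgroup_iff]
  exact fun x hx => mem_fix.1 (h hx) g hg

theorem mem_of_fx {U : Subgroup Gal(Ω/ℚ)} (hU : IsClosed (U : Set Gal(Ω/ℚ))) {g : Gal(Ω/ℚ)}
    (h : ∀ x ∈ fx U, g x = x) : g ∈ U := by
  rw [← fixing_fix hU, IntermediateField.mem_fixingSubgroup_iff]; exact h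

theorem mem_fixing {F : IntermediateField ℚ Ω} {g : Gal(Ω/ℚ)} :
    g ∈ F.fixingSubgroup ↔ ∀ x ∈ F, g x = x := IntermediateField.mem_fixingSubgroup_iff F g

theorem mem_F {F : IntermediateField ℚ Ω} {x : Ω} (h : ∀ g ∈ F.fixingSubgroup, g x = x) : x ∈ F := by
  rw [← fix_fixing F, mem_fix]; exact h

theorem fx_mono {U V : Subgroup Gal(Ω/ℚ)} (h : U ≤ V) : fx V ≤ fx U :=
  fun x hx => mem_fix.2 fun g hg => mem_fix.1 hx g (h hg)

theorem le_fx {F : IntermediateField ℚ Ω} {U : Subgroup Gal(Ω/ℚ)} (h : U ≤ F.fixingSubgroup) : F ≤ fx U :=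
  fun x hx => mem_fix.2 fun g hg => mem_fixing.1 (h hg) x hx

theorem fd_adjoin {S : Set Ω} (hS : S.Finite) : FiniteDimensional ℚ (IntermediateField.adjoin ℚ S) := by
  haveI := hS.to_subtype
  exact IntermediateField.finiteDimensional_adjoin fun x _ => (Algebra.IsAlgebraic.isAlgebraic x).isIntegral

theorem open_fixing (F : IntermediateField ℚ Ω) [FiniteDimensional ℚ F] :
    IsOpen (F.fixingSubgroup : Set Gal(Ω/ℚ)) := IntermediateField.fixingSubgroup_isOpen F

/-- description of relatively open subgroups -/
theorem OpenIn.desc {U D : Subgroup Gal(Ω/ℚ)} (h : OpenIn U D) :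
    ∃ F : IntermediateField ℚ Ω, FiniteDimensional ℚ F ∧ U = D ⊓ F.fixingSubgroup := by
  obtain ⟨hUD, hU, hf⟩ := h
  haveI : (U.subgroupOf D).FiniteIndex := ⟨hf⟩
  have hy : ∀ q : D ⧸ U.subgroupOf D, ∃ y ∈ fx U, ((q.out : D) : Gal(Ω/ℚ)) y = y → ((q.out : D) : Gal(Ω/ℚ)) ∈ U := by
    intro q
    by_contra hc
    push Not at hc
    exact (hc 0 (zero_mem _)).2 (mem_of_fx hU fun x hx => (hc x hx).1)
  choose y hy1 hy2 using hy
  refine ⟨IntermediateField.adjoin ℚ (Set.range y), fd_adjoin (Set.finite_range y), le_antisymm ?_ ?_⟩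
  · refine le_inf hUD fun g hg => ?_
    rw [mem_fixing]
    intro x hx
    have : IntermediateField.adjoin ℚ (Set.range y) ≤ fx U := by
      rw [IntermediateField.adjoin_le_iff]; rintro _ ⟨q, rfl⟩; exact hy1 q
    exact mem_fix.1 (this hx) g hg
  · rintro g ⟨hgD, hg⟩
    have hg' := mem_fixing.1 hg
    set q : D ⧸ U.subgroupOf D := QuotientGroup.mk (⟨g, hgD⟩ : D)
    have h1 : (q.out)⁻¹ * ⟨g, hgD⟩ ∈ U.subgroupOf D := by
      rw [← QuotientGroup.eq]; exact q.out_eq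
    rw [Subgroup.mem_subgroupOf] at h1
    have h2 : ((q.out : D) : Gal(Ω/ℚ))⁻¹ (g (y q)) = y q := mem_fix.1 (hy1 q) _ h1
    rw [hg' (y q) (IntermediateField.subset_adjoin ℚ _ ⟨q, rfl⟩)] at h2
    have h3 := hy2 q (by
      conv_lhs => rw [← h2]
      rw [← AlgEquiv.mul_apply]; simp)
    have := mul_mem h3 h1
    simpa using this

/-- Kummer theory, part two -/
theorem kum2 {U : Subgroup Gal(Ω/ℚ)} {l : ℕ} (hl : l.Prime) (hz : ∀ z : Ω, z ^ l = 1 → z ∈ fx U) {α : Ω}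
    (h1 : α ^ l ∈ fx U) (h2 : α ∉ fx U) :
    (st U α).relIndex U = l ∧ ∀ g ∈ U, ∀ w ∈ st U α, g * w * g⁻¹ ∈ st U α := by
  have h0 : α ≠ 0 := by rintro rfl; exact h2 (zero_mem _)
  have hr : ∀ g ∈ U, (g α / α) ^ l = 1 := by
    intro g hg
    rw [div_pow, ← map_pow, mem_fix.1 h1 g hg, div_self (pow_ne_zero _ h0)]
  let φ : U →* Ωˣ :=
    { toFun := fun g => Units.mk0 ((g : Gal(Ω/ℚ)) α / α) (div_ne_zero (by simpa using h0) h0)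
      map_one' := by ext; simp [h0]
      map_mul' := by
        intro g h
        ext
        simp only [Subgroup.coe_mul, AlgEquiv.mul_apply, Units.val_mk0, Units.val_mul]
        have h3 := mem_fix.1 (hz _ (hr h h.2)) g g.2
        rw [map_div₀] at h3
        have hg0 : (g : Gal(Ω/ℚ)) α ≠ 0 := by simpa using h0
        field_simp at h3 ⊢
        rw [h3] }
  have hφ : ∀ g : U, φ g = 1 ↔ (g : Gal(Ω/ℚ)) α = α := by
    intro g
    rw [Units.ext_iff]
    simp only [φ, MonoidHom.coe_mk, OneHom.coe_mk, Units.val_mk0, Units.val_one]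
    rw [div_eq_one_iff_eq h0]
  have hk : φ.ker = (st U α).subgroupOf U := by
    ext g
    rw [MonoidHom.mem_ker, hφ, Subgroup.mem_subgroupOf, mem_st]
    simp
  have hle : φ.range ≤ rootsOfUnity l Ω := by
    rintro _ ⟨g, rfl⟩
    rw [mem_rootsOfUnity]
    ext
    exact hr g g.2
  haveI : NeZero l := ⟨hl.ne_zero⟩
  have hne : φ.range ≠ ⊥ := by
    intro hb
    apply h2
    rw [mem_fix]
    intro g hg
    rw [← hφ ⟨g, hg⟩]
    have : φ ⟨g, hg⟩ ∈ φ.range := ⟨_, rfl⟩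
    rwa [hb, Subgroup.mem_bot] at this
  have hcard : Nat.card φ.range ∣ l := by
    have h3 := Subgroup.card_dvd_of_le hle
    have h4 : Nat.card (rootsOfUnity l Ω) = l := by
      haveI := HasEnoughRootsOfUnity.of_card_le (R := Ω) (n := l)
      rw [HasEnoughRootsOfUnity.natCard_rootsOfUnity]
    rwa [h4] at h3
  refine ⟨?_, ?_⟩
  · rw [Subgroup.relIndex, ← hk, Subgroup.index_ker]
    rcases (Nat.dvd_prime hl).1 hcard with h | h
    · exact absurd (Subgroup.card_eq_one.1 h) hne
    · exact h
  · intro g hg w hw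
    rw [mem_st] at hw ⊢
    refine ⟨mul_mem (mul_mem hg hw.1) (inv_mem hg), ?_⟩
    have := (hφ (⟨g, hg⟩ * ⟨w, hw.1⟩ * ⟨g, hg⟩⁻¹)).1 (by
      rw [map_mul, map_mul, (hφ ⟨w, hw.1⟩).2 hw.2, mul_one, ← map_mul, mul_inv_cancel, map_one])
    exact this

end NU


namespace NU
open Polynomial
open scoped Pointwise
set_option linter.unusedSectionVars false
set_option linter.style.haveILetI false
set_option linter.unusedVariables false

variable {Ω : Type*} [Field Ω] [CharZero Ω] [Algebra.IsAlgebraic ℚ Ω] [IsAlgClosed Ω]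

/-- Kummer theory, part one -/
theorem kum1 {U W : Subgroup Gal(Ω/ℚ)} {l : ℕ} (hl : l.Prime) {ζ : Ω} (hζ : IsPrimitiveRoot ζ l)
    (hζU : ζ ∈ fx U) (hW : IsClosed (W : Set Gal(Ω/ℚ))) (hWU : W ≤ U) (hi : W.relIndex U = l)
    (hn : ∀ g ∈ U, ∀ w ∈ W, g * w * g⁻¹ ∈ W) :
    ∃ α ∈ fx W, α ≠ 0 ∧ α ^ l ∈ fx U ∧ ∀ g ∈ U, g α = α ↔ g ∈ W := by
  have hex : ∃ h ∈ U, h ∉ W := by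
    by_contra hc
    push Not at hc
    have : W = U := le_antisymm hWU hc
    rw [this, Subgroup.relIndex_self] at hi
    exact hl.one_lt.ne hi
  obtain ⟨h, hhU, hhW⟩ := hex
  have hθ : ∃ θ ∈ fx W, h θ ≠ θ := by
    by_contra hc
    push Not at hc
    exact hhW (mem_of_fx hW hc)
  obtain ⟨θ, hθW, hθh⟩ := hθ
  haveI hnorm : (W.subgroupOf U).Normal := ⟨fun w hw g => by
    rw [Subgroup.mem_subgroupOf] at hw ⊢
    exact hn g g.2 w hw⟩
  have hcard : Nat.card (U ⧸ W.subgroupOf U) = l := hi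
  haveI : Fact l.Prime := ⟨hl⟩
  have hgen : ∀ g ∈ U, ∃ i : ℕ, ∃ w ∈ W, g = h ^ i * w := by
    intro g hg
    have h1 : (QuotientGroup.mk (⟨h, hhU⟩ : U) : U ⧸ W.subgroupOf U) ≠ 1 := by
      rw [Ne, QuotientGroup.eq_one_iff, Subgroup.mem_subgroupOf]; exact hhW
    have h2 := mem_powers_of_prime_card hcard h1 (g' := QuotientGroup.mk (⟨g, hg⟩ : U))
    obtain ⟨i, hi⟩ := h2
    simp only at hi
    rw [← QuotientGroup.mk_pow, QuotientGroup.eq, Subgroup.mem_subgroupOf] at hi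
    exact ⟨i, _, hi, by simp⟩
  have hlW : h ^ l ∈ W := by
    have h1 : (QuotientGroup.mk (⟨h, hhU⟩ : U) : U ⧸ W.subgroupOf U) ^ l = 1 := by
      rw [← hcard, pow_card_eq_one']
    rw [← QuotientGroup.mk_pow, QuotientGroup.eq_one_iff, Subgroup.mem_subgroupOf] at h1
    exact h1
  have hz0 : ζ ≠ 0 := hζ.ne_zero hl.ne_zero
  have hzh : ∀ g ∈ U, g ζ = ζ := mem_fix.1 hζU
  -- eigencomponents
  let r : ℕ → Ω := fun j => ∑ i ∈ Finset.range l, (ζ ^ (i * j))⁻¹ * (h ^ i) θ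
  have hr : ∀ j, h (r j) = ζ ^ j * r j := by
    intro j
    have e1 : h (r j) = ∑ i ∈ Finset.range l, ζ ^ j * ((ζ ^ ((i + 1) * j))⁻¹ * (h ^ (i + 1)) θ) := by
      simp only [r, map_sum, map_mul, map_inv₀, map_pow, hzh h hhU]
      refine Finset.sum_congr rfl fun i _ => ?_
      rw [pow_succ' h i, AlgEquiv.mul_apply, add_mul, one_mul, pow_add]
      have := pow_ne_zero j hz0
      have := pow_ne_zero (i * j) hz0
      field_simp
    rw [e1, ← Finset.mul_sum]
    congr 1
    have e2 := Finset.sum_range_succ' (fun i => (ζ ^ (i * j))⁻¹ * (h ^ i) θ) l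
    have e3 := Finset.sum_range_succ (fun i => (ζ ^ (i * j))⁻¹ * (h ^ i) θ) l
    have e4 : (ζ ^ (l * j))⁻¹ * (h ^ l) θ = (ζ ^ (0 * j))⁻¹ * (h ^ 0) θ := by
      rw [pow_mul, hζ.pow_eq_one, mem_fix.1 hθW _ hlW]; simp
    rw [e3, e4] at e2
    exact (add_right_cancel e2).symm
  have hrW : ∀ j, r j ∈ fx W := by
    intro j
    refine sum_mem fun i _ => mul_mem (inv_mem (pow_mem (fx_mono hWU hζU) _)) ?_
    rw [mem_fix]
    intro w hw
    have := hn (h ^ i)⁻¹ (inv_mem (pow_mem hhU i)) w hw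
    have h1 := mem_fix.1 hθW _ this
    rw [inv_inv] at h1
    have h2 := congrArg (h ^ i) h1
    rw [← AlgEquiv.mul_apply, show h ^ i * ((h ^ i)⁻¹ * w * h ^ i) = w * h ^ i by group] at h2
    exact h2
  have hsum : ∑ j ∈ Finset.range l, r j = l * θ := by
    simp only [r]
    rw [Finset.sum_comm, Finset.sum_eq_single 0]
    · simp
    · intro i hi hi0
      rw [← Finset.sum_mul]
      have : ∑ j ∈ Finset.range l, (ζ ^ (i * j))⁻¹ = 0 := by
        have h1 : IsPrimitiveRoot (ζ ^ i)⁻¹ l := (hζ.pow_of_coprime i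
          (Nat.coprime_of_lt_prime hi0 (Finset.mem_range.1 hi) hl).symm).inv
        rw [← h1.geom_sum_eq_zero hl.one_lt]
        simp [pow_mul]
      rw [this, zero_mul]
    · intro h0; simp [hl.pos] at h0
  have hj : ∃ j, 0 < j ∧ j < l ∧ r j ≠ 0 := by
    by_contra hc
    push Not at hc
    rw [Finset.sum_eq_single 0 (fun j hj hj0 => hc j (Nat.pos_of_ne_zero hj0) (Finset.mem_range.1 hj))
      (fun h0 => by simp [hl.pos] at h0)] at hsum
    have h1 := hr 0
    rw [hsum, pow_zero, one_mul, map_mul, map_natCast] at h1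
    exact hθh (mul_left_cancel₀ (by exact_mod_cast hl.ne_zero) h1)
  obtain ⟨j, hj0, hjl, hrj⟩ := hj
  have hpow : ∀ i : ℕ, (h ^ i) (r j) = ζ ^ (j * i) * r j := by
    intro i
    induction i with
    | zero => simp
    | succ i ih =>
      rw [pow_succ', AlgEquiv.mul_apply, ih, map_mul, map_pow, hzh h hhU, hr, mul_add, pow_add]
      ring
  refine ⟨r j, hrW j, hrj, ?_, ?_⟩
  · rw [mem_fix]
    intro g hg
    obtain ⟨i, w, hw, rfl⟩ := hgen g hg
    rw [map_pow, AlgEquiv.mul_apply, mem_fix.1 (hrW j) w hw, hpow, mul_pow, ← pow_mul, mul_comm _ l, pow_mul,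
      hζ.pow_eq_one, one_pow, one_mul]
  · intro g hg
    refine ⟨fun h1 => ?_, fun h1 => mem_fix.1 (hrW j) g h1⟩
    obtain ⟨i, w, hw, rfl⟩ := hgen g hg
    rw [AlgEquiv.mul_apply, mem_fix.1 (hrW j) w hw, hpow, mul_eq_right₀ hrj, hζ.pow_eq_one_iff_dvd] at h1
    have h2 : l ∣ i := by
      rcases hl.dvd_mul.1 h1 with h3 | h3
      · exact absurd (Nat.le_of_dvd hj0 h3) (by omega)
      · exact h3
    obtain ⟨m, rfl⟩ := h2
    rw [pow_mul]
    exact mul_mem (pow_mem hlW m) hw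

/-- Density: `F` is dense in the decomposition field. -/
theorem Over.im {A : ValuationSubring Ω} {p : ℕ} (h : Over A p) (F : IntermediateField ℚ Ω)
    [FiniteDimensional ℚ F] {y : Ω} (hy : y ∈ fx (Dec A ⊓ F.fixingSubgroup)) (hy0 : y ≠ 0) :
    ∃ c ∈ F, A.valuation (y - c) < A.valuation y := by
  classical
  let E : IntermediateField ℚ Ω := F ⊔ IntermediateField.adjoin ℚ {y}
  haveI : FiniteDimensional ℚ (IntermediateField.adjoin ℚ {y}) := fd_adjoin (Set.finite_singleton y)
  haveI : FiniteDimensional ℚ E := inferInstance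
  have hyE : y ∈ E := (le_sup_right : _ ≤ E) (IntermediateField.mem_adjoin_simple_self ℚ y)
  have hFE : F ≤ E := le_sup_left
  let R : Gal(Ω/ℚ) → (E →ₐ[ℚ] Ω) := fun g => (g : Ω →ₐ[ℚ] Ω).comp E.val
  have hfin : (R '' (F.fixingSubgroup : Set Gal(Ω/ℚ))).Finite := Set.toFinite _
  let S : Finset (E →ₐ[ℚ] Ω) := hfin.toFinset
  have hS : ∀ σ, σ ∈ S ↔ ∃ g ∈ F.fixingSubgroup, R g = σ := by
    intro σ; simp [S]
  have hone : R 1 ∈ S := (hS _).2 ⟨1, one_mem _, rfl⟩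
  -- separation
  have sep : ∀ σ ∈ S.erase (R 1), ∃ q : E, IsIntegral ℤ (q : Ω) ∧ A.valuation (σ q) < 1 ∧ A.valuation (q : Ω) = 1 := by
    intro σ hσ
    rw [Finset.mem_erase, hS] at hσ
    obtain ⟨hσ1, g, hg, rfl⟩ := hσ
    by_contra hc
    push Not at hc
    have h1 : ∀ x ∈ IntermediateField.fixedField E.fixingSubgroup, IsIntegral ℤ x →
        (g⁻¹ • A).valuation x < 1 → A.valuation x < 1 := by
      intro x hx hi hlt
      rw [fix_fixing] at hx
      rw [smul_lt, inv_inv] at hlt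
      exact lt_of_le_of_ne (mem_of_int hi) (hc ⟨x, hx⟩ hi hlt)
    obtain ⟨k, hk, hkA⟩ := trans_int (h.smul g⁻¹).ne_top h.ne_top (closed_fixing E) h1
    apply hσ1
    rw [← mul_smul] at hkA
    have h2 : k * g⁻¹ ∈ Dec A ⊓ F.fixingSubgroup := by
      refine Subgroup.mem_inf.2 ⟨hkA, mul_mem (IntermediateField.fixingSubgroup_le hFE hk) (inv_mem hg)⟩
    have h3 := mem_fix.1 hy _ (inv_mem h2)
    rw [mul_inv_rev, inv_inv, AlgEquiv.mul_apply, mem_fixing.1 (inv_mem hk) y hyE] at h3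
    have h4 : g ∈ E.fixingSubgroup := by
      have : E ≤ fx (Subgroup.zpowers g) := by
        refine sup_le ?_ ?_
        · exact le_fx (by rw [Subgroup.zpowers_le]; exact hg)
        · rw [IntermediateField.adjoin_simple_le_iff, mem_fix]
          intro k hk
          have : Subgroup.zpowers g ≤ MulAction.stabilizer Gal(Ω/ℚ) y := by
            rw [Subgroup.zpowers_le]; exact h3
          exact this hk
      rw [mem_fixing]
      exact fun x hx => mem_fix.1 (this hx) g (Subgroup.mem_zpowers g)
    ext x
    exact mem_fixing.1 h4 x x.2
  choose! q hq1 hq2 hq3 using sep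
  let Q : E := ∏ σ ∈ S.erase (R 1), q σ
  have hQ1 : A.valuation (Q : Ω) = 1 := by
    have : (Q : Ω) = ∏ σ ∈ S.erase (R 1), (q σ : Ω) := by simp [Q]
    rw [this, map_prod]
    exact Finset.prod_eq_one hq3
  have hQ2 : ∀ σ ∈ S.erase (R 1), A.valuation (σ Q) < 1 := by
    intro σ hσ
    have hIntegral : ∀ τ ∈ S.erase (R 1), A.valuation (σ (q τ)) ≤ 1 := by
      intro τ hτ
      obtain ⟨g, -, rfl⟩ := (hS _).1 (Finset.mem_of_mem_erase hσ)
      exact mem_of_int ((hq1 τ hτ).map ((g : Ω →ₐ[ℚ] Ω).restrictScalars ℤ))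
    simp only [Q]
    rw [← Finset.mul_prod_erase _ _ hσ, map_mul]
    refine mul_lt_one' (hq2 σ hσ) ?_
    rw [map_prod, map_prod]
    exact Finset.prod_le_one' fun τ hτ => hIntegral τ (Finset.mem_of_mem_erase hτ)
  obtain ⟨n, hn, hQn⟩ := h.fin hQ1
  let β : E := Q ^ n
  have hβ1 : A.valuation ((β : Ω) - 1) < 1 := by simpa [β] using hQn
  have hβ1' : A.valuation (β : Ω) = 1 := by simp [β, hQ1]
  have hβ2 : ∀ σ ∈ S.erase (R 1), A.valuation (σ β) < 1 := by
    intro σ hσ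
    simp only [β, map_pow]
    exact pow_lt_one₀ zero_le (hQ2 σ hσ) (by omega)
  -- choose the exponent
  have hN1 : ∃ N : ℕ, ∀ m ≥ N, A.valuation ((β : Ω) - 1) ^ m < 1 := by
    obtain ⟨N, hN⟩ := h.arch hβ1 1
    exact ⟨N, fun m hm => by simpa using hN m hm⟩
  have hN2 : ∀ σ ∈ S.erase (R 1), ∃ N : ℕ, ∀ m ≥ N,
      A.valuation (σ ⟨y, hyE⟩ / y) * A.valuation (σ β) ^ m < 1 := by
    intro σ hσ
    exact h.arch (hβ2 σ hσ) _
  choose! N hN using hN2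
  let M : ℕ := 1 + ∑ σ ∈ S.erase (R 1), N σ
  let α : E := 1 - (1 - β ^ M) ^ 1
  let w : E := ⟨y, hyE⟩ * α
  have hα1 : A.valuation ((α : Ω) - 1) < 1 := by
    have : (α : Ω) - 1 = (β : Ω) ^ M - 1 ^ M := by simp [α]
    rw [this]
    exact pow_sub_lt M hβ1'.le (by simp) hβ1
  have hα2 : ∀ σ ∈ S.erase (R 1), A.valuation (σ w) < A.valuation y := by
    intro σ hσ
    have h1 := hN σ hσ M (by
      have := Finset.single_le_sum (f := N) (fun _ _ => Nat.zero_le _) hσ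
      omega)
    have : σ w = y * (σ ⟨y, hyE⟩ / y * σ β ^ M) := by
      simp only [w, α, map_mul, map_sub, map_pow, map_one]
      field_simp; ring
    rw [this, map_mul, map_mul A.valuation, map_pow A.valuation]
    exact mul_lt_of_lt_one_right (v_pos hy0) h1
  refine ⟨∑ σ ∈ S, σ w, ?_, ?_⟩
  · refine mem_F fun g hg => ?_
    rw [map_sum]
    refine Finset.sum_nbij' (fun σ => (g : Ω →ₐ[ℚ] Ω).comp σ) (fun σ => ((g⁻¹ : Gal(Ω/ℚ)) : Ω →ₐ[ℚ] Ω).comp σ) ?_ ?_ ?_ ?_ ?_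
    · intro σ hσ
      rw [hS] at hσ ⊢
      obtain ⟨k, hk, rfl⟩ := hσ
      exact ⟨g * k, mul_mem hg hk, rfl⟩
    · intro σ hσ
      rw [hS] at hσ ⊢
      obtain ⟨k, hk, rfl⟩ := hσ
      exact ⟨g⁻¹ * k, mul_mem (inv_mem hg) hk, rfl⟩
    · intro σ _
      ext x
      change (g⁻¹ * g) (σ x) = σ x
      simp
    · intro σ _
      ext x
      change (g * g⁻¹) (σ x) = σ x
      simp
    · intro σ _; rfl
  · have e : y - ∑ σ ∈ S, σ w = - (y * ((α : Ω) - 1)) + (- ∑ σ ∈ S.erase (R 1), σ w) := by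
      rw [← Finset.add_sum_erase _ _ hone]
      have : (R 1) w = y * α := rfl
      rw [this]; ring
    rw [e]
    refine A.valuation.map_add_lt ?_ ?_
    · rw [Valuation.map_neg, map_mul]
      exact mul_lt_of_lt_one_right (v_pos hy0) hα1
    · rw [Valuation.map_neg]
      exact A.valuation.map_sum_lt (v_pos hy0).ne' hα2

end NU


namespace NU
open Polynomial
open scoped Pointwise
set_option linter.unusedSectionVars false
set_option linter.style.haveILetI false
set_option linter.unusedVariables false

variable {Ω : Type*} [Field Ω] [CharZero Ω]

/-- squares in the fixed field -/
def Sq (U : Subgroup Gal(Ω/ℚ)) (x : Ω) : Prop := ∃ z ∈ fx U, z ^ 2 = x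

/-- rigidity -/
def Rig (U : Subgroup Gal(Ω/ℚ)) : Prop :=
  ∀ x ∈ fx U, x ≠ 0 → ¬ Sq U x → Sq U (1 + x) ∨ Sq U (x * (1 + x))

/-- group theoretic version of rigidity -/
def Ci (U : Subgroup Gal(Ω/ℚ)) : Prop :=
  ∀ W X : Subgroup Gal(Ω/ℚ), W ≤ U → X ≤ W → IsClosed (W : Set Gal(Ω/ℚ)) → IsClosed (X : Set Gal(Ω/ℚ)) →
    W.relIndex U = 2 → X.relIndex W = 2 → ∀ g ∈ U, ∀ x ∈ X, g * x * g⁻¹ ∈ X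

theorem two_normal {U W : Subgroup Gal(Ω/ℚ)} (h : W.relIndex U = 2) (hWU : W ≤ U) :
    ∀ g ∈ U, ∀ w ∈ W, g * w * g⁻¹ ∈ W := by
  intro g hg w hw
  have := Subgroup.normal_of_index_eq_two h
  have h1 := this.conj_mem ⟨w, hWU hw⟩ (Subgroup.mem_subgroupOf.2 hw) ⟨g, hg⟩
  exact Subgroup.mem_subgroupOf.1 h1

variable [Algebra.IsAlgebraic ℚ Ω] [IsAlgClosed Ω]

theorem prim_two : IsPrimitiveRoot (-1 : Ω) 2 := by
  refine IsPrimitiveRoot.mk_of_lt _ (by norm_num) (by norm_num) ?_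
  intro l h1 h2
  interval_cases l
  norm_num

theorem kum1_two {U W : Subgroup Gal(Ω/ℚ)} (hW : IsClosed (W : Set Gal(Ω/ℚ))) (hWU : W ≤ U) (hi : W.relIndex U = 2) :
    ∃ α ∈ fx W, α ≠ 0 ∧ α ^ 2 ∈ fx U ∧ ∀ g ∈ U, g α = α ↔ g ∈ W :=
  kum1 Nat.prime_two prim_two (neg_mem (one_mem _)) hW hWU hi (two_normal hi hWU)

theorem kum2_two {U : Subgroup Gal(Ω/ℚ)} {α : Ω} (h1 : α ^ 2 ∈ fx U) (h2 : α ∉ fx U) :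
    (st U α).relIndex U = 2 ∧ ∀ g ∈ U, ∀ w ∈ st U α, g * w * g⁻¹ ∈ st U α :=
  kum2 Nat.prime_two (fun z hz => by
    rcases sq_eq_one_iff.1 hz with h | h
    · rw [h]; exact one_mem _
    · rw [h]; exact neg_mem (one_mem _)) h1 h2

theorem pm {U : Subgroup Gal(Ω/ℚ)} {α : Ω} (h1 : α ^ 2 ∈ fx U) {g : Gal(Ω/ℚ)} (hg : g ∈ U) :
    g α = α ∨ g α = - α := by
  have := mem_fix.1 h1 g hg
  rw [map_pow] at this
  exact sq_eq_sq_iff_eq_or_eq_neg.1 this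

theorem ex_root (x : Ω) {n : ℕ} (hn : 0 < n) : ∃ z : Ω, z ^ n = x := IsAlgClosed.exists_pow_nat_eq x hn

theorem not_neg {a : Ω} (ha : a ≠ 0) : a ≠ - a := fun h => ha (self_eq_neg.1 h)

theorem Ci.rig {U : Subgroup Gal(Ω/ℚ)} (hU : IsClosed (U : Set Gal(Ω/ℚ))) (h : Ci U) {i : Ω} (hi : i ^ 2 = -1)
    (hiU : i ∈ fx U) : Rig U := by
  intro x hx hx0 hsq
  obtain ⟨t, ht⟩ := ex_root x (n := 2) (by norm_num)
  have ht0 : t ≠ 0 := by rintro rfl; apply hx0; rw [← ht]; norm_num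
  have htU : t ∉ fx U := fun h' => hsq ⟨t, h', ht⟩
  have ht2 : t ^ 2 ∈ fx U := by rwa [ht]
  obtain ⟨hW2, hWn⟩ := kum2_two ht2 htU
  have hWc := (openIn_st hU t).2.1
  set W := st U t with hWdef
  have hWU : W ≤ U := st_le
  have hex : ∃ h ∈ U, h t ≠ t := by
    by_contra hc; push Not at hc; exact htU (mem_fix.2 hc)
  obtain ⟨k, hk, hkt⟩ := hex
  have hkt' : k t = - t := (pm ht2 hk).resolve_left hkt
  have htW : t ∈ fx W := mem_fix.2 fun g hg => (mem_st.1 hg).2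
  obtain ⟨α, hα⟩ := ex_root (1 + i * t) (n := 2) (by norm_num)
  have hα2 : α ^ 2 ∈ fx W := by
    rw [hα]; exact add_mem (one_mem _) (mul_mem (fx_mono hWU hiU) htW)
  set β := k α with hβ
  have hβe : β ^ 2 = 1 - i * t := by
    rw [hβ, ← map_pow, hα, map_add, map_one, map_mul, mem_fix.1 hiU k hk, hkt']; ring
  have hβ2 : β ^ 2 ∈ fx W := by
    rw [hβe]; exact sub_mem (one_mem _) (mul_mem (fx_mono hWU hiU) htW)
  have hs2 : (α * β) ^ 2 = 1 + x := by
    rw [mul_pow, hα, hβe, ← ht]; linear_combination (- t ^ 2) * hi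
  have hconj : ∀ g ∈ W, k⁻¹ * g * k ∈ W := fun g hg => by
    simpa using hWn k⁻¹ (inv_mem hk) g hg
  -- same sign
  have hsame : ∀ g ∈ W, g α = α ↔ g β = β := by
    intro g hg
    have e : g β = β ↔ (k⁻¹ * g * k) α = α := by
      rw [AlgEquiv.mul_apply, AlgEquiv.mul_apply, AlgEquiv.aut_inv, AlgEquiv.symm_apply_eq]
    rw [e]
    by_cases hαW : α ∈ fx W
    · exact ⟨fun _ => mem_fix.1 hαW _ (hconj g hg), fun _ => mem_fix.1 hαW _ hg⟩
    · obtain ⟨hX2, -⟩ := kum2_two hα2 hαW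
      have hX := h W (st W α) hWU st_le hWc (openIn_st hWc α).2.1 hW2 hX2
      constructor
      · intro h1
        have := hX k⁻¹ (inv_mem hk) g (mem_st.2 ⟨hg, h1⟩)
        rw [inv_inv] at this
        exact (mem_st.1 this).2
      · intro h1
        have := hX k hk _ (mem_st.2 ⟨hconj g hg, h1⟩)
        rw [show k * (k⁻¹ * g * k) * k⁻¹ = g by group] at this
        exact (mem_st.1 this).2
  have hsW : α * β ∈ fx W := by
    rw [mem_fix]
    intro g hg
    rw [map_mul]
    rcases pm hα2 hg with h1 | h1
    · rw [h1, (hsame g hg).1 h1]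
    · rcases pm hβ2 hg with h2 | h2
      · rw [(hsame g hg).2 h2, h2]
      · rw [h1, h2]; ring
  have hkk : k * k ∈ W := mem_st.2 ⟨mul_mem hk hk, by rw [AlgEquiv.mul_apply, hkt', map_neg, hkt', neg_neg]⟩
  have hgk : ∀ g ∈ U, g ∉ W → g * k⁻¹ ∈ W := by
    intro g hg hgW
    have h1 : g t = - t := (pm ht2 hg).resolve_left fun h' => hgW (mem_st.2 ⟨hg, h'⟩)
    refine mem_st.2 ⟨mul_mem hg (inv_mem hk), ?_⟩
    have h2 : k⁻¹ t = - t := by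
      rw [AlgEquiv.aut_inv, AlgEquiv.symm_apply_eq, map_neg, hkt', neg_neg]
    rw [AlgEquiv.mul_apply, h2, map_neg, h1, neg_neg]
  have glue : ∀ w ∈ fx W, k w = w → w ∈ fx U := by
    intro w hw hkw
    rw [mem_fix]
    intro g hg
    by_cases hgW : g ∈ W
    · exact mem_fix.1 hw g hgW
    · have := mem_fix.1 hw _ (hgk g hg hgW)
      rw [AlgEquiv.mul_apply, AlgEquiv.aut_inv] at this
      nth_rewrite 1 [← hkw] at this
      rwa [AlgEquiv.symm_apply_apply] at this
  have hks : k (α * β) = α * β ∨ k (α * β) = - (α * β) := by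
    have : k β = (k * k) α := rfl
    rw [map_mul, this]
    rcases pm hα2 hkk with h1 | h1
    · left; rw [h1, ← hβ]; ring
    · right; rw [h1, ← hβ]; ring
  rcases hks with h1 | h1
  · exact Or.inl ⟨_, glue _ hsW h1, hs2⟩
  · refine Or.inr ⟨α * β * t, glue _ (mul_mem hsW htW) ?_, ?_⟩
    · rw [map_mul, h1, hkt']; ring
    · rw [mul_pow, hs2, ht]; ring

theorem Rig.ci {U : Subgroup Gal(Ω/ℚ)} (h : Rig U) {i : Ω} (hi : i ^ 2 = -1)
    (hiU : i ∈ fx U) : Ci U := by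
  intro W X hWU hXW hWc hXc hW2 hX2
  obtain ⟨t, htW, ht0, ht2, htg⟩ := kum1_two hWc hWU hW2
  obtain ⟨α, hαX, hα0, hα2, hαg⟩ := kum1_two hXc hXW hX2
  have hWn := two_normal hW2 hWU
  have hXn := two_normal hX2 hXW
  have hi0 : i ≠ 0 := by rintro rfl; norm_num at hi
  intro k hk x hx
  by_cases hkW : k ∈ W
  · exact hXn k hkW x hx
  have hkW' : k⁻¹ ∉ W := fun h' => hkW (by simpa using inv_mem h')
  set l := k⁻¹ with hl
  have hlU : l ∈ U := inv_mem hk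
  have hlt : l t = - t := (pm ht2 hlU).resolve_left fun h' => hkW' ((htg l hlU).1 h')
  have hlW : ∀ y ∈ fx W, l y ∈ fx W := by
    intro y hy
    rw [mem_fix]
    intro g hg
    have := mem_fix.1 hy _ (hWn k hk g hg)
    rw [AlgEquiv.mul_apply, AlgEquiv.mul_apply] at this
    have h2 := congrArg l this
    rw [← hl] at h2
    rw [← AlgEquiv.mul_apply, hl, inv_mul_cancel, AlgEquiv.one_apply, ← hl] at h2
    exact h2
  have hgl : ∀ g ∈ U, g ∉ W → l⁻¹ * g ∈ W := by
    intro g hg hgW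
    have h1 : g t = - t := (pm ht2 hg).resolve_left fun h' => hgW ((htg g hg).1 h')
    rw [← htg _ (mul_mem (inv_mem hlU) hg), AlgEquiv.mul_apply, h1, AlgEquiv.aut_inv, AlgEquiv.symm_apply_eq, hlt]
  have hllW : l * l ∈ W := by
    rw [← htg _ (mul_mem hlU hlU), AlgEquiv.mul_apply, hlt, map_neg, hlt, neg_neg]
  have glue : ∀ w ∈ fx W, l w = w → w ∈ fx U := by
    intro w hw hkw
    rw [mem_fix]
    intro g hg
    by_cases hgW : g ∈ W
    · exact mem_fix.1 hw g hgW
    · have := mem_fix.1 hw _ (hgl g hg hgW)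
      rw [AlgEquiv.mul_apply, AlgEquiv.aut_inv, AlgEquiv.symm_apply_eq, hkw] at this
      exact this
  set y := α ^ 2 with hy
  set β := l α with hβ
  have hβ2 : β ^ 2 = l y := by rw [hβ, hy, map_pow]
  have hβ0 : β ≠ 0 := by rw [hβ]; simpa using hα0
  have hlly : l (l y) = y := mem_fix.1 hα2 _ hllW
  set u := (y + l y) / 2 with hu
  set v := (y - l y) / (2 * t) with hv
  have huU : u ∈ fx U := by
    refine glue _ (div_mem (add_mem hα2 (hlW y hα2)) (ofNat_mem _ 2)) ?_
    rw [hu, map_div₀, map_add, hlly, map_ofNat, add_comm]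
  have hvU : v ∈ fx U := by
    refine glue _ (div_mem (sub_mem hα2 (hlW y hα2)) (mul_mem (ofNat_mem _ 2) htW)) ?_
    rw [hv, map_div₀, map_sub, hlly, map_mul, map_ofNat, hlt]
    field_simp; ring
  have hyuv : y = u + v * t := by rw [hu, hv]; field_simp; ring
  have hlyuv : l y = u - v * t := by rw [hu, hv]; field_simp; ring
  have hiW := fx_mono hWU hiU
  have huW := fx_mono hWU huU
  have hvW := fx_mono hWU hvU
  have hr : ∃ r ∈ fx W, r ^ 2 = u ^ 2 - t ^ 2 * v ^ 2 := by
    by_cases hu0 : u = 0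
    · exact ⟨i * t * v, mul_mem (mul_mem hiW htW) hvW, by rw [hu0, mul_pow, mul_pow, hi]; ring⟩
    by_cases hv0 : v = 0
    · exact ⟨u, huW, by rw [hv0]; ring⟩
    have hx'U : - t ^ 2 * v ^ 2 / u ^ 2 ∈ fx U :=
      div_mem (mul_mem (neg_mem ht2) (pow_mem hvU 2)) (pow_mem huU 2)
    have hx'0 : - t ^ 2 * v ^ 2 / u ^ 2 ≠ 0 := by
      simp [ht0, hv0, hu0]
    have hns : ¬ Sq U (- t ^ 2 * v ^ 2 / u ^ 2) := by
      rintro ⟨z, hz, hz2⟩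
      have h1 : (i * z * u / v) ^ 2 = t ^ 2 := by
        rw [div_pow, mul_pow, mul_pow, hz2, hi]; field_simp
      have h2 : t ∈ fx U := by
        have h3 : i * z * u / v ∈ fx U := div_mem (mul_mem (mul_mem hiU hz) huU) hvU
        rcases sq_eq_sq_iff_eq_or_eq_neg.1 h1 with h4 | h4
        · rwa [h4] at h3
        · rw [h4] at h3; simpa using neg_mem h3
      have h3 := mem_fix.1 h2 l hlU
      rw [hlt] at h3
      exact not_neg ht0 h3.symm
    rcases h _ hx'U hx'0 hns with ⟨z, hz, hz2⟩ | ⟨z, hz, hz2⟩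
    · exact ⟨u * z, mul_mem huW (fx_mono hWU hz), by rw [mul_pow, hz2]; field_simp; ring⟩
    · refine ⟨u ^ 2 * z / (i * t * v), div_mem (mul_mem (pow_mem huW 2) (fx_mono hWU hz))
        (mul_mem (mul_mem hiW htW) hvW), ?_⟩
      rw [div_pow, mul_pow, hz2, mul_pow, mul_pow, hi]
      field_simp; ring
  obtain ⟨r, hrW, hr2⟩ := hr
  have hab : α * β ∈ fx W := by
    have h1 : (α * β) ^ 2 = r ^ 2 := by
      rw [mul_pow, hβ2, hlyuv, ← hy, hyuv, hr2]; ring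
    rcases sq_eq_sq_iff_eq_or_eq_neg.1 h1 with h4 | h4
    · rwa [h4]
    · rw [h4]; exact neg_mem hrW
  have hxW : x ∈ W := hXW hx
  have hxα : x α = α := (hαg x hxW).2 hx
  have hxβ : x β = β := by
    have h1 := mem_fix.1 hab x hxW
    rw [map_mul, hxα] at h1
    exact mul_left_cancel₀ hα0 h1
  have hkx : k * x * l ∈ W := by
    have := hWn k hk x hxW
    rwa [← hl] at this
  rw [← hαg _ hkx, AlgEquiv.mul_apply, ← hβ, AlgEquiv.mul_apply, hxβ, hβ, hl, ← AlgEquiv.mul_apply]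
  simp

end NU


namespace NU
open Polynomial
open scoped Pointwise
set_option linter.unusedSectionVars false
set_option linter.style.haveILetI false
set_option linter.unusedVariables false

variable {Ω : Type*} [Field Ω] [CharZero Ω] [Algebra.IsAlgebraic ℚ Ω] [IsAlgClosed Ω]

theorem ex_prim {l : ℕ} (hl : l.Prime) : ∃ ζ : Ω, IsPrimitiveRoot ζ l := by
  haveI : NeZero l := ⟨hl.ne_zero⟩
  exact HasEnoughRootsOfUnity.exists_primitiveRoot Ω l

theorem Over.root_sep {A : ValuationSubring Ω} {p l : ℕ} (h : Over A p) (hl : l.Prime) (hlp : l ≠ p)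
    {ζ : Ω} (hζ : ζ ^ l = 1) (hv : A.valuation (ζ - 1) < 1) : ζ = 1 := by
  by_contra hne
  have h1 : ∑ i ∈ Finset.range l, ζ ^ i = 0 := by
    have := geom_sum_mul ζ l
    rw [hζ, sub_self] at this
    exact (mul_eq_zero.1 this).resolve_right (sub_ne_zero.2 hne)
  have hz1 : A.valuation ζ ≤ 1 := (eq_one_of_sub_lt (by simp) hv).le
  have h2 : A.valuation (∑ i ∈ Finset.range l, (ζ ^ i - 1 ^ i)) < 1 :=
    A.valuation.map_sum_lt one_ne_zero fun i _ => pow_sub_lt i hz1 (by simp) hv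
  rw [Finset.sum_sub_distrib, h1] at h2
  simp only [one_pow, Finset.sum_const, Finset.card_range, nsmul_eq_mul, mul_one, zero_sub, Valuation.map_neg] at h2
  exact hlp (Over.unique ⟨hl, h2⟩ h)

/-- Hensel's lemma for roots. -/
theorem Over.root {A : ValuationSubring Ω} {p l : ℕ} (h : Over A p) (hl : l.Prime) (hlp : l ≠ p)
    {U : Subgroup Gal(Ω/ℚ)} (hU : U ≤ Dec A) {y : Ω} (hy : y ∈ fx U) (hv : A.valuation y < 1) :
    ∃ z ∈ fx U, z ^ l = 1 + y ∧ A.valuation (z - 1) < 1 := by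
  have hz : ∃ z, z ^ l = 1 + y ∧ A.valuation (z - 1) < 1 := by
    obtain ⟨z, hz⟩ := ex_root (1 + y) hl.pos
    by_contra hc
    push Not at hc
    obtain ⟨ζ, hζ⟩ := ex_prim (Ω := Ω) hl
    have h1 := hζ.pow_sub_pow_eq_prod_sub_mul 1 z hl.pos
    have h2 : A.valuation (1 ^ l - z ^ l) < 1 := by
      rw [hz]; simpa using hv
    rw [h1, map_prod] at h2
    refine absurd h2 (not_lt.2 (Finset.one_le_prod' fun μ hμ => ?_))
    rw [Valuation.map_sub_swap]
    refine hc _ ?_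
    rw [mul_pow, hz, (mem_nthRootsFinset hl.pos (1 : Ω)).1 hμ, one_mul]
  obtain ⟨z, hz, hz1⟩ := hz
  refine ⟨z, ?_, hz, hz1⟩
  rw [mem_fix]
  intro g hg
  have hvz : A.valuation z = 1 := eq_one_of_sub_lt (by simp) hz1
  have hz0 : z ≠ 0 := by rintro rfl; simp at hvz
  have hg1 : A.valuation (g z - 1) < 1 := by
    have := (Dec.lt (hU hg) (x := z - 1)).2 hz1
    simpa using this
  have h1 : g z / z = 1 := by
    refine h.root_sep hl hlp ?_ ?_
    · rw [div_pow, ← map_pow, hz, mem_fix.1 (add_mem (one_mem _) hy) g hg, div_self]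
      rw [← hz]; exact pow_ne_zero _ hz0
    · have e : g z / z - 1 = ((g z - 1) - (z - 1)) / z := by field_simp; ring
      rw [e, map_div₀, hvz, div_one]
      exact A.valuation.map_sub_lt hg1 hz1
  exact (div_eq_one_iff_eq hz0).1 h1

theorem Over.sq1 {A : ValuationSubring Ω} {p : ℕ} (h : Over A p) (hp : p ≠ 2)
    {U : Subgroup Gal(Ω/ℚ)} (hU : U ≤ Dec A) {x a : Ω} (hx : x ∈ fx U) (ha : a ∈ fx U) (ha1 : A.valuation a = 1)
    (hv : A.valuation (x - a ^ 2) < 1) : Sq U x := by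
  have ha0 : a ≠ 0 := by rintro rfl; simp at ha1
  obtain ⟨z, hz, hz2, -⟩ := h.root Nat.prime_two hp.symm hU (y := (x - a ^ 2) / a ^ 2)
    (div_mem (sub_mem hx (pow_mem ha 2)) (pow_mem ha 2)) (by rwa [map_div₀, map_pow, ha1, one_pow, div_one])
  exact ⟨a * z, mul_mem ha hz, by rw [mul_pow, hz2]; field_simp; ring⟩

theorem Over.rig {A : ValuationSubring Ω} {p : ℕ} (h : Over A p) (hp : p ≠ 2)
    {U : Subgroup Gal(Ω/ℚ)} (hU : U ≤ Dec A) {i : Ω} (hi : i ^ 2 = -1) (hiU : i ∈ fx U) : Rig U := by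
  intro x hx hx0 hsq
  have hi1 : A.valuation i = 1 := by
    have : A.valuation i ^ 2 = 1 := by rw [← map_pow, hi]; simp
    exact (pow_eq_one_iff_of_nonneg zero_le (by norm_num)).1 this
  rcases lt_trichotomy (A.valuation x) 1 with hv | hv | hv
  · left
    exact h.sq1 hp hU (add_mem (one_mem _) hx) (one_mem _) (by simp) (by simpa using hv)
  · by_cases hv1 : A.valuation (1 + x) < 1
    · exfalso
      exact hsq (h.sq1 hp hU hx hiU hi1 (by rw [hi]; convert hv1 using 2; ring))
    have hv2 : A.valuation (1 + x) = 1 :=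
      le_antisymm ((A.valuation.map_add_le (by simp) hv.le)) (not_lt.1 hv1)
    haveI := fd_adjoin (Set.finite_singleton x)
    have hF : IntermediateField.adjoin ℚ {x} ≤ fx U := IntermediateField.adjoin_simple_le_iff.2 hx
    obtain ⟨c, hc, hc1, -, hgen⟩ := h.gen (IntermediateField.adjoin ℚ {x})
    have hxF := IntermediateField.mem_adjoin_simple_self ℚ x
    obtain ⟨a, ha⟩ := hgen x hxF hv
    obtain ⟨b, hb⟩ := hgen (1 + x) (add_mem (one_mem _) hxF) hv2
    have hcU := hF hc
    have hce : ∀ n : ℕ, A.valuation (c ^ n) = 1 := fun n => by rw [map_pow, hc1, one_pow]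
    rcases Nat.even_or_odd' a with ⟨a', rfl | rfl⟩
    · exact absurd (h.sq1 hp hU hx (pow_mem hcU a') (hce _) (by rwa [← pow_mul, mul_comm])) hsq
    rcases Nat.even_or_odd' b with ⟨b', rfl | rfl⟩
    · left
      exact h.sq1 hp hU (add_mem (one_mem _) hx) (pow_mem hcU b') (hce _) (by rwa [← pow_mul, mul_comm])
    · right
      refine h.sq1 hp hU (mul_mem hx (add_mem (one_mem _) hx)) (pow_mem hcU (a' + b' + 1)) (hce _) ?_
      have e : x * (1 + x) - (c ^ (a' + b' + 1)) ^ 2 = (x - c ^ (2 * a' + 1)) * (1 + x)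
          + (1 + x - c ^ (2 * b' + 1)) * c ^ (2 * a' + 1) := by ring
      rw [e]
      exact A.valuation.map_add_lt (mul_lt_one' ha hv2.le) (mul_lt_one' hb (hce _).le)
  · right
    have hv' : A.valuation x⁻¹ < 1 := by rw [map_inv₀]; exact inv_lt_one_of_one_lt₀ hv
    obtain ⟨z, hz, hz2⟩ := h.sq1 hp hU (add_mem (one_mem _) (inv_mem hx)) (one_mem _) (by simp)
      (show A.valuation (1 + x⁻¹ - 1 ^ 2) < 1 by simpa using hv')
    exact ⟨x * z, mul_mem hx hz, by rw [mul_pow, hz2]; field_simp; ring⟩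

/-- nonsquare unit -/
theorem Over.nonsq {A : ValuationSubring Ω} {p : ℕ} (h : Over A p) (hp : p ≠ 2) (F : IntermediateField ℚ Ω)
    [FiniteDimensional ℚ F] : ∃ u ∈ F, A.valuation u = 1 ∧ ∀ d ∈ F, ¬ A.valuation (u - d ^ 2) < 1 := by
  obtain ⟨c, hc, hc1, ⟨N, hN, hcN⟩, hgen⟩ := h.gen F
  refine ⟨c, hc, hc1, fun d hd hcd => ?_⟩
  have hd1 : A.valuation d = 1 := by
    have h1 : A.valuation (d ^ 2) = 1 := by
      rw [Valuation.map_sub_swap] at hcd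
      exact eq_one_of_sub_lt hc1 hcd
    rw [map_pow] at h1
    exact (pow_eq_one_iff_of_nonneg zero_le (by norm_num)).1 h1
  obtain ⟨j, hj⟩ := hgen d hd hd1
  have tr : ∀ {a b e : Ω}, A.valuation (a - b) < 1 → A.valuation (b - e) < 1 → A.valuation (a - e) < 1 := by
    intro a b e h1 h2
    have := A.valuation.map_add_lt h1 h2
    simpa using this
  have hcp : ∀ n : ℕ, A.valuation (c ^ n) = 1 := fun n => by rw [map_pow, hc1, one_pow]
  -- odd order
  have h1 : A.valuation (c - c ^ (2 * j)) < 1 := by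
    refine tr hcd ?_
    have := pow_sub_lt 2 hd1.le (hcp j).le hj
    rwa [← pow_mul, mul_comm] at this
  have hodd : ∃ m : ℕ, A.valuation (c ^ (2 * m + 1) - 1) < 1 := by
    rcases Nat.eq_zero_or_pos j with rfl | hj0
    · exact ⟨0, by simpa using h1⟩
    · refine ⟨j - 1, ?_⟩
      have e : c - c ^ (2 * j) = - ((c ^ (2 * (j - 1) + 1) - 1) * c) := by
        obtain ⟨j', rfl⟩ : ∃ j', j = j' + 1 := ⟨j - 1, by omega⟩
        simp only [Nat.add_sub_cancel]; ring
      rw [e, Valuation.map_neg, map_mul, hc1, mul_one] at h1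
      exact h1
  obtain ⟨m, hm⟩ := hodd
  obtain ⟨k, hk⟩ := hgen (-1) (neg_mem (one_mem _)) (by simp)
  have h2 := pow_sub_lt (2 * m + 1) (by simp) (hcp k).le hk
  have h3 := pow_sub_lt k (hcp _).le (by simp) hm
  have e2 : (-1 : Ω) ^ (2 * m + 1) = -1 := Odd.neg_one_pow ⟨m, rfl⟩
  rw [e2, ← pow_mul, mul_comm, pow_mul] at h2
  have h4 := tr h2 h3
  rw [one_pow, show (-1 - 1 : Ω) = - ((2 : ℕ) : Ω) by norm_num, Valuation.map_neg] at h4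
  exact hp (h.unique ⟨Nat.prime_two, h4⟩)

/-- two independent square classes -/
theorem Over.two_cl {A : ValuationSubring Ω} {p : ℕ} (h : Over A p) (hp : p ≠ 2) (F : IntermediateField ℚ Ω)
    [FiniteDimensional ℚ F] : ∃ x ∈ F, ∃ y ∈ F, x ≠ 0 ∧ y ≠ 0 ∧ ¬ Sq (Dec A ⊓ F.fixingSubgroup) x ∧
      ¬ Sq (Dec A ⊓ F.fixingSubgroup) y ∧ ¬ Sq (Dec A ⊓ F.fixingSubgroup) (x * y) := by
  obtain ⟨u, hu, hu1, hns⟩ := h.nonsq hp F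
  obtain ⟨π, hπ, hπ0, hπ1, hπa⟩ := h.unif F
  have hu0 : u ≠ 0 := by rintro rfl; simp at hu1
  have key : ∀ a, A.valuation a = A.valuation π → ¬ Sq (Dec A ⊓ F.fixingSubgroup) a := by
    rintro a ha ⟨z, hz, hz2⟩
    have hz0 : z ≠ 0 := by
      rintro rfl
      rw [← hz2] at ha
      simp only [ne_eq, OfNat.ofNat_ne_zero, not_false_eq_true, zero_pow, map_zero] at ha
      exact (v_pos hπ0).ne ha
    obtain ⟨c, hc, hcv⟩ := h.im F hz hz0
    have hvc : A.valuation c = A.valuation z := by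
      have := A.valuation.map_sub_eq_of_lt_left hcv
      rw [sub_sub_cancel] at this
      exact this
    have hc0 : c ≠ 0 := by
      rintro rfl
      rw [map_zero] at hvc
      exact (v_pos hz0).ne hvc
    obtain ⟨k, hk⟩ := hπa c hc hc0
    rw [← hz2, map_pow, ← hvc, hk] at ha
    rw [← zpow_natCast, ← zpow_mul] at ha
    have h1 : A.valuation π ^ (k * ((2 : ℕ) : ℤ)) = A.valuation π ^ (1 : ℤ) := by rw [ha, zpow_one]
    have := (zpow_right_injective₀ (v_pos hπ0) hπ1.ne) h1
    omega
  refine ⟨π, hπ, u, hu, hπ0, hu0, key π rfl, ?_, key _ (by rw [map_mul, hu1, mul_one])⟩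
  rintro ⟨z, hz, hz2⟩
  have hz1 : A.valuation z = 1 := by
    have : A.valuation z ^ 2 = 1 := by rw [← map_pow, hz2, hu1]
    exact (pow_eq_one_iff_of_nonneg zero_le (by norm_num)).1 this
  have hz0 : z ≠ 0 := by rintro rfl; simp at hz1
  obtain ⟨c, hc, hcv⟩ := h.im F hz hz0
  rw [hz1] at hcv
  have hc1 : A.valuation c = 1 := by
    rw [Valuation.map_sub_swap] at hcv
    exact eq_one_of_sub_lt hz1 hcv
  refine hns c hc ?_
  rw [← hz2]
  exact pow_sub_lt 2 hz1.le hc1.le hcv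

/-- the group theoretic characterization of decomposition groups -/
def PropD (D : Subgroup Gal(Ω/ℚ)) : Prop :=
  ∃ U0, OpenIn U0 D ∧ ∀ U, OpenIn U U0 → Ci U ∧ ∃ W1 W2 : Subgroup Gal(Ω/ℚ), W1 ≠ W2 ∧
    (W1 ≤ U ∧ IsClosed (W1 : Set Gal(Ω/ℚ)) ∧ W1.relIndex U = 2) ∧
    (W2 ≤ U ∧ IsClosed (W2 : Set Gal(Ω/ℚ)) ∧ W2.relIndex U = 2)

theorem ex_i : ∃ i : Ω, i ^ 2 = -1 := ex_root (-1) (by norm_num)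

theorem two_sub {U : Subgroup Gal(Ω/ℚ)} (hU : IsClosed (U : Set Gal(Ω/ℚ))) {x y : Ω} (hx : x ∈ fx U) (hy : y ∈ fx U)
    (hy0 : y ≠ 0) (hxs : ¬ Sq U x) (hys : ¬ Sq U y) (hxy : ¬ Sq U (x * y)) :
    ∃ W1 W2 : Subgroup Gal(Ω/ℚ), W1 ≠ W2 ∧
    (W1 ≤ U ∧ IsClosed (W1 : Set Gal(Ω/ℚ)) ∧ W1.relIndex U = 2) ∧
    (W2 ≤ U ∧ IsClosed (W2 : Set Gal(Ω/ℚ)) ∧ W2.relIndex U = 2) := by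
  obtain ⟨a, ha⟩ := ex_root x (n := 2) (by norm_num)
  obtain ⟨b, hb⟩ := ex_root y (n := 2) (by norm_num)
  have haU : a ∉ fx U := fun h => hxs ⟨a, h, ha⟩
  have hbU : b ∉ fx U := fun h => hys ⟨b, h, hb⟩
  have ha2 : a ^ 2 ∈ fx U := by rwa [ha]
  have hb2 : b ^ 2 ∈ fx U := by rwa [hb]
  refine ⟨st U a, st U b, fun he => hxy ⟨a * b, mem_fix.2 fun g hg => ?_, by rw [mul_pow, ha, hb]⟩,
    ⟨st_le, (openIn_st hU a).2.1, (kum2_two ha2 haU).1⟩, ⟨st_le, (openIn_st hU b).2.1, (kum2_two hb2 hbU).1⟩⟩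
  have hiff : g a = a ↔ g b = b := by
    have h1 : g ∈ st U a ↔ g ∈ st U b := by rw [he]
    simpa [mem_st, hg] using h1
  rw [map_mul]
  rcases pm ha2 hg with h1 | h1
  · rw [h1, hiff.1 h1]
  · rcases pm hb2 hg with h2 | h2
    · rw [hiff.2 h2, h2]
    · rw [h1, h2]; ring

/-- Lemma P -/
theorem Over.propD {A : ValuationSubring Ω} {p : ℕ} (h : Over A p) (hp : p ≠ 2) {H : Subgroup Gal(Ω/ℚ)}
    (hH : IsOpen (H : Set Gal(Ω/ℚ))) : PropD (Dec A ⊓ H) := by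
  obtain ⟨i, hi⟩ := ex_i (Ω := Ω)
  have hDc : IsClosed ((Dec A ⊓ H : Subgroup Gal(Ω/ℚ)) : Set Gal(Ω/ℚ)) :=
    Dec_closed.inter (H.isClosed_of_isOpen hH)
  refine ⟨st (Dec A ⊓ H) i, openIn_st hDc i, fun U hU => ?_⟩
  have hUA : U ≤ Dec A := hU.1.trans (st_le.trans inf_le_left)
  have hiU : i ∈ fx U := mem_fix.2 fun g hg => (mem_st.1 (hU.1 hg)).2
  refine ⟨(h.rig hp hUA hi hiU).ci hi hiU, ?_⟩
  have hUD : OpenIn U (Dec A) := (hU.trans (openIn_st hDc i)).trans (openIn_inf Dec_closed hH)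
  obtain ⟨F, hF, rfl⟩ := hUD.desc
  obtain ⟨x, hx, y, hy, hx0, hy0, h1, h2, h3⟩ := h.two_cl hp F
  have hle : F ≤ fx (Dec A ⊓ F.fixingSubgroup) := le_fx inf_le_right
  exact two_sub hU.2.1 (hle hx) (hle hy) hy0 h1 h2 h3

end NU


namespace NU
open Polynomial
open scoped Pointwise
set_option linter.unusedSectionVars false
set_option linter.style.haveILetI false
set_option linter.unusedVariables false

variable {Ω : Type*} [Field Ω] [CharZero Ω] 

/-- extension of a valuation ring -/
theorem extend {L : IntermediateField ℚ Ω} (O : ValuationSubring L) :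
    ∃ B : ValuationSubring Ω, ∀ z : L, (B.valuation (z : Ω) ≤ 1 ↔ z ∈ O) := by
  let S : Subring Ω := O.toSubring.map (algebraMap L Ω)
  have hS : ∀ s : S, ∃ z : L, z ∈ O ∧ (z : Ω) = s := fun s => by
    obtain ⟨z, hz, hzs⟩ := s.2
    exact ⟨z, hz, hzs⟩
  let I : Ideal S :=
    { carrier := {s | ∃ z : L, O.valuation z < 1 ∧ (z : Ω) = s}
      add_mem' := by
        rintro a b ⟨z, hz, hza⟩ ⟨w, hw, hwb⟩
        exact ⟨z + w, O.valuation.map_add_lt hz hw, by simp [hza, hwb]⟩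
      zero_mem' := ⟨0, by simp, by simp⟩
      smul_mem' := by
        rintro c a ⟨z, hz, hza⟩
        obtain ⟨w, hw, hwc⟩ := hS c
        refine ⟨w * z, ?_, by simp [hza, hwc]⟩
        rw [map_mul]
        exact mul_lt_one_of_nonneg_of_lt_one_right ((O.valuation_le_one_iff w).2 hw) zero_le hz }
  have hI : I ≠ ⊤ := by
    rw [Ideal.ne_top_iff_one]
    rintro ⟨z, hz, hz1⟩
    have : z = 1 := Subtype.ext hz1
    rw [this] at hz
    simp at hz
  obtain ⟨B, hB1, hB2⟩ := Ideal.image_subset_nonunits_valuationSubring I hI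
  refine ⟨B, fun z => ⟨fun h => ?_, fun h => ?_⟩⟩
  · by_contra hz
    have hz0 : z ≠ 0 := by rintro rfl; exact hz (zero_mem _)
    have h1 : O.valuation z⁻¹ < 1 := by
      rw [← O.valuation_le_one_iff, not_le] at hz
      rw [map_inv₀]; exact inv_lt_one_of_one_lt₀ hz
    have h2 : B.valuation ((z⁻¹ : L) : Ω) < 1 := by
      refine hB2 ⟨⟨((z⁻¹ : L) : Ω), ⟨z⁻¹, (O.valuation_le_one_iff _).1 h1.le, rfl⟩⟩, ⟨z⁻¹, h1, rfl⟩, rfl⟩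
    have hz0' : (z : Ω) ≠ 0 := by exact_mod_cast hz0
    rw [IntermediateField.coe_inv, map_inv₀, inv_lt_one₀ (v_pos hz0')] at h2
    exact absurd h (not_le.2 h2)
  · exact (B.valuation_le_one_iff _).2 (hB1 ⟨z, h, rfl⟩)

/-- a good place -/
def Good (U : Subgroup Gal(Ω/ℚ)) (A : ValuationSubring Ω) : Prop :=
  A ≠ ⊤ ∧ ∀ y ∈ fx U, A.valuation y < 1 → Sq U (1 + y)

theorem Sq.mul {U : Subgroup Gal(Ω/ℚ)} {x y : Ω} : Sq U x → Sq U y → Sq U (x * y) := by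
  rintro ⟨z, hz, rfl⟩ ⟨w, hw, rfl⟩
  exact ⟨z * w, mul_mem hz hw, by ring⟩

theorem Sq.div {U : Subgroup Gal(Ω/ℚ)} {x y : Ω} : Sq U x → Sq U y → Sq U (x / y) := by
  rintro ⟨z, hz, rfl⟩ ⟨w, hw, rfl⟩
  exact ⟨z / w, div_mem hz hw, by rw [div_pow]⟩

theorem Sq.of_mul {U : Subgroup Gal(Ω/ℚ)} {x y : Ω} (h : Sq U (x * y)) (hy : Sq U y) (hy0 : y ≠ 0) : Sq U x := by
  have := h.div hy
  rwa [mul_div_cancel_right₀ _ hy0] at this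

theorem Sq.self {U : Subgroup Gal(Ω/ℚ)} {x : Ω} (hx : x ∈ fx U) : Sq U (x ^ 2) := ⟨x, hx, rfl⟩

variable [Algebra.IsAlgebraic ℚ Ω] [IsAlgClosed Ω]

theorem three {U : Subgroup Gal(Ω/ℚ)} {W1 W2 : Subgroup Gal(Ω/ℚ)} (hne : W1 ≠ W2)
    (h1 : W1 ≤ U ∧ IsClosed (W1 : Set Gal(Ω/ℚ)) ∧ W1.relIndex U = 2)
    (h2 : W2 ≤ U ∧ IsClosed (W2 : Set Gal(Ω/ℚ)) ∧ W2.relIndex U = 2) :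
    ∃ x ∈ fx U, ∃ y ∈ fx U, x ≠ 0 ∧ y ≠ 0 ∧ ¬ Sq U x ∧ ¬ Sq U y ∧ ¬ Sq U (x * y) := by
  obtain ⟨a, haW, ha0, ha2, hag⟩ := kum1_two h1.2.1 h1.1 h1.2.2
  obtain ⟨b, hbW, hb0, hb2, hbg⟩ := kum1_two h2.2.1 h2.1 h2.2.2
  have key : ∀ {W : Subgroup Gal(Ω/ℚ)} {a : Ω}, W ≤ U → W.relIndex U = 2 → (∀ g ∈ U, g a = a ↔ g ∈ W) →
      ¬ Sq U (a ^ 2) := by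
    rintro W a hWU hW hag ⟨z, hz, hza⟩
    have haU : a ∈ fx U := by
      rcases sq_eq_sq_iff_eq_or_eq_neg.1 hza with h | h
      · rwa [h] at hz
      · rw [h] at hz; simpa using neg_mem hz
    have : W = U := le_antisymm hWU fun g hg => (hag g hg).1 (mem_fix.1 haU g hg)
    rw [this, Subgroup.relIndex_self] at hW
    norm_num at hW
  refine ⟨a ^ 2, ha2, b ^ 2, hb2, pow_ne_zero _ ha0, pow_ne_zero _ hb0, key h1.1 h1.2.2 hag, key h2.1 h2.2.2 hbg, ?_⟩
  rintro ⟨z, hz, hza⟩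
  rw [← mul_pow] at hza
  have habU : a * b ∈ fx U := by
    rcases sq_eq_sq_iff_eq_or_eq_neg.1 hza with h | h
    · rwa [h] at hz
    · rw [h] at hz; simpa using neg_mem hz
  apply hne
  have hh : ∀ g ∈ U, g a = a ↔ g b = b := by
    intro g hg
    have h3 := mem_fix.1 habU g hg
    rw [map_mul] at h3
    constructor
    · intro h4; rw [h4] at h3; exact mul_left_cancel₀ ha0 h3
    · intro h4; rw [h4] at h3; exact mul_right_cancel₀ hb0 h3
  ext g
  constructor
  · intro hg; exact (hbg g (h1.1 hg)).1 ((hh g (h1.1 hg)).1 ((hag g (h1.1 hg)).2 hg))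
  · intro hg; exact (hag g (h2.1 hg)).1 ((hh g (h2.1 hg)).2 ((hbg g (h2.1 hg)).2 hg))

/-- existence of good places -/
theorem ex_good {U : Subgroup Gal(Ω/ℚ)} (hr : Rig U) {i : Ω} (hi : i ^ 2 = -1) (hiU : i ∈ fx U)
    {x y : Ω} (hx : x ∈ fx U) (hy : y ∈ fx U) (hx0 : x ≠ 0) (hy0 : y ≠ 0) (hxs : ¬ Sq U x) (hys : ¬ Sq U y)
    (hxy : ¬ Sq U (x * y)) : ∃ A, Good U A := by
  have hT : SqLike (fun z : fx U => z ≠ 0 ∧ Sq U (z : Ω)) := by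
    refine ⟨fun x h => h.1, fun x y h h' => ⟨mul_ne_zero h.1 h'.1, ?_⟩, ⟨by norm_num, ⟨i, hiU, by simp [hi]⟩⟩,
      fun x h => ⟨mul_ne_zero h h, ⟨x, x.2, by push_cast; ring⟩⟩, ?_⟩
    · have := h.2.mul h'.2
      exact_mod_cast this
    · intro x hx0 hx
      have hx0' : (x : Ω) ≠ 0 := by exact_mod_cast hx0
      have hns : ¬ Sq U (x : Ω) := fun h => hx ⟨hx0, h⟩
      have hx1 : 1 + x ≠ 0 := by
        intro h1
        apply hns
        have : (x : Ω) = -1 := by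
          have h2 : x = -1 := by linear_combination h1
          rw [h2]; simp
        exact ⟨i, hiU, by rw [hi, this]⟩
      rcases hr x x.2 hx0' hns with h | h
      · exact Or.inl ⟨hx1, by exact_mod_cast h⟩
      · exact Or.inr ⟨mul_ne_zero hx0 hx1, by exact_mod_cast h⟩
  obtain ⟨O, hO, hO1⟩ := hT.exists_valuationSubring (x := ⟨x, hx⟩) (y := ⟨y, hy⟩)
    (fun h => hx0 (congrArg Subtype.val h)) (fun h => hy0 (congrArg Subtype.val h)) (fun h => hxs h.2) (fun h => hys h.2)
    (fun h => hxy h.2)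
  obtain ⟨A, hA⟩ := extend O
  refine ⟨A, ?_, fun y hy hv => ?_⟩
  · rintro rfl
    apply hO
    ext z
    simp only [ValuationSubring.mem_top, iff_true]
    rw [← hA, ValuationSubring.valuation_le_one_iff]
    trivial
  · have h1 : (⟨y, hy⟩ : fx U) ∈ O := (hA _).1 hv.le
    have h2 := hO1 _ h1 (by
      by_cases hy0 : y = 0
      · left; ext; exact hy0
      · right
        rw [← hA, not_le, IntermediateField.coe_inv, map_inv₀]
        exact (one_lt_inv₀ (v_pos hy0)).2 hv)
    exact h2.2

theorem Good.uniq {U : Subgroup Gal(Ω/ℚ)} {A B : ValuationSubring Ω} (hA : Good U A) (hB : Good U B)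
    {a : Ω} (ha : a ∈ fx U) (ha0 : a ≠ 0) (has : ¬ Sq U a) : Same (fx U) A B := by
  by_contra hc
  obtain ⟨b, hb, h1, h2⟩ := approx hA.1 hB.1 hc ha ha0
  have s1 := hA.2 _ (sub_mem (div_mem hb ha) (one_mem _)) h1
  have s2 := hB.2 _ (sub_mem hb (one_mem _)) h2
  rw [add_sub_cancel] at s1 s2
  have hb0 : b ≠ 0 := by rintro rfl; simp at h2
  have := s2.div s1
  rw [div_div_cancel₀ hb0] at this
  exact has this

theorem Good.odd {U : Subgroup Gal(Ω/ℚ)} {A : ValuationSubring Ω} (hA : Good U A) {p : ℕ} (h : Over A p)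
    {x y : Ω} (hx : x ∈ fx U) (hy : y ∈ fx U) (hx0 : x ≠ 0) (hy0 : y ≠ 0) (hxs : ¬ Sq U x) (hys : ¬ Sq U y)
    (hxy : ¬ Sq U (x * y)) : p ≠ 2 := by
  rintro rfl
  have two : ∀ N : ℕ, 1 ≤ N → ∀ u ∈ fx U, A.valuation u = 1 → A.valuation (u ^ N - 1) < 1 → Sq U u := by
    intro N
    induction N using Nat.strong_induction_on with
    | _ N ih =>
      intro hN u hu hu1 hv
      have hu0 : u ≠ 0 := by rintro rfl; simp at hu1
      rcases Nat.even_or_odd' N with ⟨M, rfl | rfl⟩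
      · refine ih M (by omega) (by omega) u hu hu1 ?_
        have hw : A.valuation (u ^ M) = 1 := by rw [map_pow, hu1, one_pow]
        have e : (u ^ M - 1) ^ 2 = (u ^ (2 * M) - 1) - ((2 : ℕ) : Ω) * (u ^ M - 1) := by
          rw [mul_comm 2 M, pow_mul]; push_cast; ring
        have h1 : A.valuation ((u ^ M - 1) ^ 2) < 1 := by
          rw [e]
          exact A.valuation.map_sub_lt hv (mul_lt_one' h.2 (A.valuation.map_sub_le hw.le (by simp)))
        rw [map_pow] at h1
        by_contra hc
        exact absurd h1 (not_lt.2 (one_le_pow₀ (not_lt.1 hc)))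
      · have h1 := hA.2 _ (sub_mem (pow_mem hu _) (one_mem _)) hv
        rw [add_sub_cancel, pow_succ', pow_mul'] at h1
        exact h1.of_mul (Sq.self (pow_mem hu M)) (pow_ne_zero _ (pow_ne_zero _ hu0))
  have unit : ∀ u ∈ fx U, A.valuation u = 1 → Sq U u := by
    intro u hu hu1
    obtain ⟨N, hN, hv⟩ := h.fin hu1
    exact two N hN u hu hu1 hv
  have fin : ∀ m n : ℤ, ¬ (Even m ∧ Even n) → A.valuation (x ^ m * y ^ n) ≠ 1 := by
    intro m n hmn hv
    have s := unit _ (mul_mem (zpow_mem hx m) (zpow_mem hy n)) hv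
    have ev : ∀ {x : Ω}, x ∈ fx U → ∀ k : ℤ, Sq U (x ^ (2 * k)) := fun hx k =>
      ⟨_, zpow_mem hx k, by rw [mul_comm, zpow_mul]; norm_cast⟩
    rcases Int.even_or_odd' m with ⟨m', rfl | rfl⟩ <;> rcases Int.even_or_odd' n with ⟨n', rfl | rfl⟩
    · exact hmn ⟨by simp, by simp⟩
    · rw [zpow_add₀ hy0, zpow_one] at s
      apply hys
      have e : x ^ (2 * m') * (y ^ (2 * n') * y) = y * (x ^ (2 * m') * y ^ (2 * n')) := by ring
      rw [e] at s
      exact s.of_mul ((ev hx _).mul (ev hy _)) (mul_ne_zero (zpow_ne_zero _ hx0) (zpow_ne_zero _ hy0))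
    · rw [zpow_add₀ hx0, zpow_one] at s
      apply hxs
      have e : x ^ (2 * m') * x * y ^ (2 * n') = x * (x ^ (2 * m') * y ^ (2 * n')) := by ring
      rw [e] at s
      exact s.of_mul ((ev hx _).mul (ev hy _)) (mul_ne_zero (zpow_ne_zero _ hx0) (zpow_ne_zero _ hy0))
    · rw [zpow_add₀ hx0, zpow_one, zpow_add₀ hy0, zpow_one] at s
      apply hxy
      have e : x ^ (2 * m') * x * (y ^ (2 * n') * y) = x * y * (x ^ (2 * m') * y ^ (2 * n')) := by ring
      rw [e] at s
      exact s.of_mul ((ev hx _).mul (ev hy _)) (mul_ne_zero (zpow_ne_zero _ hx0) (zpow_ne_zero _ hy0))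
  obtain ⟨j, hj, -, k, hk⟩ := h.tie hx0
  obtain ⟨j', hj', -, k', hk'⟩ := h.tie hy0
  have hp0 : A.valuation ((2 : ℕ) : Ω) ≠ 0 := (v_pos (by norm_num)).ne'
  by_cases hk0 : k = 0
  · refine fin 1 0 (by simp) ?_
    rw [hk0, zpow_zero] at hk
    rw [zpow_one, zpow_zero, mul_one]
    exact (pow_eq_one_iff_of_nonneg zero_le (by omega)).1 hk
  set d := Int.gcd (k' * j) (- (k * j')) with hd
  have hd0 : d ≠ 0 := by
    rw [hd, Ne, Int.gcd_eq_zero_iff]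
    rintro ⟨-, h2⟩
    have : (k * j' : ℤ) ≠ 0 := mul_ne_zero hk0 (by omega)
    omega
  obtain ⟨m, hm⟩ : (d : ℤ) ∣ k' * j := Int.gcd_dvd_left ..
  obtain ⟨n, hn⟩ : (d : ℤ) ∣ - (k * j') := Int.gcd_dvd_right ..
  refine fin m n ?_ ?_
  · rintro ⟨⟨a, ha⟩, ⟨b, hb⟩⟩
    have h1 : ((d * 2 : ℕ) : ℤ) ∣ d := by
      conv_rhs => rw [hd]
      refine Int.dvd_coe_gcd ?_ ?_
      · rw [hm, ha]; exact ⟨a, by push_cast; ring⟩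
      · rw [hn, hb]; exact ⟨b, by push_cast; ring⟩
    have h2 := Nat.le_of_dvd (Nat.pos_of_ne_zero hd0) (by exact_mod_cast h1)
    omega
  · have hpow : A.valuation (x ^ m * y ^ n) ^ (d * j * j') = 1 := by
      rw [map_mul, map_zpow₀, map_zpow₀, mul_pow, ← zpow_natCast, ← zpow_natCast, ← zpow_mul, ← zpow_mul]
      have e1 : m * ((d * j * j' : ℕ) : ℤ) = (j : ℤ) * (k' * j * j') := by
        push_cast; rw [hm]; ring
      have e2 : n * ((d * j * j' : ℕ) : ℤ) = (j' : ℤ) * (- (k * j') * j) := by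
        push_cast; rw [hn]; ring
      rw [e1, e2, zpow_mul _ (j : ℤ), zpow_natCast, hk, zpow_mul _ (j' : ℤ), zpow_natCast, hk', ← zpow_mul, ← zpow_mul, ← zpow_add₀ hp0]
      have e3 : k * (k' * j * j') + k' * (- (k * j') * j) = 0 := by ring
      rw [e3, zpow_zero]
    refine (pow_eq_one_iff_of_nonneg zero_le ?_).1 hpow
    exact mul_ne_zero (mul_ne_zero hd0 (by omega)) (by omega)

end NU


namespace NU
open Polynomial
open scoped Pointwise
set_option linter.unusedSectionVars false
set_option linter.style.haveILetI false
set_option linter.unusedVariables false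

variable {Ω : Type*} [Field Ω] [CharZero Ω] [Algebra.IsAlgebraic ℚ Ω] [IsAlgClosed Ω]

/-- Normal closure inside `Ω`. -/
theorem ex_normal (F : IntermediateField ℚ Ω) [FiniteDimensional ℚ F] :
    ∃ N : IntermediateField ℚ Ω, F ≤ N ∧ FiniteDimensional ℚ N ∧ N.fixingSubgroup.Normal ∧ IsGalois ℚ N := by
  have h1 : Normal ℚ (IntermediateField.normalClosure ℚ F Ω) := normalClosure.normal ℚ F Ω
  have h2 : IsGalois ℚ (IntermediateField.normalClosure ℚ F Ω) := ⟨⟩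
  refine ⟨IntermediateField.normalClosure ℚ F Ω, F.le_normalClosure, inferInstance, ?_, h2⟩
  infer_instance

theorem exists_core {U D : Subgroup Gal(Ω/ℚ)} (hD : IsClosed (D : Set Gal(Ω/ℚ))) (h : OpenIn U D) :
    ∃ V ≤ U, OpenIn V D ∧ ∀ d ∈ D, ∀ v ∈ V, d * v * d⁻¹ ∈ V := by
  obtain ⟨F, hF, rfl⟩ := h.desc
  obtain ⟨N, hFN, hN, hn, -⟩ := ex_normal F
  refine ⟨D ⊓ N.fixingSubgroup, inf_le_inf le_rfl (IntermediateField.fixingSubgroup_le hFN),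
    openIn_inf hD (open_fixing N), fun d hd v hv => ?_⟩
  rw [Subgroup.mem_inf] at hv ⊢
  exact ⟨mul_mem (mul_mem hd hv.1) (inv_mem hd), hn.conj_mem v hv.2 d⟩

theorem Good.smul {U : Subgroup Gal(Ω/ℚ)} {A : ValuationSubring Ω} (hA : Good U A) {d : Gal(Ω/ℚ)}
    (hd : ∀ v ∈ U, d * v * d⁻¹ ∈ U) (hd' : ∀ v ∈ U, d⁻¹ * v * d ∈ U) : Good U (d • A) := by
  refine ⟨?_, fun y hy hv => ?_⟩
  · intro h
    apply hA.1
    obtain ⟨h1, h2⟩ := hA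
    rw [← inv_smul_smul d A, h]
    ext x
    rw [ValuationSubring.mem_pointwise_smul_iff_inv_smul_mem]
    simp
  · rw [smul_lt] at hv
    have h1 : d⁻¹ y ∈ fx U := mem_fix.2 fun v hv => by
      have := mem_fix.1 hy _ (hd v hv)
      have e : v (d⁻¹ y) = d⁻¹ ((d * v * d⁻¹) y) := by
        rw [← AlgEquiv.mul_apply, ← AlgEquiv.mul_apply]; congr 1; group
      rw [e, this]
    obtain ⟨z, hz, hz2⟩ := hA.2 _ h1 hv
    refine ⟨d z, mem_fix.2 fun v hv => ?_, ?_⟩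
    · have := mem_fix.1 hz _ (hd' v hv)
      have e : v (d z) = d ((d⁻¹ * v * d) z) := by
        rw [← AlgEquiv.mul_apply, ← AlgEquiv.mul_apply]; congr 1; group
      rw [e, this]
    · rw [← map_pow, hz2, map_add, map_one, ← AlgEquiv.mul_apply]; simp

theorem Good.up {U U1 : Subgroup Gal(Ω/ℚ)} {A : ValuationSubring Ω} {p : ℕ} (hA : Good U1 A) (h : Over A p) (hp : p ≠ 2)
    (hU : U1 ≤ U) (hn : ∀ d ∈ U, ∀ v ∈ U1, d * v * d⁻¹ ∈ U1) {a : Ω} (ha : a ∈ fx U1) (ha0 : a ≠ 0)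
    (has : ¬ Sq U1 a) : Good U A := by
  refine ⟨hA.1, fun y hy hv => ?_⟩
  have ht : A.valuation (2 : Ω) = 1 := by
    have := h.coprime (n := 2)
    exact_mod_cast this (by
      intro h1
      have h2 : p ∣ 2 := by exact_mod_cast h1
      exact hp ((Nat.prime_dvd_prime_iff_eq h.1 Nat.prime_two).1 h2))
  obtain ⟨z, hz, hz2, hz1⟩ : ∃ z ∈ fx U1, z ^ 2 = 1 + y ∧ A.valuation (z - 1) < 1 := by
    obtain ⟨z, hz, hz2⟩ := hA.2 y (fx_mono hU hy) hv
    have e : (z - 1) * (z + 1) = y := by linear_combination hz2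
    by_cases h1 : A.valuation (z - 1) < 1
    · exact ⟨z, hz, hz2, h1⟩
    · refine ⟨-z, neg_mem hz, by rw [neg_sq, hz2], ?_⟩
      have e2 : -z - 1 = -(z + 1) := by ring
      rw [e2, Valuation.map_neg]
      by_contra h2
      rw [← e, map_mul] at hv
      exact absurd hv (not_lt.2 (one_le_mul (not_lt.1 h1) (not_lt.1 h2)))
  refine ⟨z, mem_fix.2 fun g hg => ?_, hz2⟩
  rcases pm (U := U) (α := z) (by rw [hz2]; exact add_mem (one_mem _) hy) hg with h1 | h1
  · exact h1
  exfalso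
  have hs : Same (fx U1) (g • A) A := (hA.smul (hn g hg) (fun v hv => by
    simpa using hn g⁻¹ (inv_mem hg) v hv)).uniq hA ha ha0 has
  have h2 : (g • A).valuation (g (z - 1)) < 1 := smul_lt'.2 hz1
  rw [map_sub, map_one, h1, hs.lt (sub_mem (neg_mem hz) (one_mem _))] at h2
  have h3 := A.valuation.map_add_lt hz1 h2
  have e : z - 1 + (-z - 1) = -2 := by ring
  rw [e, Valuation.map_neg, ht] at h3
  exact lt_irrefl _ h3

theorem Over.ne {A : ValuationSubring Ω} {p : ℕ} (h : Over A p) : A ≠ ⊤ := h.ne_top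

/-- Lemma D -/
theorem PropD.dec {D : Subgroup Gal(Ω/ℚ)} (hD : IsClosed (D : Set Gal(Ω/ℚ))) (h : PropD D) :
    ∃ A p, Over A p ∧ p ≠ 2 ∧ D ≤ Dec A := by
  obtain ⟨U00, hU00, hP⟩ := h
  obtain ⟨i, hi⟩ := ex_i (Ω := Ω)
  obtain ⟨U0, hU0', hU0, hn0⟩ := exists_core hD ((openIn_st hU00.2.1 i).trans hU00)
  have hiU0 : i ∈ fx U0 := mem_fix.2 fun g hg => (mem_st.1 (hU0' hg)).2
  have data : ∀ U, OpenIn U U0 → ∃ A p, Good U A ∧ Over A p ∧ p ≠ 2 ∧ ∃ a ∈ fx U, a ≠ 0 ∧ ¬ Sq U a := by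
    intro U hU
    have hU' : OpenIn U U00 := (hU.trans hU0).sub (hU.1.trans (hU0'.trans st_le)) hU00.1
    obtain ⟨hC, W1, W2, hne, h1, h2⟩ := hP U hU'
    have hiU := fx_mono hU.1 hiU0
    have hr := hC.rig hU.2.1 hi hiU
    obtain ⟨x, hx, y, hy, hx0, hy0, hxs, hys, hxy⟩ := three hne h1 h2
    obtain ⟨A, hA⟩ := ex_good hr hi hiU hx hy hx0 hy0 hxs hys hxy
    obtain ⟨p, hp⟩ := exists_over hA.1
    exact ⟨A, p, hA, hp, hA.odd hp hx hy hx0 hy0 hxs hys hxy, x, hx, hx0, hxs⟩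
  obtain ⟨A0, p0, hA0, hp0, hp02, a0, ha0, ha00, has0⟩ := data U0 (OpenIn.refl hU0.2.1)
  refine ⟨A0, p0, hp0, hp02, fun d hd => mem_Dec fun x => ?_⟩
  obtain ⟨U1, hU1', hU1, hn1⟩ := exists_core hD (((openIn_st hU0.2.1 (d x)).trans hU0))
  have h10 : OpenIn U1 U0 := hU1.sub (hU1'.trans st_le) hU0.1
  obtain ⟨A1, p1, hA1, hp1, hp12, a1, ha1, ha10, has1⟩ := data U1 h10
  have hA1U0 := hA1.up hp1 hp12 h10.1 (fun d hd => hn1 d (hU0.1 hd)) ha1 ha10 has1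
  obtain ⟨g, hg, hgA⟩ := trans hA1.1 hA0.1 hU0.2.1 (hA1U0.uniq hA0 ha0 ha00 has0)
  have inv : ∀ d ∈ D, ∀ v ∈ U1, d⁻¹ * v * d ∈ U1 := fun d hd v hv => by
    simpa using hn1 d⁻¹ (inv_mem hd) v hv
  have h0 : Good U1 A0 := hgA ▸ hA1.smul (hn1 g (hU0.1 hg)) (inv g (hU0.1 hg))
  have h0d := h0.smul (hn1 d hd) (inv d hd)
  have hs := h0.uniq h0d ha1 ha10 has1
  rw [hs (d x) (mem_fix.2 fun v hv => (mem_st.1 (hU1' hv)).2), smul_le']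

theorem Over.good {A : ValuationSubring Ω} {p : ℕ} (h : Over A p) (hp : p ≠ 2) {U : Subgroup Gal(Ω/ℚ)}
    (hU : U ≤ Dec A) : Good U A :=
  ⟨h.ne_top, fun y hy hv => by
    obtain ⟨z, hz, hz2, -⟩ := h.root Nat.prime_two hp.symm hU hy hv
    exact ⟨z, hz, hz2⟩⟩

theorem PropD.unique {D : Subgroup Gal(Ω/ℚ)} (hD : IsClosed (D : Set Gal(Ω/ℚ))) (h : PropD D)
    {A B : ValuationSubring Ω} {p q : ℕ} (hA : Over A p) (hB : Over B q) (hp : p ≠ 2) (hq : q ≠ 2)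
    (hDA : D ≤ Dec A) (hDB : D ≤ Dec B) : A = B := by
  obtain ⟨U0, hU0, hP⟩ := h
  ext x
  rw [← ValuationSubring.valuation_le_one_iff, ← ValuationSubring.valuation_le_one_iff]
  obtain ⟨-, W1, W2, hne, h1, h2⟩ := hP _ (openIn_st hU0.2.1 x)
  obtain ⟨a, ha, -, -, ha0, -, has, -⟩ := three hne h1 h2
  have hle : st U0 x ≤ D := st_le.trans hU0.1
  exact (hA.good hp (hle.trans hDA)).uniq (hB.good hq (hle.trans hDB)) ha ha0 has x
    (mem_fix.2 fun g hg => (mem_st.1 hg).2)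

end NU


namespace NU
open Polynomial
open scoped Pointwise
set_option linter.unusedSectionVars false
set_option linter.style.haveILetI false
set_option linter.unusedVariables false

variable {Ω : Type*} [Field Ω] [CharZero Ω] [Algebra.IsAlgebraic ℚ Ω] [IsAlgClosed Ω]

/-- Group theoretic characterization of the residue characteristic. -/
def Ql (l : ℕ) (D : Subgroup Gal(Ω/ℚ)) : Prop :=
  ∀ U0, OpenIn U0 D → ∀ n : ℕ, ∃ U, OpenIn U U0 ∧ ∃ W : Fin n → Subgroup Gal(Ω/ℚ), Function.Injective W ∧
    ∀ i, W i ≤ U ∧ IsClosed (W i : Set Gal(Ω/ℚ)) ∧ (W i).relIndex U = l ∧ ∀ g ∈ U, ∀ w ∈ W i, g * w * g⁻¹ ∈ W i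

theorem Over.im_val {A : ValuationSubring Ω} {p : ℕ} (h : Over A p) (F : IntermediateField ℚ Ω)
    [FiniteDimensional ℚ F] {y : Ω} (hy : y ∈ fx (Dec A ⊓ F.fixingSubgroup)) (hy0 : y ≠ 0) :
    ∃ c ∈ F, c ≠ 0 ∧ A.valuation c = A.valuation y ∧ A.valuation (y / c - 1) < 1 := by
  obtain ⟨c, hc, hv⟩ := h.im F hy hy0
  have e : A.valuation c = A.valuation y := by
    have : c = y - (y - c) := by ring
    rw [this, A.valuation.map_sub_eq_of_lt_left hv]
  have hc0 : c ≠ 0 := by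
    rintro rfl; rw [map_zero] at e; exact (v_pos hy0).ne e
  refine ⟨c, hc, hc0, e, ?_⟩
  have : y / c - 1 = (y - c) / c := by field_simp
  rw [this, map_div₀, e]
  exact (div_lt_one₀ (v_pos hy0)).2 hv

theorem Over.not_ql {A : ValuationSubring Ω} {p l : ℕ} (h : Over A p) (hl : l.Prime) (hlp : l ≠ p)
    {H : Subgroup Gal(Ω/ℚ)} (hH : IsOpen (H : Set Gal(Ω/ℚ))) : ¬ Ql l (Dec A ⊓ H) := by
  intro hQ
  obtain ⟨ζ, hζ⟩ := ex_prim (Ω := Ω) hl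
  have hDc : IsClosed ((Dec A ⊓ H : Subgroup Gal(Ω/ℚ)) : Set Gal(Ω/ℚ)) :=
    Dec_closed.inter (H.isClosed_of_isOpen hH)
  obtain ⟨U, hU, W, hWi, hW⟩ := hQ _ (openIn_st hDc ζ) (l * l + 1)
  have hζU : ζ ∈ fx U := mem_fix.2 fun g hg => (mem_st.1 (hU.1 hg)).2
  have hUA : U ≤ Dec A := hU.1.trans (st_le.trans inf_le_left)
  obtain ⟨F, hF, hUF⟩ := ((hU.trans (openIn_st hDc ζ)).trans (openIn_inf Dec_closed hH)).desc
  have hFU : F ≤ fx U := le_fx (by rw [hUF]; exact inf_le_right)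
  obtain ⟨π, hπ, hπ0, hπ1, hπv⟩ := h.unif F
  obtain ⟨c, hc, hc1, -, hcg⟩ := h.gen F
  have hc0 : c ≠ 0 := by rintro rfl; simp at hc1
  have key : ∀ i, ∃ α : Ω, ∃ k : ℤ, ∃ j : ℕ, ∃ z ∈ fx U, α ≠ 0 ∧ z ≠ 0 ∧ (∀ g ∈ U, g α = α ↔ g ∈ W i) ∧
      α ^ l = π ^ k * c ^ j * z ^ l := by
    intro i
    obtain ⟨α, -, hα0, hαU, hα⟩ := kum1 hl hζ hζU (hW i).2.1 (hW i).1 (hW i).2.2.1 (hW i).2.2.2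
    obtain ⟨f, hf, hf0, -, hfv⟩ := h.im_val F (y := α ^ l) (by rwa [← hUF]) (pow_ne_zero _ hα0)
    obtain ⟨k, hk⟩ := hπv f hf hf0
    have hu1 : A.valuation (f / π ^ k) = 1 := by
      rw [map_div₀, map_zpow₀, hk, div_self (zpow_ne_zero _ (v_pos hπ0).ne')]
    obtain ⟨j, hj⟩ := hcg (f / π ^ k) (div_mem hf (zpow_mem hπ k)) hu1
    obtain ⟨z, hz, hz1, -⟩ := h.root hl hlp hUA (sub_mem (div_mem hαU (hFU hf)) (one_mem _)) hfv
    have hv2 : A.valuation (f / π ^ k / c ^ j - 1) < 1 := by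
      have : f / π ^ k / c ^ j - 1 = (f / π ^ k - c ^ j) / c ^ j := by
        rw [sub_div, div_self (pow_ne_zero _ hc0)]
      rw [this, map_div₀, map_pow, hc1, one_pow, div_one]; exact hj
    obtain ⟨w, hw, hw1, -⟩ := h.root hl hlp hUA
      (sub_mem (div_mem (div_mem (hFU hf) (zpow_mem (hFU hπ) k)) (pow_mem (hFU hc) j)) (one_mem _)) hv2
    rw [add_sub_cancel] at hz1 hw1
    have hπk : π ^ k ≠ 0 := zpow_ne_zero _ hπ0
    have hck : c ^ j ≠ 0 := pow_ne_zero _ hc0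
    have e : α ^ l = π ^ k * c ^ j * (w * z) ^ l := by
      rw [mul_pow, hz1, hw1]; field_simp
    refine ⟨α, k, j, w * z, mul_mem hw hz, hα0, ?_, hα, e⟩
    intro h0
    rw [h0, zero_pow hl.ne_zero, mul_zero] at e
    exact pow_ne_zero _ hα0 e
  choose α k j z hz hα0 hz0 hα he using key
  haveI : NeZero l := ⟨hl.ne_zero⟩
  obtain ⟨a, b, hab, hab'⟩ := Fintype.exists_ne_map_eq_of_card_lt
    (fun i : Fin (l * l + 1) => ((k i : ZMod l), (j i : ZMod l))) (by simp [ZMod.card])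
  simp only [Prod.mk.injEq] at hab'
  obtain ⟨h1, h2⟩ := hab'
  rw [ZMod.intCast_eq_intCast_iff_dvd_sub] at h1
  have h2' : ((j a : ℤ) : ZMod l) = ((j b : ℤ) : ZMod l) := by exact_mod_cast h2
  rw [ZMod.intCast_eq_intCast_iff_dvd_sub] at h2'
  obtain ⟨m, hm⟩ := h1
  obtain ⟨m', hm'⟩ := h2'
  apply hab
  apply hWi
  have e : (α b / α a / (π ^ m * c ^ m' * (z b / z a))) ^ l = 1 := by
    have hkb : k b = k a + m * l := by linarith
    have hjb : (j b : ℤ) = j a + m' * l := by linarith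
    have := hα0 a; have := hz0 a; have := hz0 b
    rw [div_pow, div_pow, he, he, mul_pow, mul_pow, div_pow, ← zpow_natCast (π ^ m), ← zpow_natCast (c ^ m'), ← zpow_mul, ← zpow_mul,
      hkb, ← zpow_natCast c (j b), hjb, ← zpow_natCast c (j a), zpow_add₀ hπ0, zpow_add₀ hc0]
    have := zpow_ne_zero (k a) hπ0
    have := zpow_ne_zero (m * l) hπ0
    have := zpow_ne_zero (j a) hc0
    have := zpow_ne_zero (m' * l) hc0
    field_simp
  obtain ⟨s, -, hs⟩ := hζ.eq_pow_of_pow_eq_one e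
  set q := ζ ^ s * (π ^ m * c ^ m' * (z b / z a)) with hq
  have hqU : q ∈ fx U := mul_mem (pow_mem hζU s) (mul_mem (mul_mem (zpow_mem (hFU hπ) _) (zpow_mem (hFU hc) _))
    (div_mem (hz b) (hz a)))
  have hnz : π ^ m * c ^ m' * (z b / z a) ≠ 0 := mul_ne_zero (mul_ne_zero (zpow_ne_zero _ hπ0) (zpow_ne_zero _ hc0))
    (div_ne_zero (hz0 b) (hz0 a))
  have hba : α b = q * α a := by
    rw [hq, hs, div_mul_cancel₀ _ hnz, div_mul_cancel₀ _ (hα0 a)]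
  have hq0 : q ≠ 0 := by rintro h0; rw [h0, zero_mul] at hba; exact hα0 b hba
  have hfix : ∀ g ∈ U, g (α a) = α a ↔ g (α b) = α b := by
    intro g hg
    rw [hba, map_mul, mem_fix.1 hqU g hg]
    exact ⟨fun h => by rw [h], fun h => mul_left_cancel₀ hq0 h⟩
  ext g
  constructor
  · intro hg
    have := (hW a).1 hg
    exact (hα b g this).1 ((hfix g this).1 ((hα a g this).2 hg))
  · intro hg
    have := (hW b).1 hg
    exact (hα a g this).1 ((hfix g this).2 ((hα b g this).2 hg))

/-- the nonpower lemma -/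
theorem Over.nonpow {A : ValuationSubring Ω} {p : ℕ} (h : Over A p) (F : IntermediateField ℚ Ω)
    [FiniteDimensional ℚ F] {π : Ω} (hπ0 : π ≠ 0) (hπ1 : A.valuation π < 1)
    (hπv : ∀ x ∈ F, x ≠ 0 → ∃ k : ℤ, A.valuation x = A.valuation π ^ k) {z c : Ω}
    (hz : z ∈ fx (Dec A ⊓ F.fixingSubgroup)) (hzc : z ^ p = 1 + c) {k : ℕ} (hk : ¬ p ∣ k)
    (hck : A.valuation c = A.valuation π ^ k) (hkp : A.valuation (p : Ω) < A.valuation π ^ k) : False := by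
  have hk0 : k ≠ 0 := by rintro rfl; simp at hk
  have hc1 : A.valuation c < 1 := by rw [hck]; exact pow_lt_one₀ zero_le hπ1 hk0
  have hz1 : A.valuation z ≤ 1 := by
    have : A.valuation (z ^ p) = 1 := by
      rw [hzc]; exact eq_one_of_sub_lt (y := 1) (by simp) (by simpa using hc1)
    rw [map_pow] at this
    exact ((pow_eq_one_iff_of_nonneg zero_le h.1.ne_zero).1 this).le
  have ht1 : A.valuation (z - 1) ≤ 1 := A.valuation.map_sub_le hz1 (by simp)
  obtain ⟨r, hr⟩ := exists_add_pow_prime_eq h.1 (1 : A) ⟨z - 1, (A.valuation_le_one_iff _).1 ht1⟩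
  have hr' := congrArg Subtype.val hr
  push_cast at hr'
  rw [add_sub_cancel, hzc, one_pow] at hr'
  have e1 : (z - 1) ^ p = c - p * ((z - 1) * r) := by linear_combination -hr'
  have hlt : A.valuation (p * ((z - 1) * r)) < A.valuation c := by
    rw [hck, map_mul, map_mul]
    refine lt_of_le_of_lt ?_ hkp
    refine mul_le_of_le_one_right' ?_
    exact mul_le_one' ht1 ((A.valuation_le_one_iff _).2 r.2)
  have e2 : A.valuation (z - 1) ^ p = A.valuation π ^ k := by
    rw [← map_pow, e1, A.valuation.map_sub_eq_of_lt_left hlt, hck]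
  have ht0 : z - 1 ≠ 0 := by
    intro h0
    rw [h0, map_zero, zero_pow h.1.ne_zero] at e2
    exact (pow_ne_zero _ (v_pos hπ0).ne') e2.symm
  obtain ⟨f, hf, hf0, hfv, -⟩ := h.im_val F (sub_mem hz (one_mem _)) ht0
  obtain ⟨m, hm⟩ := hπv f hf hf0
  rw [← hfv, hm, ← zpow_natCast, ← zpow_natCast, ← zpow_mul] at e2
  have := zpow_right_injective₀ (v_pos hπ0) hπ1.ne e2
  exact hk (by exact_mod_cast (Dvd.intro_left m this : (p : ℤ) ∣ k))

theorem Over.ql {A : ValuationSubring Ω} {p : ℕ} (h : Over A p)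
    {H : Subgroup Gal(Ω/ℚ)} (hH : IsOpen (H : Set Gal(Ω/ℚ))) : Ql p (Dec A ⊓ H) := by
  intro U0 hU0 n
  obtain ⟨F0, hF0, hUF0⟩ := (hU0.trans (openIn_inf Dec_closed hH)).desc
  obtain ⟨ζ, hζ⟩ := ex_prim (Ω := Ω) h.1
  set N := p * (n + 1) with hN
  have hN0 : 0 < N := Nat.mul_pos h.1.pos (by omega)
  obtain ⟨ϖ, hϖ⟩ := ex_root (p : Ω) hN0
  have hp0 : (p : Ω) ≠ 0 := by exact_mod_cast h.1.ne_zero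
  have hϖ0 : ϖ ≠ 0 := by rintro rfl; rw [zero_pow hN0.ne'] at hϖ; exact hp0 hϖ.symm
  haveI hE := fd_adjoin (Ω := Ω) (S := {ζ, ϖ}) (by simp)
  set F := F0 ⊔ IntermediateField.adjoin ℚ {ζ, ϖ} with hF
  haveI : FiniteDimensional ℚ F := IntermediateField.finiteDimensional_sup _ _
  have hζF : ζ ∈ F := (le_sup_right : _ ≤ F) (IntermediateField.subset_adjoin ℚ _ (by simp))
  have hϖF : ϖ ∈ F := (le_sup_right : _ ≤ F) (IntermediateField.subset_adjoin ℚ _ (by simp))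
  set U := Dec A ⊓ F.fixingSubgroup with hU
  have hFU : F ≤ fx U := le_fx inf_le_right
  have hUo : OpenIn U U0 := by
    have h1 : OpenIn U (Dec A) := openIn_inf Dec_closed (open_fixing F)
    refine h1.sub ?_ (hU0.1.trans inf_le_left)
    rw [hUF0]
    exact inf_le_inf le_rfl (IntermediateField.fixingSubgroup_le le_sup_left)
  obtain ⟨π, hπ, hπ0, hπ1, hπv⟩ := h.unif F
  have hvπ := v_pos (A := A) hπ0
  obtain ⟨a, ha⟩ := hπv ϖ hϖF hϖ0
  have hϖ1 : A.valuation ϖ < 1 := by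
    by_contra hc
    have := h.2
    rw [← hϖ, map_pow] at this
    exact absurd this (not_lt.2 (one_le_pow₀ (not_lt.1 hc)))
  have ha1 : A.valuation ϖ ≤ A.valuation π := by
    have : 1 ≤ a := by
      by_contra hc
      rw [ha] at hϖ1
      exact absurd hϖ1 (not_lt.2 (one_le_zpow_of_nonpos₀ hvπ hπ1.le (by omega)))
    rw [ha]
    calc A.valuation π ^ a ≤ A.valuation π ^ (1 : ℤ) := zpow_le_zpow_right_of_le_one₀ hvπ hπ1.le this
      _ = _ := zpow_one _
  have hkp : ∀ i : Fin n, A.valuation (p : Ω) < A.valuation π ^ (p * (i : ℕ) + 1) := by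
    intro i
    rw [← hϖ, map_pow]
    refine (pow_le_pow_left₀ zero_le ha1 N).trans_lt ?_
    refine pow_lt_pow_right_of_lt_one₀ hvπ hπ1 ?_
    have := i.2
    have := h.1.two_le
    rw [hN]; nlinarith
  have hnd : ∀ i : ℕ, ¬ p ∣ (p * i + 1) := by
    intro i hd
    have := (Nat.dvd_add_right (Dvd.intro _ rfl)).1 hd
    exact h.1.one_lt.ne' (Nat.dvd_one.1 this)
  have hroot : ∀ i : Fin n, ∃ α : Ω, α ^ p = 1 + π ^ (p * (i : ℕ) + 1) := fun i => ex_root _ h.1.pos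
  choose α hα using hroot
  have hαU : ∀ i, α i ^ p ∈ fx U := fun i => by
    rw [hα]; exact add_mem (one_mem _) (pow_mem (hFU hπ) _)
  have hαn : ∀ i, α i ∉ fx U := fun i hi =>
    h.nonpow F hπ0 hπ1 hπv hi (hα i) (hnd i) (by rw [map_pow]) (hkp i)
  have hα0 : ∀ i, α i ≠ 0 := fun i h0 => hαn i (by rw [h0]; exact zero_mem _)
  have hμ : ∀ z : Ω, z ^ p = 1 → z ∈ fx U := by
    intro z hz
    haveI : NeZero p := ⟨h.1.ne_zero⟩
    obtain ⟨s, -, rfl⟩ := hζ.eq_pow_of_pow_eq_one hz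
    exact pow_mem (hFU hζF) s
  have key : ∀ i j : Fin n, i < j → st U (α i) ≠ st U (α j) := by
    intro i j hij he
    obtain ⟨g, hg, hgj⟩ : ∃ g ∈ U, g (α j) ≠ α j := by
      by_contra hc
      push Not at hc
      exact hαn j (mem_fix.2 hc)
    have act : ∀ i, ∀ g ∈ U, ∃ ω ∈ fx U, ω ^ p = 1 ∧ g (α i) = ω * α i := by
      intro i g hg
      have e : (g (α i) / α i) ^ p = 1 := by
        rw [div_pow, ← map_pow, mem_fix.1 (hαU i) g hg, div_self (pow_ne_zero _ (hα0 i))]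
      exact ⟨_, hμ _ e, e, by rw [div_mul_cancel₀ _ (hα0 i)]⟩
    obtain ⟨ω, hωU, hω, hgω⟩ := act j g hg
    have hω1 : ω ≠ 1 := by rintro rfl; rw [one_mul] at hgω; exact hgj hgω
    have hωp : IsPrimitiveRoot ω p := by
      have h1 := orderOf_eq_prime (hp := ⟨h.1⟩) hω hω1
      rw [← h1]; exact IsPrimitiveRoot.orderOf ω
    obtain ⟨ω', hω'U, hω', hgω'⟩ := act i g hg
    haveI : NeZero p := ⟨h.1.ne_zero⟩
    obtain ⟨s, -, hs⟩ := hωp.eq_pow_of_pow_eq_one hω'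
    set m := s * (p - 1) with hm
    have hpow : ∀ (i) (t : Ω), t ∈ fx U → g (α i) = t * α i → ∀ r : ℕ, (g ^ r) (α i) = t ^ r * α i := by
      intro i t ht hgt r
      induction r with
      | zero => simp
      | succ r ih =>
        rw [pow_succ', AlgEquiv.mul_apply, ih, map_mul, map_pow, mem_fix.1 ht g hg, hgt]; ring
    have hβ : α i * α j ^ m ∈ fx U := by
      refine mem_fix.2 fun x hx => ?_
      obtain ⟨τ, hτU, hτ, hxτ⟩ := act j x hx
      obtain ⟨r, -, hr⟩ := hωp.eq_pow_of_pow_eq_one hτ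
      have hgr : g ^ r ∈ U := pow_mem hg r
      have h1 : (g ^ r)⁻¹ * x ∈ st U (α j) := by
        refine mem_st.2 ⟨mul_mem (inv_mem hgr) hx, ?_⟩
        rw [AlgEquiv.mul_apply, hxτ, ← hr, ← hpow j ω hωU hgω, ← AlgEquiv.mul_apply]; simp
      rw [← he] at h1
      have h2 : x (α i) = (g ^ r) (α i) := by
        have := congrArg (g ^ r) (mem_st.1 h1).2
        rw [← AlgEquiv.mul_apply] at this
        rw [← this]; congr 1; group
      rw [map_mul, map_pow, h2, hpow i _ hω'U hgω', hxτ, ← hr, ← hs]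
      have e1 : (ω ^ s) ^ r * (ω ^ r) ^ m = 1 := by
        rw [← pow_mul, ← pow_mul, ← pow_add]
        have : s * r + r * m = p * (s * r) := by
          rw [hm]
          obtain ⟨q, hq⟩ : ∃ q, p = q + 1 := ⟨p - 1, by have := h.1.pos; omega⟩
          rw [hq, Nat.add_sub_cancel]; ring
        rw [this, pow_mul, hω, one_pow]
      rw [mul_pow]
      linear_combination (α i * α j ^ m) * e1
    set ki := p * (i : ℕ) + 1 with hki
    set kj := p * (j : ℕ) + 1 with hkj
    have hkij : ki < kj := by
      have : (i : ℕ) < j := hij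
      have := h.1.pos
      rw [hki, hkj]; nlinarith
    have hxj : A.valuation (π ^ kj) < A.valuation (π ^ ki) := by
      rw [map_pow, map_pow]; exact pow_lt_pow_right_of_lt_one₀ hvπ hπ1 hkij
    have hxj1 : A.valuation (π ^ kj) < 1 := by
      rw [map_pow]; exact pow_lt_one₀ zero_le hπ1 (by omega)
    obtain ⟨w, hw, hwe⟩ : ∃ w : Ω, A.valuation w ≤ 1 ∧ (1 + π ^ kj) ^ m = 1 + π ^ kj * w := by
      obtain ⟨w, hw⟩ := sub_dvd_pow_sub_pow (⟨1 + π ^ kj, (A.valuation_le_one_iff _).1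
        (A.valuation.map_add_le (by simp) hxj1.le)⟩ : A) 1 m
      refine ⟨w, (A.valuation_le_one_iff _).2 w.2, ?_⟩
      have := congrArg Subtype.val hw
      push_cast at this
      rw [one_pow, add_sub_cancel_left] at this
      linear_combination this
    refine h.nonpow F hπ0 hπ1 hπv (c := π ^ ki + (1 + π ^ ki) * (π ^ kj * w)) hβ ?_ (hnd i) ?_ (hkp i)
    · rw [mul_pow, ← pow_mul, mul_comm m p, pow_mul, hα, hα, ← hki, ← hkj, hwe]; ring
    · rw [← map_pow]
      refine A.valuation.map_add_eq_of_lt_left ?_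
      rw [map_mul, map_mul]
      refine lt_of_le_of_lt ?_ hxj
      have h1 : A.valuation (1 + π ^ ki) ≤ 1 :=
        A.valuation.map_add_le (by simp) (by rw [map_pow]; exact pow_le_one₀ zero_le hπ1.le)
      exact (mul_le_of_le_one_left' h1).trans (mul_le_of_le_one_right' hw)
  refine ⟨U, hUo, fun i => st U (α i), ?_, fun i => ⟨st_le, (openIn_st hUo.2.1 _).2.1,
    (kum2 h.1 hμ (hαU i) (hαn i)).1, (kum2 h.1 hμ (hαU i) (hαn i)).2⟩⟩
  intro i j hij
  rcases lt_trichotomy i j with h1 | h1 | h1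
  · exact absurd hij (key i j h1)
  · exact h1
  · exact absurd hij.symm (key j i h1)

end NU


namespace NU
open Polynomial
open scoped Pointwise NumberField
set_option linter.unusedSectionVars false
set_option linter.style.haveILetI false
set_option linter.unusedVariables false

section zeta
variable (K : Type*) [Field K] [NumberField K]

/-- number of ideals of given norm -/
noncomputable def idc (n : ℕ) : ℕ := Nat.card {I : Ideal (𝓞 K) // Ideal.absNorm I = n}

instance fin_idc (n : ℕ) : Finite {I : Ideal (𝓞 K) // Ideal.absNorm I = n} :=
  Ideal.finite_setOfPred_absNorm_eq n

theorem idc_one : idc K 1 = 1 := by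
  rw [idc, Nat.card_eq_one_iff_unique]
  refine ⟨⟨fun a b => Subtype.ext ?_⟩, ⟨⟨⊤, Ideal.absNorm_top⟩⟩⟩
  rw [Ideal.absNorm_eq_one_iff.1 a.2, Ideal.absNorm_eq_one_iff.1 b.2]

variable {K}

theorem cop_of_mem {m n : ℕ} (h : m.Coprime n) {I : Ideal (𝓞 K)} (hI : (m : 𝓞 K) ∈ I) :
    (Ideal.absNorm I).Coprime n := by
  have h1 : Ideal.absNorm I ∣ Ideal.absNorm (Ideal.span {(m : 𝓞 K)}) :=
    Ideal.absNorm_dvd_absNorm_of_le ((Ideal.span_singleton_le_iff_mem I).2 hI)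
  rw [Ideal.absNorm_span_natCast] at h1
  exact Nat.Coprime.coprime_dvd_left h1 (h.pow_left _)

theorem ex_comb {m n : ℕ} (h : m.Coprime n) : ∃ a b : 𝓞 K, a * m + b * n = 1 := by
  obtain ⟨a, b, hab⟩ := Nat.isCoprime_iff_coprime.2 h
  exact ⟨a, b, by exact_mod_cast congrArg (Int.cast : ℤ → 𝓞 K) hab⟩

theorem ideal_split {m n : ℕ} (h : m.Coprime n) {I : Ideal (𝓞 K)} (hI : ((m * n : ℕ) : 𝓞 K) ∈ I) :
    (I ⊔ Ideal.span {(m : 𝓞 K)}) * (I ⊔ Ideal.span {(n : 𝓞 K)}) = I := by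
  obtain ⟨a, b, hab⟩ := ex_comb (K := K) h
  apply le_antisymm
  · rw [Ideal.sup_mul, Ideal.mul_sup, Ideal.mul_sup]
    refine sup_le (sup_le Ideal.mul_le_left Ideal.mul_le_left) (sup_le Ideal.mul_le_right ?_)
    rw [Ideal.span_singleton_mul_span_singleton, Ideal.span_singleton_le_iff_mem]
    exact_mod_cast hI
  · intro x hx
    have e : x = (a * m) * x + x * (b * n) := by linear_combination -x * hab
    rw [e]
    refine add_mem (Ideal.mul_mem_mul ?_ ?_) (Ideal.mul_mem_mul ?_ ?_)
    · exact Ideal.mem_sup_right (Ideal.mul_mem_left _ _ (Ideal.mem_span_singleton_self _))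
    · exact Ideal.mem_sup_left hx
    · exact Ideal.mem_sup_left hx
    · exact Ideal.mem_sup_right (Ideal.mul_mem_left _ _ (Ideal.mem_span_singleton_self _))

theorem ideal_join {m n : ℕ} (h : m.Coprime n) {I J : Ideal (𝓞 K)} (hI : (m : 𝓞 K) ∈ I) (hJ : (n : 𝓞 K) ∈ J) :
    I * J ⊔ Ideal.span {(m : 𝓞 K)} = I := by
  obtain ⟨a, b, hab⟩ := ex_comb (K := K) h
  apply le_antisymm
  · exact sup_le Ideal.mul_le_left ((Ideal.span_singleton_le_iff_mem I).2 hI)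
  · intro x hx
    have e : x = x * (b * n) + (a * x) * m := by linear_combination -x * hab
    rw [e]
    exact add_mem (Ideal.mem_sup_left (Ideal.mul_mem_mul hx (Ideal.mul_mem_left _ _ hJ)))
      (Ideal.mem_sup_right (Ideal.mul_mem_left _ _ (Ideal.mem_span_singleton_self _)))

theorem norm_split {m n : ℕ} (h : m.Coprime n) {I : Ideal (𝓞 K)} (hI : Ideal.absNorm I = m * n) :
    Ideal.absNorm (I ⊔ Ideal.span {(m : 𝓞 K)}) = m := by
  have hmem : ((m * n : ℕ) : 𝓞 K) ∈ I := by rw [← hI]; exact Ideal.absNorm_mem I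
  have h1 := congrArg Ideal.absNorm (ideal_split h hmem)
  rw [map_mul, hI] at h1
  set x := Ideal.absNorm (I ⊔ Ideal.span {(m : 𝓞 K)})
  set y := Ideal.absNorm (I ⊔ Ideal.span {(n : 𝓞 K)})
  have hx : x.Coprime n := cop_of_mem h (Ideal.mem_sup_right (Ideal.mem_span_singleton_self _))
  have hy : y.Coprime m := cop_of_mem h.symm (Ideal.mem_sup_right (Ideal.mem_span_singleton_self _))
  apply Nat.dvd_antisymm
  · exact hx.dvd_of_dvd_mul_right (h1 ▸ Dvd.intro _ rfl)
  · exact hy.symm.dvd_of_dvd_mul_right (h1.symm ▸ Dvd.intro _ rfl)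

theorem idc_mul {m n : ℕ} (h : m.Coprime n) : idc K (m * n) = idc K m * idc K n := by
  rw [idc, idc, idc, ← Nat.card_prod]
  refine Nat.card_congr ⟨fun I => (⟨_, norm_split h I.2⟩, ⟨_, norm_split h.symm (by rw [I.2, mul_comm])⟩),
    fun P => ⟨P.1.1 * P.2.1, by rw [map_mul, P.1.2, P.2.2]⟩, fun I => Subtype.ext ?_, fun P => ?_⟩
  · exact ideal_split h (by have := Ideal.absNorm_mem I.1; rwa [I.2] at this)
  · have h1 := Ideal.absNorm_mem P.1.1
    have h2 := Ideal.absNorm_mem P.2.1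
    rw [P.1.2] at h1; rw [P.2.2] at h2
    refine Prod.ext (Subtype.ext ?_) (Subtype.ext ?_)
    · exact ideal_join h h1 h2
    · change P.1.1 * P.2.1 ⊔ _ = _
      rw [mul_comm]; exact ideal_join h.symm h2 h1

theorem idc_pow {p : ℕ} (hp : p.Prime) (k : ℕ) :
    idc K (p ^ k) ≤ (k + 1) ^ Module.finrank ℤ (𝓞 K) := by
  classical
  set d := Module.finrank ℤ (𝓞 K) with hd
  have hp0 : (p : 𝓞 K) ≠ 0 := by exact_mod_cast hp.ne_zero
  have hs0 : Ideal.span {(p : 𝓞 K)} ≠ 0 := by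
    rw [Ideal.zero_eq_bot, Ne, Ideal.span_singleton_eq_bot]; exact hp0
  let T := (UniqueFactorizationMonoid.normalizedFactors (Ideal.span {(p : 𝓞 K)})).toFinset
  have hTp : ∀ P ∈ T, Prime P := fun P hP =>
    UniqueFactorizationMonoid.prime_of_normalized_factor P (Multiset.mem_toFinset.1 hP)
  have hTn : ∀ P ∈ T, p ∣ Ideal.absNorm P := by
    intro P hP
    have h1 : P ∣ Ideal.span {(p : 𝓞 K)} := UniqueFactorizationMonoid.dvd_of_mem_normalizedFactors (Multiset.mem_toFinset.1 hP)
    have h2 : Ideal.absNorm P ∣ p ^ d := by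
      rw [hd, ← Ideal.absNorm_span_natCast]; exact map_dvd _ h1
    obtain ⟨j, -, hj⟩ := (Nat.dvd_prime_pow hp).1 h2
    rcases Nat.eq_zero_or_pos j with rfl | hj0
    · rw [pow_zero, Ideal.absNorm_eq_one_iff] at hj
      exact absurd (Ideal.isUnit_iff.2 hj) (hTp P hP).not_isUnit
    · rw [hj]; exact dvd_pow_self _ hj0.ne'
  have hTc : T.card ≤ d := by
    have h1 : ∏ P ∈ T, P ∣ Ideal.span {(p : 𝓞 K)} := by
      conv_rhs => rw [← Ideal.prod_normalizedFactors_eq_self hs0]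
      rw [Finset.prod_eq_multiset_prod, Multiset.map_id']
      exact Multiset.prod_dvd_prod_of_le
        (Multiset.dedup_le (UniqueFactorizationMonoid.normalizedFactors (Ideal.span {(p : 𝓞 K)})))
    have h2 := map_dvd (Ideal.absNorm (S := 𝓞 K)) h1
    rw [Ideal.absNorm_span_natCast, map_prod] at h2
    have h3 : p ^ T.card ∣ ∏ P ∈ T, Ideal.absNorm P := by
      rw [← Finset.prod_const]; exact Finset.prod_dvd_prod_of_dvd _ _ hTn
    exact (Nat.pow_dvd_pow_iff_le_right hp.one_lt).1 (h3.trans h2)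
  have hne : ∀ I : {I : Ideal (𝓞 K) // Ideal.absNorm I = p ^ k}, I.1 ≠ 0 := by
    intro I h0
    have := I.2
    rw [h0, map_zero] at this
    exact (pow_pos hp.pos k).ne this
  let φ : {I : Ideal (𝓞 K) // Ideal.absNorm I = p ^ k} → (T → Fin (k + 1)) := fun I P =>
    ⟨(UniqueFactorizationMonoid.normalizedFactors I.1).count P.1, by
      set c := (UniqueFactorizationMonoid.normalizedFactors I.1).count P.1 with hc
      have h1 : P.1 ^ c ∣ I.1 := by
        conv_rhs => rw [← Ideal.prod_normalizedFactors_eq_self (hne I)]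
        rw [← Multiset.prod_replicate]
        exact Multiset.prod_dvd_prod_of_le (Multiset.le_count_iff_replicate_le.1 le_rfl)
      have h2 := map_dvd (Ideal.absNorm (S := 𝓞 K)) h1
      rw [map_pow, I.2] at h2
      have := (Nat.pow_dvd_pow_iff_le_right hp.one_lt).1 ((pow_dvd_pow_of_dvd (hTn P.1 P.2) c).trans h2)
      omega⟩
  have hφ : Function.Injective φ := by
    intro I J hIJ
    have sub : ∀ I : {I : Ideal (𝓞 K) // Ideal.absNorm I = p ^ k}, ∀ Q,
        Q ∈ UniqueFactorizationMonoid.normalizedFactors I.1 → Q ∈ T := by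
      intro I Q hQ
      have hQp := UniqueFactorizationMonoid.prime_of_normalized_factor Q hQ
      have h1 := UniqueFactorizationMonoid.dvd_of_mem_normalizedFactors hQ
      have h2 : (p : 𝓞 K) ^ k ∈ Q := by
        have := Ideal.absNorm_mem I.1
        rw [I.2] at this
        exact_mod_cast Ideal.le_of_dvd h1 this
      have h3 : (p : 𝓞 K) ∈ Q := (Ideal.isPrime_of_prime hQp).mem_of_pow_mem _ h2
      rw [Multiset.mem_toFinset, Ideal.mem_normalizedFactors_iff hs0]
      exact ⟨Ideal.isPrime_of_prime hQp, (Ideal.span_singleton_le_iff_mem _).2 h3⟩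
    have : UniqueFactorizationMonoid.normalizedFactors I.1 = UniqueFactorizationMonoid.normalizedFactors J.1 := by
      ext Q
      by_cases hQ : Q ∈ T
      · have := congrArg Fin.val (congrFun hIJ ⟨Q, hQ⟩)
        exact this
      · rw [Multiset.count_eq_zero_of_notMem fun h => hQ (sub I Q h),
          Multiset.count_eq_zero_of_notMem fun h => hQ (sub J Q h)]
    apply Subtype.ext
    rw [← Ideal.prod_normalizedFactors_eq_self (hne I), this, Ideal.prod_normalizedFactors_eq_self (hne J)]
  have := Nat.card_le_card_of_injective φ hφ
  rw [Nat.card_fun, Nat.card_fin, Nat.card_eq_fintype_card (α := T), Fintype.card_coe] at this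
  exact this.trans (Nat.pow_le_pow_right (by omega) hTc)

end zeta
end NU


namespace NU
open Polynomial Filter Topology
open scoped Pointwise NumberField
set_option linter.unusedSectionVars false
set_option linter.style.haveILetI false
set_option linter.unusedVariables false

section zeta
variable (K : Type*) [Field K] [NumberField K]

noncomputable def zt (s : ℝ) (n : ℕ) : ℝ := (idc K n : ℝ) * (n : ℝ) ^ (-s)

theorem zt_nonneg (s : ℝ) (n : ℕ) : 0 ≤ zt K s n := by unfold zt; positivity

theorem zt_zero {s : ℝ} (hs : 0 < s) : zt K s 0 = 0 := by
  rw [zt, Nat.cast_zero, Real.zero_rpow (by linarith), mul_zero]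

theorem zt_one (s : ℝ) : zt K s 1 = 1 := by
  rw [zt, idc_one]; simp

theorem zt_mul (s : ℝ) {m n : ℕ} (h : m.Coprime n) : zt K s (m * n) = zt K s m * zt K s n := by
  rw [zt, zt, zt, idc_mul h, Nat.cast_mul, Nat.cast_mul, Real.mul_rpow (by positivity) (by positivity)]
  ring

theorem zt_lim : Tendsto (fun s : ℝ => (s - 1) * ∑' n, zt K s n) (𝓝[>] 1)
    (𝓝 (NumberField.dedekindZeta_residue K)) := by
  have h := NumberField.tendsto_sub_one_mul_dedekindZeta_nhdsGT K
  have h2 := (Complex.continuous_re.tendsto _).comp h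
  rw [Complex.ofReal_re] at h2
  refine h2.congr' ?_
  filter_upwards [self_mem_nhdsWithin] with s hs
  have hs' : (1 : ℝ) < s := hs
  have e : NumberField.dedekindZeta K s = ((∑' n, zt K s n : ℝ) : ℂ) := by
    rw [Complex.ofReal_tsum]
    unfold NumberField.dedekindZeta LSeries
    congr 1
    ext n
    rcases Nat.eq_zero_or_pos n with rfl | hn
    · rw [zt_zero K (by linarith)]; simp
    · rw [LSeries.term_of_ne_zero hn.ne', zt]
      push_cast
      rw [Complex.ofReal_cpow (by positivity)]
      push_cast
      rw [Complex.cpow_neg, div_eq_mul_inv]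
      rfl
  simp only [Function.comp_apply]
  rw [e, ← Complex.ofReal_one, ← Complex.ofReal_sub, ← Complex.ofReal_mul, Complex.ofReal_re]

theorem zt_summable : ∀ᶠ s : ℝ in 𝓝[>] 1, Summable (zt K s) := by
  have h := (zt_lim K).eventually (lt_mem_nhds (NumberField.dedekindZeta_residue_pos K))
  filter_upwards [h] with s hs
  by_contra hn
  rw [tsum_eq_zero_of_not_summable hn, mul_zero] at hs
  exact lt_irrefl _ hs

noncomputable def ef (s : ℝ) (p : ℕ) : ℝ := ∑' e : ℕ, zt K s (p ^ e)

theorem ef_lim {s : ℝ} (hs : 1 < s) (h : Summable (zt K s)) :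
    Tendsto (fun n : ℕ ↦ ∏ p ∈ Nat.primesBelow n, ef K s p) atTop (𝓝 (∑' n, zt K s n)) :=
  EulerProduct.eulerProduct (f := zt K s) (zt_one K s) (fun h => zt_mul K s h)
    (by simpa only [Real.norm_of_nonneg (zt_nonneg K s _)] using h) (zt_zero K (by linarith))

theorem ef_summable {s : ℝ} {p : ℕ} (hp : p.Prime) (h : Summable (zt K s)) :
    Summable (fun e : ℕ => zt K s (p ^ e)) :=
  h.comp_injective (Nat.pow_right_injective hp.two_le)

theorem ef_split {s : ℝ} {p : ℕ} (hp : p.Prime) (h : Summable (zt K s)) :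
    ef K s p = 1 + zt K s p + ∑' e : ℕ, zt K s (p ^ (e + 2)) := by
  rw [ef, ← (ef_summable K hp h).sum_add_tsum_nat_add 2, Finset.sum_range_succ, Finset.sum_range_one,
    pow_zero, pow_one, zt_one]

theorem ef_ge {s : ℝ} {p : ℕ} (hp : p.Prime) (h : Summable (zt K s)) : 1 + zt K s p ≤ ef K s p := by
  rw [ef_split K hp h]
  have : 0 ≤ ∑' e : ℕ, zt K s (p ^ (e + 2)) := tsum_nonneg fun _ => zt_nonneg K s _
  linarith

theorem zt_pow_le {s : ℝ} (hs : 1 < s) {p : ℕ} (hp : p.Prime) (k : ℕ) :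
    zt K s (p ^ k) ≤ ((k : ℝ) + 1) ^ Module.finrank ℤ (𝓞 K) * ((p : ℝ) ^ k)⁻¹ := by
  unfold zt
  have hp1 : (1 : ℝ) ≤ ((p ^ k : ℕ) : ℝ) := by exact_mod_cast Nat.one_le_pow _ _ hp.pos
  refine mul_le_mul (by exact_mod_cast idc_pow hp k) ?_ (by positivity) (by positivity)
  calc ((p ^ k : ℕ) : ℝ) ^ (-s) ≤ ((p ^ k : ℕ) : ℝ) ^ (-1 : ℝ) :=
        Real.rpow_le_rpow_of_exponent_le hp1 (by linarith)
    _ = _ := by rw [Real.rpow_neg_one]; push_cast; rfl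

noncomputable def cst : ℝ := ∑' e : ℕ, ((e : ℝ) + 3) ^ Module.finrank ℤ (𝓞 K) * (1 / 2) ^ e

theorem cst_summable (d : ℕ) : Summable (fun e : ℕ => ((e : ℝ) + 3) ^ d * (1 / 2 : ℝ) ^ e) := by
  have h := summable_pow_mul_geometric_of_norm_lt_one d (r := (1 / 2 : ℝ)) (by norm_num)
  have h3 := ((summable_nat_add_iff 3).2 h).mul_left 8
  refine h3.congr fun e => ?_
  push_cast
  rw [pow_add]; ring

theorem tail_le {s : ℝ} (hs : 1 < s) {p : ℕ} (hp : p.Prime) (h : Summable (zt K s)) :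
    ∑' e : ℕ, zt K s (p ^ (e + 2)) ≤ cst K * ((p : ℝ) ^ 2)⁻¹ := by
  rw [cst, ← tsum_mul_right]
  refine Summable.tsum_le_tsum (fun e => ?_) ((summable_nat_add_iff 2).2 (ef_summable K hp h))
    ((cst_summable _).mul_right _)
  refine (zt_pow_le K hs hp (e + 2)).trans ?_
  have hp2 : (2 : ℝ) ≤ p := by exact_mod_cast hp.two_le
  have e1 : (((e + 2 : ℕ) : ℝ) + 1) = (e : ℝ) + 3 := by push_cast; ring
  rw [e1, pow_add, mul_inv, mul_assoc]
  refine mul_le_mul_of_nonneg_left ?_ (by positivity)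
  refine mul_le_mul_of_nonneg_right ?_ (by positivity)
  rw [← inv_pow, one_div]
  exact pow_le_pow_left₀ (by positivity) (inv_anti₀ (by norm_num) hp2) e

theorem cst_nonneg : 0 ≤ cst K := tsum_nonneg fun e => by positivity

theorem zeta_contra (F M : Type*) [Field F] [NumberField F] [Field M] [NumberField M] (S : Finset ℕ)
    (h : ∀ p : ℕ, p.Prime → p ∉ S → 2 * idc F p ≤ idc M p) : False := by
  classical
  set d := Module.finrank ℤ (𝓞 F) with hd
  set C := cst F with hC
  have hC0 : 0 ≤ C := cst_nonneg F
  set D : ℝ := 4 ^ d + 2 * C * (1 + 2 ^ d) + C ^ 2 with hD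
  have hD0 : 0 ≤ D := by positivity
  set B : ℝ := (1 + 2 ^ d + C) ^ 2 with hB
  have hB0 : 0 ≤ B := by positivity
  set E : ℝ := D + B * ∑ p ∈ S, (p : ℝ) ^ 2 with hE
  have hSs : 0 ≤ ∑ p ∈ S, (p : ℝ) ^ 2 := Finset.sum_nonneg fun _ _ => by positivity
  have hE0 : 0 ≤ E := by positivity
  have hDE : D ≤ E := by rw [hE]; nlinarith [mul_nonneg hB0 hSs]
  have key : ∀ s : ℝ, 1 < s → Summable (zt F s) → Summable (zt M s) → ∀ p : ℕ, p.Prime →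
      ef F s p ^ 2 ≤ ef M s p * Real.exp (E * ((p : ℝ) ^ 2)⁻¹) := by
    intro s hs hF hM p hp
    have hp2 : (2 : ℝ) ≤ p := by exact_mod_cast hp.two_le
    set q : ℝ := (p : ℝ)⁻¹ with hq
    have hq0 : 0 < q := by positivity
    have hq1 : q ≤ 1 := by rw [hq]; exact inv_le_one_of_one_le₀ (by linarith)
    have eq2 : ((p : ℝ) ^ 2)⁻¹ = q ^ 2 := by rw [hq, inv_pow]
    rw [eq2]
    set x := zt F s p with hx
    have hx0 : 0 ≤ x := zt_nonneg F s p
    have hxq : x ≤ 2 ^ d * q := by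
      have := zt_pow_le F hs hp 1
      rw [pow_one, pow_one] at this
      norm_num at this
      exact this
    have hx1 : x ≤ 2 ^ d := hxq.trans (mul_le_of_le_one_right (by positivity) hq1)
    have hup : ef F s p ≤ 1 + x + C * q ^ 2 := by
      rw [ef_split F hp hF, ← eq2]
      have := tail_le F hs hp hF
      linarith
    have hef0 : 0 ≤ ef F s p := by have := ef_ge F hp hF; linarith
    have hM1 := ef_ge M hp hM
    have hM0 := zt_nonneg M s p
    have hexp : 1 + E * q ^ 2 ≤ Real.exp (E * q ^ 2) := by
      have := Real.add_one_le_exp (E * q ^ 2); linarith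
    refine le_trans ?_ (mul_le_mul_of_nonneg_left hexp (by linarith))
    have hsq : ef F s p ^ 2 ≤ (1 + x + C * q ^ 2) ^ 2 := pow_le_pow_left₀ hef0 hup 2
    refine hsq.trans ?_
    have hq21 : q ^ 2 ≤ 1 := pow_le_one₀ hq0.le hq1
    have hq20 : 0 ≤ q ^ 2 := by positivity
    by_cases hpS : p ∈ S
    · have h1 : (1 + x + C * q ^ 2) ^ 2 ≤ B := by
        refine pow_le_pow_left₀ (by positivity) ?_ 2
        have := mul_le_mul_of_nonneg_left hq21 hC0
        linarith
      have h2 : (p : ℝ) ^ 2 ≤ ∑ p ∈ S, (p : ℝ) ^ 2 :=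
        Finset.single_le_sum (f := fun p : ℕ => (p : ℝ) ^ 2) (fun _ _ => by positivity) hpS
      have h3 : B ≤ E * q ^ 2 := by
        have h4 : B * (p : ℝ) ^ 2 ≤ E := by
          rw [hE]; have := mul_le_mul_of_nonneg_left h2 hB0; linarith
        have h5 := mul_le_mul_of_nonneg_right h4 hq20
        have h6 : B * (p : ℝ) ^ 2 * q ^ 2 = B := by
          rw [hq]; field_simp
        linarith
      have h7 : 1 * (1 + E * q ^ 2) ≤ ef M s p * (1 + E * q ^ 2) :=
        mul_le_mul_of_nonneg_right (by linarith) (by positivity)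
      linarith
    · have h1 : 2 * x ≤ zt M s p := by
        have h2 : (2 : ℝ) * idc F p ≤ idc M p := by exact_mod_cast h p hp hpS
        rw [hx, zt, zt, ← mul_assoc]
        exact mul_le_mul_of_nonneg_right h2 (by positivity)
      have h2 : (1 + x + C * q ^ 2) ^ 2 ≤ 1 + 2 * x + D * q ^ 2 := by
        have e1 : x ^ 2 ≤ 4 ^ d * q ^ 2 := by
          have := pow_le_pow_left₀ hx0 hxq 2
          rwa [mul_pow, ← pow_mul, mul_comm d 2, pow_mul, show (2 : ℝ) ^ 2 = 4 by norm_num] at this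
        have e2 : C * q ^ 2 * x ≤ C * q ^ 2 * 2 ^ d := mul_le_mul_of_nonneg_left hx1 (by positivity)
        have e3 : C ^ 2 * q ^ 2 * q ^ 2 ≤ C ^ 2 * q ^ 2 * 1 := mul_le_mul_of_nonneg_left hq21 (by positivity)
        rw [hD]
        nlinarith
      have h3 : D * q ^ 2 ≤ E * q ^ 2 := mul_le_mul_of_nonneg_right hDE hq20
      have h4 : 1 * (E * q ^ 2) ≤ ef M s p * (E * q ^ 2) := mul_le_mul_of_nonneg_right (by linarith) (by positivity)
      linarith
  have hs2 : Summable (fun n : ℕ => ((n : ℝ) ^ 2)⁻¹) := Real.summable_nat_pow_inv.2 (by norm_num)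
  set W := Real.exp (E * ∑' n : ℕ, ((n : ℝ) ^ 2)⁻¹) with hW
  have key2 : ∀ s : ℝ, 1 < s → Summable (zt F s) → Summable (zt M s) →
      (∑' n, zt F s n) ^ 2 ≤ (∑' n, zt M s n) * W := by
    intro s hs hF hM
    refine le_of_tendsto_of_tendsto' ((ef_lim F hs hF).pow 2) ((ef_lim M hs hM).mul_const W) fun n => ?_
    rw [← Finset.prod_pow]
    calc _ ≤ ∏ p ∈ Nat.primesBelow n, (ef M s p * Real.exp (E * ((p : ℝ) ^ 2)⁻¹)) :=
          Finset.prod_le_prod (fun _ _ => by positivity) fun p hp => key s hs hF hM p (Nat.prime_of_mem_primesBelow hp)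
      _ = (∏ p ∈ Nat.primesBelow n, ef M s p) * Real.exp (∑ p ∈ Nat.primesBelow n, E * ((p : ℝ) ^ 2)⁻¹) := by
          rw [Finset.prod_mul_distrib, Real.exp_sum]
      _ ≤ _ := by
          refine mul_le_mul_of_nonneg_left ?_ (Finset.prod_nonneg fun p hp => ?_)
          · rw [hW, ← Finset.mul_sum]
            refine Real.exp_le_exp.2 (mul_le_mul_of_nonneg_left ?_ hE0)
            exact hs2.sum_le_tsum _ fun _ _ => by positivity
          · have := ef_ge M (Nat.prime_of_mem_primesBelow hp) hM
            have := zt_nonneg M s p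
            linarith
  have hpos := NumberField.dedekindZeta_residue_pos F
  have l1 := (zt_lim F).pow 2
  have l0 : Tendsto (fun s : ℝ => s - 1) (𝓝[>] 1) (𝓝 0) := by
    have : Tendsto (fun s : ℝ => s - 1) (𝓝 1) (𝓝 (1 - 1)) := (continuous_id.sub continuous_const).tendsto _
    rw [sub_self] at this
    exact this.mono_left nhdsWithin_le_nhds
  have l2 := (l0.mul (zt_lim M)).mul_const W
  rw [zero_mul, zero_mul] at l2
  have := le_of_tendsto_of_tendsto l1 l2 (by
    filter_upwards [zt_summable F, zt_summable M, self_mem_nhdsWithin] with s hF hM hs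
    have := mul_le_mul_of_nonneg_left (key2 s hs hF hM) (sq_nonneg (s - 1))
    calc _ = (s - 1) ^ 2 * (∑' n, zt F s n) ^ 2 := by ring
      _ ≤ _ := this
      _ = _ := by ring)
  nlinarith

end zeta
end NU


namespace NU
open Polynomial
open scoped Pointwise NumberField
set_option linter.unusedSectionVars false
set_option linter.style.haveILetI false
set_option linter.unusedVariables false

variable {Ω : Type*} [Field Ω] [CharZero Ω] [Algebra.IsAlgebraic ℚ Ω] [IsAlgClosed Ω]

/-- residue degree one and unramified or not -/
def Deg1 (F : IntermediateField ℚ Ω) (A : ValuationSubring Ω) : Prop :=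
  ∀ x ∈ F, IsIntegral ℤ x → ∃ n : ℤ, A.valuation (x - n) < 1

theorem nf (F : IntermediateField ℚ Ω) [h : FiniteDimensional ℚ F] : NumberField F := by
  haveI : CharZero F := inferInstance
  refine @NumberField.mk F _ _ ?_
  convert h

theorem int_coe {F : IntermediateField ℚ Ω} (x : 𝓞 F) : IsIntegral ℤ ((x : F) : Ω) :=
  (NumberField.RingOfIntegers.isIntegral_coe x).map (IsScalarTower.toAlgHom ℤ F Ω)

theorem int_of {F : IntermediateField ℚ Ω} {x : Ω} (hx : x ∈ F) (h : IsIntegral ℤ x) :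
    ∃ y : 𝓞 F, ((y : F) : Ω) = x := by
  have : IsIntegral ℤ (⟨x, hx⟩ : F) :=
    (isIntegral_algHom_iff (IsScalarTower.toAlgHom ℤ F Ω) (algebraMap F Ω).injective).1 h
  exact ⟨⟨⟨x, hx⟩, this⟩, rfl⟩

/-- the induced ideal -/
def idl (F : IntermediateField ℚ Ω) (A : ValuationSubring Ω) : Ideal (𝓞 F) where
  carrier := {x | A.valuation ((x : F) : Ω) < 1}
  add_mem' := by
    intro a b ha hb
    simp only [Set.mem_ofPred_eq, map_add, IntermediateField.coe_add] at *
    exact A.valuation.map_add_lt ha hb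
  zero_mem' := by simp
  smul_mem' := by
    intro c x hx
    simp only [Set.mem_ofPred_eq, smul_eq_mul, map_mul, IntermediateField.coe_mul] at *
    rw [mul_comm]
    exact mul_lt_of_lt_of_le_one hx (mem_of_int (int_coe c))

theorem mem_idl {F : IntermediateField ℚ Ω} {A : ValuationSubring Ω} {x : 𝓞 F} :
    x ∈ idl F A ↔ A.valuation ((x : F) : Ω) < 1 := Iff.rfl

theorem norm_idl {F : IntermediateField ℚ Ω} [NumberField F] {A : ValuationSubring Ω} {p : ℕ} (h : Over A p)
    (hd : Deg1 F A) : Ideal.absNorm (idl F A) = p := by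
  rw [Ideal.absNorm_apply, Submodule.cardQuot_apply]
  let φ : ℤ →+* 𝓞 F ⧸ idl F A := Int.castRingHom _
  have hφ : Function.Surjective φ := by
    intro y
    obtain ⟨x, rfl⟩ := Ideal.Quotient.mk_surjective y
    obtain ⟨n, hn⟩ := hd _ (x : F).2 (int_coe x)
    refine ⟨n, ?_⟩
    rw [eq_comm, eq_intCast, ← map_intCast (Ideal.Quotient.mk (idl F A)), Ideal.Quotient.eq, mem_idl]
    simpa using hn
  have hk : RingHom.ker φ = Ideal.span {(p : ℤ)} := by
    ext n
    rw [RingHom.mem_ker, Ideal.mem_span_singleton, eq_intCast, ← map_intCast (Ideal.Quotient.mk (idl F A)),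
      Ideal.Quotient.eq_zero_iff_mem, mem_idl]
    have e : (((n : 𝓞 F) : F) : Ω) = n := by simp
    rw [e]
    constructor
    · intro hn
      by_contra hc
      rw [h.coprime hc] at hn
      exact lt_irrefl _ hn
    · rintro ⟨k, rfl⟩
      push_cast
      rw [map_mul]
      exact mul_lt_of_lt_of_le_one h.2 (v_int_le A k)
  rw [← Nat.card_congr (RingHom.quotientKerEquivOfSurjective hφ).toEquiv, hk,
    Nat.card_congr (Int.quotientSpanNatEquivZMod p).toEquiv, Nat.card_zmod]

theorem ex_idl {F : IntermediateField ℚ Ω} [NumberField F] {p : ℕ} (hp : p.Prime) {P : Ideal (𝓞 F)}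
    (hP : Ideal.absNorm P = p) : ∃ A : ValuationSubring Ω, Over A p ∧ Deg1 F A ∧ idl F A = P := by
  haveI := Fact.mk hp
  have hPp : P.IsPrime := Ideal.isPrime_of_irreducible_absNorm (by rw [hP]; exact hp)
  have hP0 : P ≠ ⊥ := by
    rintro rfl
    rw [Ideal.absNorm_bot] at hP
    exact hp.ne_zero hP.symm
  have hPm : P.IsMaximal := hPp.isMaximal hP0
  let φ : 𝓞 F →+* Ω := (algebraMap F Ω).comp (algebraMap (𝓞 F) F)
  have hφ : Function.Injective φ := (algebraMap F Ω).injective.comp NumberField.RingOfIntegers.coe_injective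
  have hb : Function.Bijective φ.rangeRestrict :=
    ⟨fun a b hab => hφ (congrArg (fun z : φ.range => (z : Ω)) hab), φ.rangeRestrict_surjective⟩
  have hne : P.map φ.rangeRestrict ≠ ⊤ := by
    intro h
    have h1 := Ideal.comap_map_of_bijective _ hb (I := P)
    rw [h, Ideal.comap_top] at h1
    exact hPp.ne_top h1.symm
  obtain ⟨A, h1, h2⟩ := Ideal.image_subset_nonunits_valuationSubring (P.map φ.rangeRestrict) hne
  have h3 : P ≤ idl F A := by
    intro x hx
    have : φ x ∈ A.nonunits := h2 ⟨φ.rangeRestrict x, Ideal.mem_map_of_mem _ hx, rfl⟩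
    exact (ValuationSubring.mem_nonunits_iff A).1 this
  have hpP : (p : 𝓞 F) ∈ P := by rw [← hP]; exact Ideal.absNorm_mem P
  have hO : Over A p := ⟨hp, by have := mem_idl.1 (h3 hpP); simpa using this⟩
  have h4 : P = idl F A := by
    refine hPm.eq_of_le ?_ h3
    rw [Ne, Ideal.eq_top_iff_one, mem_idl]
    simp
  refine ⟨A, hO, ?_, h4.symm⟩
  intro x hx hxi
  obtain ⟨y, rfl⟩ := int_of hx hxi
  rw [Ideal.absNorm_apply, Submodule.cardQuot_apply] at hP
  have h5 := zmultiples_eq_top_of_prime_card hP (g := (1 : 𝓞 F ⧸ P)) (by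
    haveI := hPp
    exact one_ne_zero)
  have h6 : Ideal.Quotient.mk P y ∈ AddSubgroup.zmultiples (1 : 𝓞 F ⧸ P) := by rw [h5]; trivial
  obtain ⟨n, hn⟩ := AddSubgroup.mem_zmultiples_iff.1 h6
  refine ⟨n, ?_⟩
  rw [zsmul_one, ← map_intCast (Ideal.Quotient.mk P), eq_comm, Ideal.Quotient.eq, h4, mem_idl] at hn
  simpa using hn

theorem Deg1.up {F M : IntermediateField ℚ Ω} [FiniteDimensional ℚ F] {A : ValuationSubring Ω} {p : ℕ}
    (h : Over A p) (hd : Deg1 F A) (hM : Dec A ⊓ F.fixingSubgroup ≤ M.fixingSubgroup) : Deg1 M A := by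
  intro x hx hxi
  by_cases hx0 : x = 0
  · exact ⟨0, by rw [hx0]; simp⟩
  have hxf : x ∈ fx (Dec A ⊓ F.fixingSubgroup) := mem_fix.2 fun g hg => mem_fixing.1 (hM hg) x hx
  obtain ⟨c, hc, hc0, hcv, hcd⟩ := h.im_val F hxf hx0
  have hxc : A.valuation (x - c) < 1 := by
    have : x - c = (x / c - 1) * c := by field_simp
    rw [this]
    exact mul_lt_one' hcd (hcv ▸ mem_of_int hxi)
  obtain ⟨b, hb, hbi, hb1, hbc⟩ := h.locF hc (hcv ▸ mem_of_int hxi)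
  obtain ⟨m, hm⟩ := hd b hb hbi
  obtain ⟨n, hn⟩ := hd (b * c) (mul_mem hb hc) hbc
  have hm1 : A.valuation (m : Ω) = 1 := eq_one_of_sub_lt hb1 (by rw [← neg_sub, Valuation.map_neg]; exact hm)
  have hpm : ¬ (p : ℤ) ∣ m := by
    rintro ⟨k, rfl⟩
    push_cast at hm1
    have := mul_lt_of_lt_of_le_one h.2 (v_int_le A k)
    rw [← map_mul, hm1] at this
    exact lt_irrefl _ this
  have hcop : IsCoprime m (p : ℤ) :=
    ((Nat.prime_iff_prime_int.1 h.1).coprime_iff_not_dvd.2 hpm).symm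
  obtain ⟨r, s, hrs⟩ := hcop
  refine ⟨r * n, ?_⟩
  have hrs' : (r : Ω) * m + s * p = 1 := by exact_mod_cast congrArg (Int.cast : ℤ → Ω) hrs
  have e : c - ((r * n : ℤ) : Ω) = r * (b * c - n) - (b - m) * (r * c) + (p : Ω) * (s * c) := by
    push_cast
    linear_combination -c * hrs'
  have hc1 : A.valuation c ≤ 1 := hcv ▸ mem_of_int hxi
  have h1 : A.valuation (c - ((r * n : ℤ) : Ω)) < 1 := by
    rw [e]
    refine A.valuation.map_add_lt (A.valuation.map_sub_lt ?_ ?_) ?_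
    · rw [mul_comm]; exact mul_lt_one' hn (v_int_le A r)
    · exact mul_lt_one' hm (by rw [map_mul]; exact mul_le_one' (v_int_le A r) hc1)
    · exact mul_lt_one' h.2 (by rw [map_mul]; exact mul_le_one' (v_int_le A s) hc1)
  have : x - ((r * n : ℤ) : Ω) = (x - c) + (c - ((r * n : ℤ) : Ω)) := by ring
  rw [this]
  exact A.valuation.map_add_lt hxc h1

theorem Deg1.smul {F : IntermediateField ℚ Ω} {A : ValuationSubring Ω} (h : Deg1 F A) {g : Gal(Ω/ℚ)}
    (hg : ∀ x ∈ F, g⁻¹ x ∈ F) : Deg1 F (g • A) := by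
  intro x hx hxi
  obtain ⟨n, hn⟩ := h _ (hg x hx) (hxi.map ((g⁻¹ : Gal(Ω/ℚ)).toAlgHom.restrictScalars ℤ))
  refine ⟨n, ?_⟩
  rw [smul_lt, map_sub, map_intCast]
  exact hn

theorem Deg1.mono {F M : IntermediateField ℚ Ω} {A : ValuationSubring Ω} (h : Deg1 M A) (hFM : F ≤ M) : Deg1 F A :=
  fun x hx => h x (hFM hx)

theorem thmA {F M : IntermediateField ℚ Ω} [FiniteDimensional ℚ F] [FiniteDimensional ℚ M] (hFM : F ≤ M)
    (hne : ¬ M ≤ F) (S : Finset ℕ) :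
    ∃ (A : ValuationSubring Ω) (p : ℕ), Over A p ∧ p ∉ S ∧ Deg1 F A ∧
      ¬ (Dec A ⊓ F.fixingSubgroup ≤ M.fixingSubgroup) := by
  by_contra hcon
  push Not at hcon
  haveI := nf F
  haveI := nf M
  have hg : ∃ g ∈ F.fixingSubgroup, g ∉ M.fixingSubgroup := by
    by_contra hc
    push Not at hc
    exact hne fun x hx => mem_F fun g hg => mem_fixing.1 (hc g hg) x hx
  obtain ⟨g, hgF, hgM⟩ := hg
  have hMF : M.fixingSubgroup ≤ F.fixingSubgroup := fun u hu => mem_fixing.2 fun x hx => mem_fixing.1 hu x (hFM hx)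
  refine zeta_contra F M S fun p hp hpS => ?_
  choose A hA using fun P : {P : Ideal (𝓞 F) // Ideal.absNorm P = p} => ex_idl hp P.2
  let γ : Bool → Gal(Ω/ℚ) := fun b => if b then g⁻¹ else 1
  have hγ : ∀ b, γ b ∈ F.fixingSubgroup := by
    intro b
    cases b
    · exact one_mem _
    · exact inv_mem hgF
  have hB : ∀ P b, Deg1 F (γ b • A P) := fun P b => (hA P).2.1.smul fun x hx => by
    rw [mem_fixing.1 (inv_mem (hγ b)) x hx]; exact hx
  have hBM : ∀ P b, Deg1 M (γ b • A P) := fun P b =>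
    (hB P b).up ((hA P).1.smul _) (hcon _ _ ((hA P).1.smul _) hpS (hB P b))
  let Φ : {P : Ideal (𝓞 F) // Ideal.absNorm P = p} × Bool → {Q : Ideal (𝓞 M) // Ideal.absNorm Q = p} :=
    fun P => ⟨idl M (γ P.2 • A P.1), norm_idl ((hA P.1).1.smul _) (hBM _ _)⟩
  have hlt : ∀ P b x, x ∈ F → ((γ b • A P).valuation x < 1 ↔ (A P).valuation x < 1) := by
    intro P b x hx
    rw [smul_lt, mem_fixing.1 (inv_mem (hγ b)) x hx]
  have hΦ : Function.Injective Φ := by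
    rintro ⟨P, b⟩ ⟨Q, c⟩ hPQ
    have h1 : idl M (γ b • A P) = idl M (γ c • A Q) := congrArg Subtype.val hPQ
    have h2 : ∀ x ∈ M, IsIntegral ℤ x → ((γ b • A P).valuation x < 1 ↔ (γ c • A Q).valuation x < 1) := by
      intro x hx hxi
      obtain ⟨y, rfl⟩ := int_of hx hxi
      rw [← mem_idl, ← mem_idl, h1]
    have h3 : P = Q := by
      apply Subtype.ext
      rw [← (hA P).2.2, ← (hA Q).2.2]
      ext x
      rw [mem_idl, mem_idl, ← hlt P b _ (x : F).2, ← hlt Q c _ (x : F).2]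
      exact h2 _ (hFM (x : F).2) (int_coe x)
    subst h3
    have key : ∀ b c, (∀ x ∈ M, IsIntegral ℤ x → ((γ b • A P).valuation x < 1 ↔ (γ c • A P).valuation x < 1)) →
        b = true → c = false → False := by
      rintro b c hbc rfl rfl
      have e1 : γ true = g⁻¹ := rfl
      have e2 : γ false = 1 := rfl
      rw [e1, e2, one_smul] at hbc
      obtain ⟨u, hu, huA⟩ := trans_int (A := A P) (B := g⁻¹ • A P) (hA P).1.ne_top ((hA P).1.smul _).ne_top
        (closed_fixing M) (fun x hx hxi h => (hbc x (by rwa [fix_fixing] at hx) hxi).2 h)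
      have h4 : g * u ∈ Dec (A P) := by
        rw [MulAction.mem_stabilizer_iff, mul_smul, huA, smul_inv_smul]
      have h5 := hcon _ _ (hA P).1 hpS (hA P).2.1 (Subgroup.mem_inf.2 ⟨h4, mul_mem hgF (hMF hu)⟩)
      exact hgM ((Subgroup.mul_mem_cancel_right _ hu).1 h5)
    cases b <;> cases c
    · rfl
    · exact (key true false (fun x hx hi => (h2 x hx hi).symm) rfl rfl).elim
    · exact (key true false h2 rfl rfl).elim
    · rfl
  have := Nat.card_le_card_of_injective Φ hΦ
  rw [Nat.card_prod, Nat.card_eq_fintype_card (α := Bool), Fintype.card_bool] at this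
  rw [idc, idc, mul_comm]
  exact this

end NU


namespace NU
open Polynomial
open scoped Pointwise NumberField
set_option linter.unusedSectionVars false
set_option linter.style.haveILetI false
set_option linter.unusedVariables false

variable {Ω : Type*} [Field Ω] [CharZero Ω]
variable {H H' : Subgroup Gal(Ω/ℚ)}

/-- transport of subgroups -/
def tr (e : H ≃ₜ* H') (U : Subgroup Gal(Ω/ℚ)) : Subgroup Gal(Ω/ℚ) :=
  (U.subgroupOf H).map (H'.subtype.comp e.toMulEquiv.toMonoidHom)

theorem mem_tr {e : H ≃ₜ* H'} {U : Subgroup Gal(Ω/ℚ)} {g : Gal(Ω/ℚ)} :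
    g ∈ tr e U ↔ ∃ h : H, (h : Gal(Ω/ℚ)) ∈ U ∧ (e h : Gal(Ω/ℚ)) = g := by
  rw [tr, Subgroup.mem_map]
  rfl

theorem tr_le {e : H ≃ₜ* H'} {U : Subgroup Gal(Ω/ℚ)} : tr e U ≤ H' := by
  intro g hg
  obtain ⟨h, -, rfl⟩ := mem_tr.1 hg
  exact (e h).2

theorem tr_mem {e : H ≃ₜ* H'} {U : Subgroup Gal(Ω/ℚ)} {h : H} : (e h : Gal(Ω/ℚ)) ∈ tr e U ↔ (h : Gal(Ω/ℚ)) ∈ U := by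
  rw [mem_tr]
  constructor
  · rintro ⟨k, hk, hkh⟩
    have : k = h := e.injective (Subtype.ext hkh)
    rwa [← this]
  · exact fun hh => ⟨h, hh, rfl⟩

theorem tr_symm {e : H ≃ₜ* H'} {U : Subgroup Gal(Ω/ℚ)} (hU : U ≤ H) : tr e.symm (tr e U) = U := by
  ext g
  rw [mem_tr]
  constructor
  · rintro ⟨h, hh, rfl⟩
    have := tr_mem (e := e) (U := U) (h := e.symm h)
    rw [e.apply_symm_apply] at this
    exact this.1 hh
  · intro hg
    exact ⟨e ⟨g, hU hg⟩, tr_mem.2 hg, by rw [e.symm_apply_apply]⟩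

theorem symm_symm' (e : H ≃ₜ* H') : e.symm.symm = e := rfl

theorem tr_symm' {e : H ≃ₜ* H'} {U : Subgroup Gal(Ω/ℚ)} (hU : U ≤ H') : tr e (tr e.symm U) = U :=
  tr_symm (e := e.symm) hU

theorem tr_mono (e : H ≃ₜ* H') {U V : Subgroup Gal(Ω/ℚ)} (h : U ≤ V) : tr e U ≤ tr e V := by
  intro g hg
  obtain ⟨k, hk, rfl⟩ := mem_tr.1 hg
  exact tr_mem.2 (h hk)

theorem tr_top (e : H ≃ₜ* H') : tr e H = H' := by
  apply le_antisymm tr_le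
  intro g hg
  refine mem_tr.2 ⟨e.symm ⟨g, hg⟩, (e.symm ⟨g, hg⟩).2, by rw [e.apply_symm_apply]⟩

theorem tr_rel (e : H ≃ₜ* H') {U V : Subgroup Gal(Ω/ℚ)} (hV : V ≤ H) : (tr e U).relIndex (tr e V) = U.relIndex V := by
  rw [tr, tr, Subgroup.relIndex_map_map_of_injective _ _ (Subtype.val_injective.comp e.injective),
    Subgroup.relIndex_subgroupOf hV]

theorem tr_closed (e : H ≃ₜ* H') (hH' : IsClosed (H' : Set Gal(Ω/ℚ))) {U : Subgroup Gal(Ω/ℚ)}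
    (hU : IsClosed (U : Set Gal(Ω/ℚ))) : IsClosed (tr e U : Set Gal(Ω/ℚ)) := by
  have e1 : (tr e U : Set Gal(Ω/ℚ)) = Subtype.val '' (e.toHomeomorph '' ((Subtype.val : H → Gal(Ω/ℚ)) ⁻¹' (U : Set Gal(Ω/ℚ)))) := by
    ext g
    rw [SetLike.mem_coe, mem_tr]
    constructor
    · rintro ⟨h, hh, rfl⟩
      exact ⟨_, ⟨h, hh, rfl⟩, rfl⟩
    · rintro ⟨_, ⟨h, hh, rfl⟩, rfl⟩
      exact ⟨h, hh, rfl⟩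
  rw [e1]
  exact hH'.isClosedEmbedding_subtypeVal.isClosedMap _
    (e.toHomeomorph.isClosedMap _ (hU.preimage continuous_subtype_val))

theorem tr_openIn (e : H ≃ₜ* H') (hH' : IsClosed (H' : Set Gal(Ω/ℚ))) {U D : Subgroup Gal(Ω/ℚ)}
    (hD : D ≤ H) (h : OpenIn U D) : OpenIn (tr e U) (tr e D) :=
  ⟨tr_mono e h.1, tr_closed e hH' h.2.1, by rw [tr_rel e hD]; exact h.2.2⟩

theorem tr_conj (e : H ≃ₜ* H') {U W : Subgroup Gal(Ω/ℚ)} (h : ∀ g ∈ U, ∀ w ∈ W, g * w * g⁻¹ ∈ W) :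
    ∀ g ∈ tr e U, ∀ w ∈ tr e W, g * w * g⁻¹ ∈ tr e W := by
  intro g hg w hw
  obtain ⟨g, hg1, rfl⟩ := mem_tr.1 hg
  obtain ⟨w, hw1, rfl⟩ := mem_tr.1 hw
  exact mem_tr.2 ⟨g * w * g⁻¹, h _ hg1 _ hw1, by simp⟩

theorem tr_ci (e : H ≃ₜ* H') (hH : IsClosed (H : Set Gal(Ω/ℚ)))
    {U : Subgroup Gal(Ω/ℚ)} (hU : U ≤ H) (h : Ci U) : Ci (tr e U) := by
  intro W X hWU hXW hW hX hi hj
  have hWH : W ≤ H' := hWU.trans tr_le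
  have hXH : X ≤ H' := hXW.trans hWH
  have h1 := h (tr e.symm W) (tr e.symm X) (by have := tr_mono e.symm hWU; rwa [tr_symm hU] at this)
    (tr_mono _ hXW) (tr_closed _ hH hW) (tr_closed _ hH hX)
    (by have := tr_rel e.symm (U := W) (V := tr e U) tr_le; rw [tr_symm hU] at this; rw [this, hi])
    (by rw [tr_rel e.symm hWH, hj])
  have h2 := tr_conj e h1
  rwa [tr_symm' hXH] at h2

theorem tr_propD (e : H ≃ₜ* H') (hH : IsClosed (H : Set Gal(Ω/ℚ))) (hH' : IsClosed (H' : Set Gal(Ω/ℚ)))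
    {D : Subgroup Gal(Ω/ℚ)} (hD : D ≤ H) (h : PropD D) : PropD (tr e D) := by
  obtain ⟨U0, hU0, hP⟩ := h
  have hU0H : U0 ≤ H := hU0.1.trans hD
  refine ⟨tr e U0, tr_openIn e hH' hD hU0, fun U' hU' => ?_⟩
  have hUH : U' ≤ H' := hU'.1.trans tr_le
  have h1 := tr_openIn e.symm hH tr_le hU'
  rw [tr_symm hU0H] at h1
  obtain ⟨hc, W1, W2, hne, ⟨a1, b1, c1⟩, ⟨a2, b2, c2⟩⟩ := hP _ h1
  have hUH2 : tr e.symm U' ≤ H := tr_le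
  refine ⟨by have := tr_ci e hH hUH2 hc; rwa [tr_symm' hUH] at this, tr e W1, tr e W2, fun hh => hne ?_, ?_, ?_⟩
  · rw [← tr_symm (e := e) (a1.trans hUH2), hh, tr_symm (a2.trans hUH2)]
  · refine ⟨by have := tr_mono e a1; rwa [tr_symm' hUH] at this, tr_closed e hH' b1, ?_⟩
    have := tr_rel e (U := W1) hUH2
    rwa [tr_symm' hUH, c1] at this
  · refine ⟨by have := tr_mono e a2; rwa [tr_symm' hUH] at this, tr_closed e hH' b2, ?_⟩
    have := tr_rel e (U := W2) hUH2
    rwa [tr_symm' hUH, c2] at this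

theorem tr_ql (e : H ≃ₜ* H') (hH : IsClosed (H : Set Gal(Ω/ℚ))) (hH' : IsClosed (H' : Set Gal(Ω/ℚ)))
    {D : Subgroup Gal(Ω/ℚ)} (hD : D ≤ H) {l : ℕ} (h : Ql l D) : Ql l (tr e D) := by
  intro U0' hU0' n
  have hU0H : U0' ≤ H' := hU0'.1.trans tr_le
  have h1 := tr_openIn e.symm hH tr_le hU0'
  rw [tr_symm hD] at h1
  obtain ⟨U, hU, W, hWi, hW⟩ := h _ h1 n
  have hUH : U ≤ H := hU.1.trans tr_le
  refine ⟨tr e U, by have := tr_openIn e hH' tr_le hU; rwa [tr_symm' hU0H] at this, fun i => tr e (W i), ?_, fun i => ?_⟩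
  · intro i j hij
    apply hWi
    have : tr e (W i) = tr e (W j) := hij
    rw [← tr_symm (e := e) ((hW i).1.trans hUH), this, tr_symm ((hW j).1.trans hUH)]
  · obtain ⟨a, b, c, d⟩ := hW i
    exact ⟨tr_mono e a, tr_closed e hH' b, by rw [tr_rel e hUH, c], tr_conj e d⟩

variable [Algebra.IsAlgebraic ℚ Ω] [IsAlgClosed Ω]

theorem loc_corr (e : H ≃ₜ* H') (hH : IsOpen (H : Set Gal(Ω/ℚ))) (hH' : IsOpen (H' : Set Gal(Ω/ℚ)))
    {A : ValuationSubring Ω} {p : ℕ} (h : Over A p) (hp : p ≠ 2) :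
    ∃ B, Over B p ∧ tr e (Dec A ⊓ H) = Dec B ⊓ H' := by
  have hHc := H.isClosed_of_isOpen hH
  have hHc' := H'.isClosed_of_isOpen hH'
  have hDc : IsClosed ((Dec A ⊓ H : Subgroup Gal(Ω/ℚ)) : Set Gal(Ω/ℚ)) := Dec_closed.inter hHc
  have hP := h.propD hp hH
  obtain ⟨B, q, hB, hq, hDB⟩ := (tr_propD e hHc hHc' inf_le_right hP).dec (tr_closed e hHc' hDc)
  have hDB' : tr e (Dec A ⊓ H) ≤ Dec B ⊓ H' := le_inf hDB tr_le
  have hPB := hB.propD hq hH'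
  have hDc' : IsClosed ((Dec B ⊓ H' : Subgroup Gal(Ω/ℚ)) : Set Gal(Ω/ℚ)) := Dec_closed.inter hHc'
  obtain ⟨C, r, hC, hr, hDC⟩ := (tr_propD e.symm hHc' hHc inf_le_right hPB).dec (tr_closed e.symm hHc hDc')
  have h1 : Dec A ⊓ H ≤ tr e.symm (Dec B ⊓ H') := by
    have := tr_mono e.symm hDB'
    rwa [tr_symm inf_le_right] at this
  have hAC : A = C := hP.unique hDc h hC hp hr inf_le_left (h1.trans hDC)
  subst hAC
  have heq : tr e (Dec A ⊓ H) = Dec B ⊓ H' := by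
    apply le_antisymm hDB'
    have := tr_mono e (le_inf hDC tr_le)
    rwa [tr_symm' inf_le_right] at this
  have hpq : p = q := by
    by_contra hne
    have := tr_ql e hHc hHc' inf_le_right (h.ql hH)
    rw [heq] at this
    exact hB.not_ql h.1 hne hH' this
  subst hpq
  exact ⟨B, hB, heq⟩

theorem corr_unique (hH : IsOpen (H : Set Gal(Ω/ℚ))) {A B : ValuationSubring Ω} {p q : ℕ} (h : Over A p) (hB : Over B q)
    (hp : p ≠ 2) (hq : q ≠ 2) (hAB : Dec A ⊓ H ≤ Dec B) : A = B :=
  (h.propD hp hH).unique (Dec_closed.inter (H.isClosed_of_isOpen hH)) h hB hp hq inf_le_left hAB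

end NU


namespace NU
open Polynomial
open scoped Pointwise NumberField
set_option linter.unusedSectionVars false
set_option linter.style.haveILetI false
set_option linter.unusedVariables false

variable {Ω : Type*} [Field Ω] [CharZero Ω] [Algebra.IsAlgebraic ℚ Ω] [IsAlgClosed Ω]

variable (Ω) in
theorem ex_over {p : ℕ} (hp : p.Prime) : ∃ A : ValuationSubring Ω, Over A p := by
  let φ : ℤ →+* Ω := Int.castRingHom Ω
  have hφ : Function.Injective φ := Int.cast_injective
  have hb : Function.Bijective φ.rangeRestrict :=
    ⟨fun a b hab => hφ (congrArg (fun z : φ.range => (z : Ω)) hab), φ.rangeRestrict_surjective⟩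
  let P : Ideal ℤ := Ideal.span {(p : ℤ)}
  have hP : P ≠ ⊤ := by
    rw [Ne, Ideal.span_singleton_eq_top]
    exact (Nat.prime_iff_prime_int.1 hp).not_isUnit
  have hne : P.map φ.rangeRestrict ≠ ⊤ := by
    intro h
    have h1 := Ideal.comap_map_of_bijective _ hb (I := P)
    rw [h, Ideal.comap_top] at h1
    exact hP h1.symm
  obtain ⟨A, h1, h2⟩ := Ideal.image_subset_nonunits_valuationSubring (P.map φ.rangeRestrict) hne
  have : φ (p : ℤ) ∈ A.nonunits :=
    h2 ⟨φ.rangeRestrict p, Ideal.mem_map_of_mem _ (Ideal.mem_span_singleton_self _), rfl⟩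
  exact ⟨A, hp, by simpa [φ] using (ValuationSubring.mem_nonunits_iff A).1 this⟩

theorem ex_proper (E : IntermediateField ℚ Ω) [FiniteDimensional ℚ E] :
    ∃ M : IntermediateField ℚ Ω, FiniteDimensional ℚ M ∧ E ≤ M ∧ ¬ M ≤ E := by
  obtain ⟨A, hA⟩ := ex_over Ω Nat.prime_three
  obtain ⟨π, hπ, hπ0, hπ1, hk⟩ := hA.unif E
  obtain ⟨s, hs⟩ := ex_root π (n := 2) (by norm_num)
  have hs0 : s ≠ 0 := by rintro rfl; exact hπ0 (by rw [← hs]; simp)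
  haveI : FiniteDimensional ℚ (IntermediateField.adjoin ℚ ({s} : Set Ω)) := fd_adjoin (Set.finite_singleton s)
  refine ⟨E ⊔ IntermediateField.adjoin ℚ {s}, inferInstance, le_sup_left, fun h => ?_⟩
  have hsE : s ∈ E := h ((le_sup_right : _ ≤ E ⊔ _) (IntermediateField.mem_adjoin_simple_self ℚ s))
  obtain ⟨k, hk⟩ := hk s hsE hs0
  have h1 : A.valuation π ^ (1 : ℤ) = A.valuation π ^ (k * 2) := by
    rw [zpow_mul, ← hk, zpow_one, ← hs, map_pow]
    rfl
  have := zpow_right_injective₀ (v_pos hπ0) hπ1.ne h1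
  omega

theorem bad_aux (y : Ω) : ∃ d : ℤ, d ≠ 0 ∧ IsIntegral ℤ (d * y) := by
  have h : IsAlgebraic ℚ y := Algebra.IsAlgebraic.isAlgebraic y
  have h2 : IsAlgebraic ℤ y := (IsFractionRing.isAlgebraic_iff ℤ ℚ Ω).2 h
  obtain ⟨d, hd, hi⟩ := h2.exists_integral_multiple
  exact ⟨d, hd, by rwa [zsmul_eq_mul] at hi⟩

theorem Over.one_of_not_dvd {A : ValuationSubring Ω} {p : ℕ} (h : Over A p) {d : ℤ} (hd : d ≠ 0)
    (hp : p ∉ d.natAbs.primeFactors) : A.valuation (d : Ω) = 1 := by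
  apply h.coprime
  intro hc
  apply hp
  rw [Nat.mem_primeFactors]
  exact ⟨h.1, Int.natCast_dvd.1 hc, by simpa using hd⟩

theorem fin_bad {y : Ω} (hy : y ≠ 0) :
    ∃ S : Finset ℕ, ∀ (A : ValuationSubring Ω) (p : ℕ), Over A p → p ∉ S → A.valuation y = 1 := by
  obtain ⟨d, hd, hdi⟩ := bad_aux y
  obtain ⟨d', hd', hdi'⟩ := bad_aux y⁻¹
  refine ⟨d.natAbs.primeFactors ∪ d'.natAbs.primeFactors, fun A p h hp => ?_⟩
  rw [Finset.mem_union, not_or] at hp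
  have h1 := mem_of_int (A := A) hdi
  have h2 := mem_of_int (A := A) hdi'
  rw [map_mul, h.one_of_not_dvd hd hp.1, one_mul] at h1
  rw [map_mul, h.one_of_not_dvd hd' hp.2, one_mul, map_inv₀] at h2
  exact le_antisymm h1 ((inv_le_one₀ (v_pos hy)).1 h2)

theorem unram (M : IntermediateField ℚ Ω) [FiniteDimensional ℚ M] :
    ∃ S : Finset ℕ, ∀ (A : ValuationSubring Ω) (p : ℕ), Over A p → p ∉ S → ∀ g : Gal(Ω/ℚ),
      (∀ x ∈ M, IsIntegral ℤ x → A.valuation (g x - x) < 1) → g ∈ M.fixingSubgroup := by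
  classical
  obtain ⟨θ, hθ⟩ := @Field.exists_primitive_element ℚ M _ _ M.algebra' _ _
  obtain ⟨d, hd, hdi⟩ := bad_aux (θ : Ω)
  let t : Ω := d * θ
  have htM : t ∈ M := mul_mem (intCast_mem M d) θ.2
  let R : Finset Ω := ((minpoly ℚ t).map (algebraMap ℚ Ω)).roots.toFinset
  have hR : ∀ g : Gal(Ω/ℚ), g t ∈ R := by
    intro g
    have ht : IsIntegral ℚ t := (Algebra.IsAlgebraic.isAlgebraic t).isIntegral
    rw [Multiset.mem_toFinset, mem_roots ((Polynomial.map_ne_zero_iff (algebraMap ℚ Ω).injective).2 (minpoly.ne_zero ht)), IsRoot,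
      eval_map_algebraMap]
    have : aeval (g t) (minpoly ℚ t) = g (aeval t (minpoly ℚ t)) := (aeval_algHom_apply g.toAlgHom t _)
    rw [this, minpoly.aeval, map_zero]
  have hbad : ∀ z : Ω, ∃ S : Finset ℕ, z ≠ t → ∀ (A : ValuationSubring Ω) (p : ℕ), Over A p → p ∉ S →
      A.valuation (z - t) = 1 := by
    intro z
    by_cases hz : z = t
    · exact ⟨∅, fun h => (h hz).elim⟩
    · obtain ⟨S, hS⟩ := fin_bad (sub_ne_zero.2 hz)
      exact ⟨S, fun _ => hS⟩
  choose S hS using hbad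
  refine ⟨R.biUnion S, fun A p h hp g hg => ?_⟩
  have hgt : g t = t := by
    by_contra hc
    have h1 := hS (g t) hc A p h (fun hp' => hp (Finset.mem_biUnion.2 ⟨_, hR g, hp'⟩))
    have h2 := hg t htM hdi
    rw [h1] at h2
    exact lt_irrefl _ h2
  have hd' : (d : Ω) ≠ 0 := Int.cast_ne_zero.2 hd
  have hgθ : g θ = θ := by
    have : g t = d * g θ := by rw [map_mul, map_intCast]
    rw [this] at hgt
    exact mul_left_cancel₀ hd' hgt
  have hM : M ≤ IntermediateField.adjoin ℚ {(θ : Ω)} := by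
    intro x hx
    have h1 : (⟨x, hx⟩ : M) ∈ @IntermediateField.adjoin ℚ _ M _ M.algebra' {θ} := by rw [hθ]; trivial
    have h2 := @IntermediateField.adjoin_map ℚ _ M _ M.algebra' {θ} Ω _ _ M.val
    rw [Set.image_singleton] at h2
    have h3 : M.val ⟨x, hx⟩ ∈ (@IntermediateField.adjoin ℚ _ M _ M.algebra' {θ}).map M.val := ⟨_, h1, rfl⟩
    rw [h2] at h3
    exact h3
  have h4 : IntermediateField.adjoin ℚ {(θ : Ω)} ≤ fx (Subgroup.zpowers g) := by
    rw [IntermediateField.adjoin_simple_le_iff]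
    refine mem_fix.2 fun u hu => ?_
    have : Subgroup.zpowers g ≤ MulAction.stabilizer Gal(Ω/ℚ) (θ : Ω) := by
      rw [Subgroup.zpowers_le]; exact hgθ
    exact this hu
  exact mem_fixing.2 fun x hx => mem_fix.1 (h4 (hM hx)) g (Subgroup.mem_zpowers g)

theorem ex_split (R : IntermediateField ℚ Ω) [FiniteDimensional ℚ R] (S : Finset ℕ) :
    ∃ (A : ValuationSubring Ω) (p : ℕ), Over A p ∧ p ∉ S ∧ Deg1 R A ∧ Dec A ≤ R.fixingSubgroup := by
  classical
  obtain ⟨M, hM, h1, h2⟩ := ex_proper R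
  obtain ⟨T, hT⟩ := unram R
  obtain ⟨A, p, hA, hp, hd, -⟩ := thmA h1 h2 (S ∪ T)
  rw [Finset.mem_union, not_or] at hp
  refine ⟨A, p, hA, hp.1, hd, fun g hg => hT A p hA hp.2 g fun x hx hxi => ?_⟩
  obtain ⟨n, hn⟩ := hd x hx hxi
  have h3 : A.valuation (g (x - n)) < 1 := (Dec.lt hg).2 hn
  rw [map_sub, map_intCast] at h3
  have : g x - x = (g x - n) - (x - n) := by ring
  rw [this]
  exact A.valuation.map_sub_lt h3 hn

theorem Deg1.dec_le {R : IntermediateField ℚ Ω} {A : ValuationSubring Ω} {p : ℕ} {T : Finset ℕ}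
    (hT : ∀ (A : ValuationSubring Ω) (p : ℕ), Over A p → p ∉ T → ∀ g : Gal(Ω/ℚ),
      (∀ x ∈ R, IsIntegral ℤ x → A.valuation (g x - x) < 1) → g ∈ R.fixingSubgroup)
    (hA : Over A p) (hp : p ∉ T) (hd : Deg1 R A) : Dec A ≤ R.fixingSubgroup := by
  refine fun g hg => hT A p hA hp g fun x hx hxi => ?_
  obtain ⟨n, hn⟩ := hd x hx hxi
  have h3 : A.valuation (g (x - n)) < 1 := (Dec.lt hg).2 hn
  rw [map_sub, map_intCast] at h3
  have : g x - x = (g x - n) - (x - n) := by ring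
  rw [this]
  exact A.valuation.map_sub_lt h3 hn

end NU


namespace NU
open Polynomial
open scoped Pointwise NumberField
set_option linter.unusedSectionVars false
set_option linter.style.haveILetI false
set_option linter.unusedVariables false

theorem ff_inv {k : Type*} [Field k] [Finite k] (f g : k →+* k) (hf : ∀ x, f (f x) = x) (hg : ∀ x, g (g x) = x)
    (hf1 : ∃ x, f x ≠ x) (hg1 : ∃ x, g x ≠ x) : f = g := by
  classical
  haveI : Fintype k := Fintype.ofFinite k
  obtain ⟨p, hp⟩ := CharP.exists k
  haveI : Fact p.Prime := ⟨CharP.char_is_prime k p⟩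
  letI : Algebra (ZMod p) k := ZMod.algebra k p
  let mk : ∀ h : k →+* k, (∀ x, h (h x) = x) → (k ≃ₐ[ZMod p] k) := fun h hh =>
    AlgEquiv.ofRingEquiv (f := RingEquiv.ofRingHom h h (RingHom.ext hh) (RingHom.ext hh))
      (fun x => by
        have : (h.comp (algebraMap (ZMod p) k)) = algebraMap (ZMod p) k := Subsingleton.elim _ _
        exact congrArg (fun u : ZMod p →+* k => u x) this)
  have hmk : ∀ h hh x, mk h hh x = h x := fun h hh x => rfl
  haveI : Finite (k ≃ₐ[ZMod p] k) := inferInstance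
  haveI : Fintype (k ≃ₐ[ZMod p] k) := Fintype.ofFinite _
  have hc := IsCyclic.card_pow_eq_one_le (α := k ≃ₐ[ZMod p] k) (n := 2) (by norm_num)
  by_contra hne
  have hsub : ({1, mk f hf, mk g hg} : Finset (k ≃ₐ[ZMod p] k)) ⊆ Finset.univ.filter fun a => a ^ 2 = 1 := by
    intro a ha
    simp only [Finset.mem_insert, Finset.mem_singleton] at ha
    rw [Finset.mem_filter]
    refine ⟨Finset.mem_univ _, ?_⟩
    rcases ha with rfl | rfl | rfl
    · simp
    · ext x; rw [sq, AlgEquiv.mul_apply, hmk f hf, hmk f hf, hf]; rfl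
    · ext x; rw [sq, AlgEquiv.mul_apply, hmk g hg, hmk g hg, hg]; rfl
  have h1 : (1 : k ≃ₐ[ZMod p] k) ≠ mk f hf := by
    obtain ⟨x, hx⟩ := hf1
    intro h
    apply hx
    rw [← hmk f hf, ← h]; rfl
  have h2 : (1 : k ≃ₐ[ZMod p] k) ≠ mk g hg := by
    obtain ⟨x, hx⟩ := hg1
    intro h
    apply hx
    rw [← hmk g hg, ← h]; rfl
  have h3 : mk f hf ≠ mk g hg := by
    intro h
    apply hne
    ext x
    rw [← hmk f hf, ← hmk g hg, h]
  have h4 := Finset.card_le_card hsub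
  rw [Finset.card_eq_three.2 ⟨_, _, _, h1, h2, h3, rfl⟩] at h4
  omega

variable {Ω : Type*} [Field Ω] [CharZero Ω] [Algebra.IsAlgebraic ℚ Ω] [IsAlgClosed Ω]

theorem normal_mem {M : IntermediateField ℚ Ω} (hN : M.fixingSubgroup.Normal) (g : Gal(Ω/ℚ)) {x : Ω} (hx : x ∈ M) :
    g x ∈ M := by
  refine mem_F fun u hu => ?_
  have h1 : g⁻¹ * u * g ∈ M.fixingSubgroup := by
    have := hN.conj_mem u hu g⁻¹
    rwa [inv_inv] at this
  have h2 := mem_fixing.1 h1 x hx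
  calc u (g x) = g ((g⁻¹ * u * g) x) := by
        rw [← AlgEquiv.mul_apply, ← AlgEquiv.mul_apply]; congr 1; group
    _ = g x := by rw [h2]

theorem int_smul (g : Gal(Ω/ℚ)) {x : Ω} (hx : IsIntegral ℤ x) : IsIntegral ℤ (g x) :=
  hx.map ((g : Gal(Ω/ℚ)).toAlgHom.restrictScalars ℤ)

theorem ex_red {M : IntermediateField ℚ Ω} (hN : M.fixingSubgroup.Normal) {A : ValuationSubring Ω} {σ : Gal(Ω/ℚ)}
    (hσ : σ ∈ Dec A) : ∃ f : 𝓞 M ⧸ idl M A →+* 𝓞 M ⧸ idl M A, ∀ x : 𝓞 M, ∃ y : 𝓞 M, ((y : M) : Ω) = σ (x : M) ∧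
      f (Ideal.Quotient.mk _ x) = Ideal.Quotient.mk _ y := by
  let f0 : M →+* M := ((σ : Ω →+* Ω).comp (algebraMap M Ω)).codRestrict M.toSubfield fun x => normal_mem hN σ x.2
  let φ : 𝓞 M →+* 𝓞 M := NumberField.RingOfIntegers.mapRingHom f0
  have hφ : ∀ x : 𝓞 M, ((φ x : M) : Ω) = σ (x : M) := fun x => rfl
  refine ⟨Ideal.quotientMap (idl M A) φ ?_, fun x => ⟨φ x, hφ x, ?_⟩⟩
  · intro x hx
    rw [Ideal.mem_comap, mem_idl, hφ]
    exact (Dec.lt hσ).2 (mem_idl.1 hx)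
  · rw [Ideal.quotientMap_mk]

theorem idl_max {M : IntermediateField ℚ Ω} [FiniteDimensional ℚ M] {A : ValuationSubring Ω} {p : ℕ} (h : Over A p) :
    (idl M A).IsMaximal ∧ Finite (𝓞 M ⧸ idl M A) := by
  haveI := nf M
  have h0 : idl M A ≠ ⊥ := by
    intro hb
    have h1 : (p : 𝓞 M) ∈ idl M A := by rw [mem_idl]; simpa using h.2
    rw [hb, Ideal.mem_bot] at h1
    exact h.1.ne_zero (by exact_mod_cast h1)
  have hp : (idl M A).IsPrime := by
    refine ⟨?_, ?_⟩
    · rw [Ne, Ideal.eq_top_iff_one, mem_idl]; simp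
    · intro x y hxy
      by_contra hc
      push Not at hc
      simp only [mem_idl, not_lt] at hc hxy
      have h1 := le_antisymm (mem_of_int (A := A) (int_coe x)) hc.1
      have h2 := le_antisymm (mem_of_int (A := A) (int_coe y)) hc.2
      simp [h1, h2] at hxy
  exact ⟨hp.isMaximal h0, Ideal.finiteQuotientOfFreeOfNeBot _ h0⟩

theorem inv_unique (M : IntermediateField ℚ Ω) [FiniteDimensional ℚ M] (hN : M.fixingSubgroup.Normal) :
    ∃ S : Finset ℕ, ∀ (A : ValuationSubring Ω) (p : ℕ), Over A p → p ∉ S → ∀ σ ∈ Dec A, ∀ τ ∈ Dec A,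
      σ ∉ M.fixingSubgroup → τ ∉ M.fixingSubgroup → σ * σ ∈ M.fixingSubgroup → τ * τ ∈ M.fixingSubgroup →
      τ⁻¹ * σ ∈ M.fixingSubgroup := by
  obtain ⟨S, hS⟩ := unram M
  refine ⟨S, fun A p h hp σ hσ τ hτ hσ1 hτ1 hσ2 hτ2 => ?_⟩
  obtain ⟨hmax, hfin⟩ := idl_max (M := M) h
  letI : Field (𝓞 M ⧸ idl M A) := Ideal.Quotient.field _
  have sq : ∀ {σ : Gal(Ω/ℚ)}, σ * σ ∈ M.fixingSubgroup → ∀ {x y z : 𝓞 M}, ((y : M) : Ω) = σ (x : M) →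
      ((z : M) : Ω) = σ (y : M) → z = x := by
    intro σ hσ x y z h1 h2
    have h3 : ((z : M) : Ω) = (x : M) := by
      rw [h2, h1, ← AlgEquiv.mul_apply]
      exact mem_fixing.1 hσ _ (x : M).2
    exact NumberField.RingOfIntegers.coe_injective (Subtype.ext h3)
  have inv : ∀ {σ : Gal(Ω/ℚ)}, σ * σ ∈ M.fixingSubgroup → ∀ f : 𝓞 M ⧸ idl M A →+* 𝓞 M ⧸ idl M A,
      (∀ x : 𝓞 M, ∃ y : 𝓞 M, ((y : M) : Ω) = σ (x : M) ∧
        f (Ideal.Quotient.mk _ x) = Ideal.Quotient.mk _ y) → ∀ x, f (f x) = x := by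
    intro σ hσ f hf x
    obtain ⟨x, rfl⟩ := Ideal.Quotient.mk_surjective x
    obtain ⟨y, hy, hxy⟩ := hf x
    obtain ⟨z, hz, hyz⟩ := hf y
    rw [hxy, hyz, sq hσ hy hz]
  have nid : ∀ {σ : Gal(Ω/ℚ)}, σ ∉ M.fixingSubgroup → ∀ f : 𝓞 M ⧸ idl M A →+* 𝓞 M ⧸ idl M A,
      (∀ x : 𝓞 M, ∃ y : 𝓞 M, ((y : M) : Ω) = σ (x : M) ∧
        f (Ideal.Quotient.mk _ x) = Ideal.Quotient.mk _ y) → ∃ x, f x ≠ x := by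
    intro σ hσ f hf
    by_contra hc
    push Not at hc
    refine hσ (hS A p h hp σ fun x hx hxi => ?_)
    obtain ⟨x, rfl⟩ := int_of hx hxi
    obtain ⟨y, hy, hxy⟩ := hf x
    rw [hc, eq_comm, Ideal.Quotient.eq, mem_idl] at hxy
    rw [← hy]
    simpa using hxy
  obtain ⟨f, hf⟩ := ex_red hN hσ
  obtain ⟨g, hg⟩ := ex_red hN hτ
  have hfg : f = g := ff_inv f g (inv hσ2 f hf) (inv hτ2 g hg) (nid hσ1 f hf) (nid hτ1 g hg)
  refine hS A p h hp _ fun x hx hxi => ?_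
  obtain ⟨x, rfl⟩ := int_of hx hxi
  obtain ⟨y, hy, hxy⟩ := hf x
  obtain ⟨z, hz, hxz⟩ := hg x
  rw [hfg, hxz, eq_comm, Ideal.Quotient.eq, mem_idl] at hxy
  have h1 : A.valuation (σ (x : M) - τ (x : M)) < 1 := by
    rw [← hy, ← hz]
    simpa using hxy
  have h2 := (Dec.lt (inv_mem hτ)).2 h1
  rw [map_sub, ← AlgEquiv.mul_apply, ← AlgEquiv.mul_apply, inv_mul_cancel] at h2
  exact h2

end NU


namespace NU
open Polynomial
open scoped Pointwise NumberField
set_option linter.unusedSectionVars false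
set_option linter.style.haveILetI false
set_option linter.unusedVariables false

variable {Ω : Type*} [Field Ω] [CharZero Ω] [Algebra.IsAlgebraic ℚ Ω] [IsAlgClosed Ω]

theorem conj_over {A B : ValuationSubring Ω} {p : ℕ} (hA : Over A p) (hB : Over B p) : ∃ g : Gal(Ω/ℚ), g • A = B := by
  obtain ⟨g, -, hg⟩ := trans_int hA.ne_top hB.ne_top (U := ⊤) isClosed_univ (by
    intro x hx hxi hlt
    have h1 : x ∈ (⊥ : IntermediateField ℚ Ω) := by
      rw [← fix_fixing ⊥, IntermediateField.fixingSubgroup_bot]; exact hx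
    obtain ⟨q, rfl⟩ := IntermediateField.mem_bot.1 h1
    have h2 : IsIntegral ℤ q := (isIntegral_algHom_iff (IsScalarTower.toAlgHom ℤ ℚ Ω) (algebraMap ℚ Ω).injective).1 hxi
    obtain ⟨n, rfl⟩ := IsIntegrallyClosed.isIntegral_iff.1 h2
    have e : algebraMap ℚ Ω (algebraMap ℤ ℚ n) = (n : Ω) := by simp
    rw [e] at hlt ⊢
    by_cases hn : (p : ℤ) ∣ n
    · obtain ⟨k, rfl⟩ := hn
      push_cast
      exact mul_lt_one' hB.2 (v_int_le B k)
    · rw [hA.coprime hn] at hlt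
      exact (lt_irrefl _ hlt).elim)
  exact ⟨g, hg⟩

theorem fd_of_index {V : Subgroup Gal(Ω/ℚ)} (h : V.index ≠ 0) : FiniteDimensional ℚ (fx V) := by
  have h1 : V ≤ (fx V).fixingSubgroup := fun g hg => mem_fixing.2 fun x hx => mem_fix.1 hx g hg
  have h2 : (fx V).fixingSubgroup.index ≠ 0 := fun h0 => h (by
    have := Subgroup.index_dvd_of_le h1
    rw [h0] at this
    exact Nat.eq_zero_of_zero_dvd this)
  haveI : (fx V).fixingSubgroup.FiniteIndex := ⟨h2⟩
  have h3 := Subgroup.isOpen_of_isClosed_of_finiteIndex _ (closed_fixing (fx V))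
  exact (InfiniteGalois.isOpen_iff_finite (fx V)).1 h3

variable {H H' : Subgroup Gal(Ω/ℚ)}

theorem tr_normal_le (e : H ≃ₜ* H') (hH : IsOpen (H : Set Gal(Ω/ℚ))) (hH' : IsOpen (H' : Set Gal(Ω/ℚ)))
    {M : IntermediateField ℚ Ω} [FiniteDimensional ℚ M] (hN : M.fixingSubgroup.Normal)
    (hM : M.fixingSubgroup ≤ H) (hM' : M.fixingSubgroup ≤ H') : M.fixingSubgroup ≤ tr e M.fixingSubgroup := by
  have hHc := H.isClosed_of_isOpen hH
  have hHc' := H'.isClosed_of_isOpen hH'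
  have hVc := tr_closed e hHc' (closed_fixing M)
  have hVi : (tr e M.fixingSubgroup).index ≠ 0 := by
    have h1 := Subgroup.relIndex_mul_index (tr_le : tr e M.fixingSubgroup ≤ H')
    rw [← h1]
    refine mul_ne_zero ?_ (fi_of_open hH')
    have h2 := tr_rel e (U := M.fixingSubgroup) (le_refl H)
    rw [tr_top] at h2
    rw [h2]
    exact rel_of_open (open_fixing M) H
  haveI := fd_of_index hVi
  set N' := fx (tr e M.fixingSubgroup) with hN'
  have hfix : N'.fixingSubgroup = tr e M.fixingSubgroup := fixing_fix hVc
  by_contra hcon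
  have hne : ¬ M ⊔ N' ≤ M := by
    intro h
    apply hcon
    intro g hg
    rw [← hfix]
    exact mem_fixing.2 fun x hx => mem_fixing.1 hg x (h ((le_sup_right : N' ≤ M ⊔ N') hx))
  obtain ⟨T, hT⟩ := unram M
  classical
  obtain ⟨B, p, hB, hp, hd, hnot⟩ := thmA (le_sup_left : M ≤ M ⊔ N') hne (T ∪ {2})
  rw [Finset.mem_union, not_or, Finset.mem_singleton] at hp
  apply hnot
  have hBM : Dec B ≤ M.fixingSubgroup := hd.dec_le hT hB hp.1
  obtain ⟨A, hA, hAB⟩ := loc_corr e.symm hH' hH hB hp.2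
  obtain ⟨g, rfl⟩ := conj_over hB hA
  have hAM : Dec (g • B) ≤ M.fixingSubgroup := by
    intro u hu
    have h1 := hN.conj_mem _ (hBM ((Dec_smul B g u).1 hu)) g
    have : g * (g⁻¹ * u * g) * g⁻¹ = u := by group
    rwa [this] at h1
  have h1 : Dec B ⊓ H' ≤ tr e M.fixingSubgroup := by
    rw [← tr_symm' (e := e) (inf_le_right : Dec B ⊓ H' ≤ H'), hAB]
    exact tr_mono e (inf_le_left.trans hAM)
  intro u hu
  have hu' := Subgroup.mem_inf.1 hu
  have h2 : u ∈ N'.fixingSubgroup := by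
    rw [hfix]
    exact h1 (Subgroup.mem_inf.2 ⟨hu'.1, hM' hu'.2⟩)
  rw [IntermediateField.fixingSubgroup_sup]
  exact Subgroup.mem_inf.2 ⟨hu'.2, h2⟩

theorem tr_normal (e : H ≃ₜ* H') (hH : IsOpen (H : Set Gal(Ω/ℚ))) (hH' : IsOpen (H' : Set Gal(Ω/ℚ)))
    {M : IntermediateField ℚ Ω} [FiniteDimensional ℚ M] (hN : M.fixingSubgroup.Normal)
    (hM : M.fixingSubgroup ≤ H) (hM' : M.fixingSubgroup ≤ H') : tr e M.fixingSubgroup = M.fixingSubgroup := by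
  apply le_antisymm
  · have := tr_mono e (tr_normal_le e.symm hH' hH hN hM' hM)
    rwa [tr_symm' hM'] at this
  · exact tr_normal_le e hH hH' hN hM hM'

theorem tr_normal_mem (e : H ≃ₜ* H') (hH : IsOpen (H : Set Gal(Ω/ℚ))) (hH' : IsOpen (H' : Set Gal(Ω/ℚ)))
    {M : IntermediateField ℚ Ω} [FiniteDimensional ℚ M] (hN : M.fixingSubgroup.Normal)
    (hM : M.fixingSubgroup ≤ H) (hM' : M.fixingSubgroup ≤ H') (h : H) :
    (e h : Gal(Ω/ℚ)) ∈ M.fixingSubgroup ↔ (h : Gal(Ω/ℚ)) ∈ M.fixingSubgroup := by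
  have h1 := tr_normal e hH hH' hN hM hM'
  conv_lhs => rw [← h1]
  exact tr_mem

/-- sign lemma -/
theorem sgn {N : IntermediateField ℚ Ω} {a : Gal(Ω/ℚ)} (ha : a ∈ N.fixingSubgroup) {s : Ω} (hs : s ^ 2 ∈ N) :
    a s = s ∨ a s = -s := by
  have h1 := mem_fixing.1 ha _ hs
  rw [map_pow] at h1
  exact sq_eq_sq_iff_eq_or_eq_neg.1 h1

theorem sgn_sq {N : IntermediateField ℚ Ω} {a : Gal(Ω/ℚ)} (ha : a ∈ N.fixingSubgroup) {s : Ω} (hs : s ^ 2 ∈ N) :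
    (a * a) s = s := by
  rw [AlgEquiv.mul_apply]
  rcases sgn ha hs with h | h
  · rw [h, h]
  · rw [h, map_neg, h, neg_neg]

theorem sgn_comm {N : IntermediateField ℚ Ω} {a b : Gal(Ω/ℚ)} (ha : a ∈ N.fixingSubgroup) (hb : b ∈ N.fixingSubgroup)
    {s : Ω} (hs : s ^ 2 ∈ N) : a (b s) = b (a s) := by
  rcases sgn ha hs with h | h <;> rcases sgn hb hs with h' | h' <;> simp [h, h', map_neg]

theorem sq_mem {N : IntermediateField ℚ Ω} (hN : N.fixingSubgroup.Normal) (g : Gal(Ω/ℚ)) {s : Ω} (hs : s ^ 2 ∈ N) :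
    (g s) ^ 2 ∈ N := by
  rw [← map_pow]
  exact normal_mem hN g hs

/-- the field generated by conjugates of square roots -/
theorem ex_M {N : IntermediateField ℚ Ω} [FiniteDimensional ℚ N] (hN : N.fixingSubgroup.Normal) {X : Set Ω}
    (hX : X.Finite) (hXN : ∀ s ∈ X, s ^ 2 ∈ N) : ∃ M : IntermediateField ℚ Ω, FiniteDimensional ℚ M ∧
      M.fixingSubgroup.Normal ∧ M.fixingSubgroup ≤ N.fixingSubgroup ∧ (∀ s ∈ X, s ∈ M) ∧
      ∀ a ∈ N.fixingSubgroup, a * a ∈ M.fixingSubgroup := by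
  let X' : Set Ω := ⋃ s ∈ X, MulAction.orbit Gal(Ω/ℚ) s
  have hX' : X'.Finite := hX.biUnion fun s _ => by
    haveI := Subgroup.quotient_finite_of_isOpen _ (open_stab s)
    haveI : Finite (MulAction.orbit Gal(Ω/ℚ) s) :=
      Finite.of_equiv _ (MulAction.orbitEquivQuotientStabilizer Gal(Ω/ℚ) s).symm
    exact Set.toFinite _
  have hXX : ∀ s ∈ X, s ∈ X' := fun s hs => Set.mem_biUnion hs (MulAction.mem_orbit_self s)
  have hXg : ∀ (g : Gal(Ω/ℚ)), ∀ z ∈ X', g z ∈ X' := by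
    intro g z hz
    obtain ⟨s, hs, u, rfl⟩ := Set.mem_iUnion₂.1 hz
    exact Set.mem_biUnion hs ⟨g * u, mul_smul g u s⟩
  have hXN' : ∀ z ∈ X', z ^ 2 ∈ N := by
    intro z hz
    obtain ⟨s, hs, u, rfl⟩ := Set.mem_iUnion₂.1 hz
    exact sq_mem hN u (hXN s hs)
  haveI := fd_adjoin hX'
  have hmem : ∀ u : Gal(Ω/ℚ), u ∈ (N ⊔ IntermediateField.adjoin ℚ X').fixingSubgroup ↔
      u ∈ N.fixingSubgroup ∧ ∀ z ∈ X', u z = z := by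
    intro u
    rw [IntermediateField.fixingSubgroup_sup, Subgroup.mem_inf]
    refine and_congr_right fun _ => ⟨fun h z hz => mem_fixing.1 h z (IntermediateField.subset_adjoin ℚ X' hz), fun h => ?_⟩
    have h4 : IntermediateField.adjoin ℚ X' ≤ fx (Subgroup.zpowers u) := by
      rw [IntermediateField.adjoin_le_iff]
      intro z hz
      refine mem_fix.2 fun v hv => ?_
      have : Subgroup.zpowers u ≤ MulAction.stabilizer Gal(Ω/ℚ) z := by
        rw [Subgroup.zpowers_le]; exact h z hz
      exact this hv
    exact mem_fixing.2 fun x hx => mem_fix.1 (h4 hx) u (Subgroup.mem_zpowers u)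
  refine ⟨N ⊔ IntermediateField.adjoin ℚ X', inferInstance, ⟨fun u hu g => ?_⟩, fun u hu => ((hmem u).1 hu).1, fun s hs => ?_,
    fun a ha => (hmem _).2 ⟨mul_mem ha ha, fun z hz => sgn_sq ha (hXN' z hz)⟩⟩
  · rw [hmem] at hu ⊢
    refine ⟨hN.conj_mem _ hu.1 g, fun z hz => ?_⟩
    rw [AlgEquiv.mul_apply, AlgEquiv.mul_apply, hu.2 _ (hXg _ z hz), ← AlgEquiv.mul_apply, mul_inv_cancel]
    rfl
  · exact (le_sup_right : _ ≤ N ⊔ _) (IntermediateField.subset_adjoin ℚ X' (hXX s hs))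

/-- subgroup generated by an involution and a normal subgroup -/
def invol {U : Subgroup Gal(Ω/ℚ)} (hU : U.Normal) {a : Gal(Ω/ℚ)} (ha : a * a ∈ U) : Subgroup Gal(Ω/ℚ) where
  carrier := {g | g ∈ U ∨ a⁻¹ * g ∈ U}
  one_mem' := Or.inl (one_mem _)
  mul_mem' := by
    rintro x y (hx | hx) (hy | hy)
    · exact Or.inl (mul_mem hx hy)
    · refine Or.inr ?_
      have h1 := mul_mem (hU.conj_mem x hx a⁻¹) hy
      have : a⁻¹ * x * a⁻¹⁻¹ * (a⁻¹ * y) = a⁻¹ * (x * y) := by group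
      rwa [this] at h1
    · refine Or.inr ?_
      have h1 := mul_mem hx hy
      rwa [mul_assoc] at h1
    · refine Or.inl ?_
      have h1 := mul_mem (mul_mem ha (hU.conj_mem _ hx a⁻¹)) hy
      have : a * a * (a⁻¹ * (a⁻¹ * x) * a⁻¹⁻¹) * (a⁻¹ * y) = x * y := by group
      rwa [this] at h1
  inv_mem' := by
    rintro x (hx | hx)
    · exact Or.inl (inv_mem hx)
    · refine Or.inr ?_
      have h2 := mul_mem (inv_mem ha) (hU.conj_mem _ (inv_mem hx) a)
      have : (a * a)⁻¹ * (a * (a⁻¹ * x)⁻¹ * a⁻¹) = a⁻¹ * x⁻¹ := by group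
      rwa [this] at h2

theorem invol_closed {U : Subgroup Gal(Ω/ℚ)} (hU : U.Normal) {a : Gal(Ω/ℚ)} (ha : a * a ∈ U)
    (hUc : IsClosed (U : Set Gal(Ω/ℚ))) : IsClosed (invol hU ha : Set Gal(Ω/ℚ)) := by
  have : (invol hU ha : Set Gal(Ω/ℚ)) = (U : Set Gal(Ω/ℚ)) ∪ (fun g => a⁻¹ * g) ⁻¹' (U : Set Gal(Ω/ℚ)) := rfl
  rw [this]
  exact hUc.union (hUc.preimage (continuous_const_mul a⁻¹))

theorem fin_claim (e : H ≃ₜ* H') (hH : IsOpen (H : Set Gal(Ω/ℚ))) (hH' : IsOpen (H' : Set Gal(Ω/ℚ)))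
    {N : IntermediateField ℚ Ω} [FiniteDimensional ℚ N] (hN : N.fixingSubgroup.Normal)
    (hNH : N.fixingSubgroup ≤ H) (hNH' : N.fixingSubgroup ≤ H') (a : H) (ha : (a : Gal(Ω/ℚ)) ∈ N.fixingSubgroup)
    {X : Set Ω} (hX : X.Finite) (hXN : ∀ s ∈ X, s ^ 2 ∈ N) :
    ∃ g : Gal(Ω/ℚ), ∀ s ∈ X, (e a : Gal(Ω/ℚ)) s = (g * a * g⁻¹) s := by
  obtain ⟨M, hMf, hMn, hMN, hXM, hsq⟩ := ex_M hN hX hXN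
  have heM := tr_normal_mem e hH hH' hMn (hMN.trans hNH) (hMN.trans hNH')
  have heN := tr_normal_mem e hH hH' hN hNH hNH'
  by_cases haM : (a : Gal(Ω/ℚ)) ∈ M.fixingSubgroup
  · refine ⟨1, fun s hs => ?_⟩
    rw [mem_fixing.1 ((heM a).2 haM) s (hXM s hs), one_mul, inv_one, mul_one, mem_fixing.1 haM s (hXM s hs)]
  have haa := hsq _ ha
  let U := invol hMn haa
  have hUc : IsClosed (U : Set Gal(Ω/ℚ)) := invol_closed hMn haa (closed_fixing M)
  have hMU : M.fixingSubgroup ≤ U := fun g hg => Or.inl hg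
  have hFM : fx U ≤ M := by
    have := fx_mono hMU
    rwa [fx, fx, fix_fixing] at this
  haveI : FiniteDimensional ℚ (fx U) := fd_of_index (by
    intro h0
    have := Subgroup.index_dvd_of_le hMU
    rw [h0] at this
    exact fi_of_open (open_fixing M) (Nat.eq_zero_of_zero_dvd this))
  have hne : ¬ M ≤ fx U := by
    intro h
    apply haM
    exact mem_fixing.2 fun x hx => mem_fix.1 (h hx) a (Or.inr (by rw [inv_mul_cancel]; exact one_mem _))
  obtain ⟨S, hS⟩ := inv_unique M hMn
  classical
  obtain ⟨A, p, hA, hp, -, hnot⟩ := thmA hFM hne (S ∪ {2})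
  rw [Finset.mem_union, not_or, Finset.mem_singleton] at hp
  rw [fixing_fix hUc] at hnot
  obtain ⟨σ, hσ, hσM⟩ := SetLike.not_le_iff_exists.1 hnot
  obtain ⟨hσA, hσU⟩ := Subgroup.mem_inf.1 hσ
  have haσ : (a : Gal(Ω/ℚ))⁻¹ * σ ∈ M.fixingSubgroup := hσU.resolve_left hσM
  have hσN : σ ∈ N.fixingSubgroup := by
    have := mul_mem ha (hMN haσ)
    rwa [mul_inv_cancel_left] at this
  let σ' : H := ⟨σ, hNH hσN⟩
  obtain ⟨B, hB, hAB⟩ := loc_corr e hH hH' hA hp.2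
  obtain ⟨g, rfl⟩ := conj_over hA hB
  have h1 : (e σ' : Gal(Ω/ℚ)) ∈ Dec (g • A) := by
    have : (e σ' : Gal(Ω/ℚ)) ∈ tr e (Dec A ⊓ H) := tr_mem.2 (Subgroup.mem_inf.2 ⟨hσA, σ'.2⟩)
    rw [hAB] at this
    exact (Subgroup.mem_inf.1 this).1
  rw [Dec_smul] at h1
  have h2 : g⁻¹ * (e σ' : Gal(Ω/ℚ)) * g ∈ N.fixingSubgroup := by
    have := hN.conj_mem _ ((heN σ').2 hσN) g⁻¹
    rwa [inv_inv] at this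
  have h3 : g⁻¹ * (e σ' : Gal(Ω/ℚ)) * g ∉ M.fixingSubgroup := by
    intro h
    have h4 := hMn.conj_mem _ h g
    have : g * (g⁻¹ * (e σ' : Gal(Ω/ℚ)) * g) * g⁻¹ = e σ' := by group
    rw [this] at h4
    exact hσM ((heM σ').1 h4)
  have h5 := hS A p hA hp.1 σ hσA _ h1 hσM h3 (hsq _ hσN) (hsq _ h2)
  refine ⟨g, fun s hs => ?_⟩
  have h6 : g⁻¹ s ∈ M := normal_mem hMn _ (hXM s hs)
  have h7 := mem_fixing.1 h5 _ h6
  have h8 := mem_fixing.1 haσ _ h6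
  have h9 : (e (a⁻¹ * σ') : Gal(Ω/ℚ)) s = s := mem_fixing.1 ((heM _).2 haσ) s (hXM s hs)
  rw [map_mul, map_inv, Subgroup.coe_mul, Subgroup.coe_inv, AlgEquiv.mul_apply] at h9
  have h10 : (e σ' : Gal(Ω/ℚ)) s = (e a : Gal(Ω/ℚ)) s := by
    conv_rhs => rw [← h9]
    rw [← AlgEquiv.mul_apply, mul_inv_cancel]; rfl
  rw [← h10]
  calc (e σ' : Gal(Ω/ℚ)) s = (g * (g⁻¹ * (e σ' : Gal(Ω/ℚ)) * g)) (((g⁻¹ * (e σ' : Gal(Ω/ℚ)) * g)⁻¹ * σ) (g⁻¹ s)) := by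
        rw [h7, ← AlgEquiv.mul_apply]; congr 1; group
    _ = (g * a) (((a : Gal(Ω/ℚ))⁻¹ * σ) (g⁻¹ s)) := by
        simp only [← AlgEquiv.mul_apply]; congr 1; group
    _ = (g * a * g⁻¹) s := by rw [h8, ← AlgEquiv.mul_apply]

end NU


namespace NU
open Polynomial
open scoped Pointwise NumberField
set_option linter.unusedSectionVars false
set_option linter.style.haveILetI false
set_option linter.unusedVariables false

variable {Ω : Type*} [Field Ω] [CharZero Ω] [Algebra.IsAlgebraic ℚ Ω] [IsAlgClosed Ω]
variable {H H' : Subgroup Gal(Ω/ℚ)}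

/-- the subgroup on which `e` looks like conjugation by `g` -/
def Vg (e : H ≃ₜ* H') {N : IntermediateField ℚ Ω} (hN : N.fixingSubgroup.Normal) (hNH : N.fixingSubgroup ≤ H)
    (g : Gal(Ω/ℚ)) : Subgroup N.fixingSubgroup where
  carrier := {a | ∀ s : Ω, s ^ 2 ∈ N → (e ⟨a, hNH a.2⟩ : Gal(Ω/ℚ)) s = (g * a * g⁻¹) s}
  one_mem' := by
    intro s hs
    have : (⟨((1 : N.fixingSubgroup) : Gal(Ω/ℚ)), hNH (1 : N.fixingSubgroup).2⟩ : H) = 1 := rfl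
    rw [this, map_one]
    simp
  mul_mem' := by
    intro a b ha hb s hs
    have : (⟨((a * b : N.fixingSubgroup) : Gal(Ω/ℚ)), hNH (a * b).2⟩ : H) = ⟨a, hNH a.2⟩ * ⟨b, hNH b.2⟩ := rfl
    rw [this, map_mul, Subgroup.coe_mul, AlgEquiv.mul_apply, hb s hs, ha _ (sq_mem hN _ hs), ← AlgEquiv.mul_apply]
    congr 1
    rw [Subgroup.coe_mul]
    group
  inv_mem' := by
    intro a ha s hs
    have : (⟨((a⁻¹ : N.fixingSubgroup) : Gal(Ω/ℚ)), hNH (a⁻¹).2⟩ : H) = (⟨a, hNH a.2⟩ : H)⁻¹ := rfl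
    rw [this, map_inv, Subgroup.coe_inv, Subgroup.coe_inv]
    have h1 := ha ((g * (a : Gal(Ω/ℚ))⁻¹ * g⁻¹) s) (sq_mem hN _ hs)
    rw [← AlgEquiv.mul_apply (g * (a : Gal(Ω/ℚ)) * g⁻¹)] at h1
    have h2 : g * (a : Gal(Ω/ℚ)) * g⁻¹ * (g * (a : Gal(Ω/ℚ))⁻¹ * g⁻¹) = 1 := by group
    rw [h2] at h1
    have h3 : s = (e ⟨a, hNH a.2⟩ : Gal(Ω/ℚ)) ((g * (a : Gal(Ω/ℚ))⁻¹ * g⁻¹) s) := h1.symm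
    conv_lhs => rw [h3]
    rw [← AlgEquiv.mul_apply, inv_mul_cancel]
    rfl

theorem mem_Vg {e : H ≃ₜ* H'} {N : IntermediateField ℚ Ω} {hN : N.fixingSubgroup.Normal} {hNH : N.fixingSubgroup ≤ H}
    {g : Gal(Ω/ℚ)} {a : N.fixingSubgroup} : a ∈ Vg e hN hNH g ↔
      ∀ s : Ω, s ^ 2 ∈ N → (e ⟨a, hNH a.2⟩ : Gal(Ω/ℚ)) s = (g * a * g⁻¹) s := Iff.rfl

theorem conj_dep {N : IntermediateField ℚ Ω} (hN : N.fixingSubgroup.Normal) {a g n : Gal(Ω/ℚ)} (ha : a ∈ N.fixingSubgroup)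
    (hn : n ∈ N.fixingSubgroup) {s : Ω} (hs : s ^ 2 ∈ N) : (g * n * a * (g * n)⁻¹) s = (g * a * g⁻¹) s := by
  have h1 : (g⁻¹ s) ^ 2 ∈ N := sq_mem hN _ hs
  have h2 : (n⁻¹ (g⁻¹ s)) ^ 2 ∈ N := sq_mem hN _ h1
  calc (g * n * a * (g * n)⁻¹) s = g (n (a (n⁻¹ (g⁻¹ s)))) := by
        simp only [← AlgEquiv.mul_apply]; congr 1
    _ = g (a (n (n⁻¹ (g⁻¹ s)))) := by rw [sgn_comm hn ha h2]
    _ = (g * a * g⁻¹) s := by simp only [← AlgEquiv.mul_apply]; congr 1; group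

theorem cover_Vg (e : H ≃ₜ* H') (hH : IsOpen (H : Set Gal(Ω/ℚ))) (hH' : IsOpen (H' : Set Gal(Ω/ℚ)))
    {N : IntermediateField ℚ Ω} [FiniteDimensional ℚ N] (hN : N.fixingSubgroup.Normal)
    (hNH : N.fixingSubgroup ≤ H) (hNH' : N.fixingSubgroup ≤ H') (a : N.fixingSubgroup) :
    ∃ q : Gal(Ω/ℚ) ⧸ N.fixingSubgroup, a ∈ Vg e hN hNH q.out := by
  haveI := Subgroup.quotient_finite_of_isOpen _ (open_fixing N)
  by_contra hc
  push Not at hc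
  have h1 : ∀ q : Gal(Ω/ℚ) ⧸ N.fixingSubgroup, ∃ s : Ω, s ^ 2 ∈ N ∧
      (e ⟨a, hNH a.2⟩ : Gal(Ω/ℚ)) s ≠ (q.out * a * q.out⁻¹) s := by
    intro q
    have := hc q
    rw [mem_Vg] at this
    push Not at this
    exact this
  choose s hs hne using h1
  obtain ⟨g, hg⟩ := fin_claim e hH hH' hN hNH hNH' ⟨a, hNH a.2⟩ a.2 (Set.finite_range s) (by
    rintro _ ⟨q, rfl⟩; exact hs q)
  let q : Gal(Ω/ℚ) ⧸ N.fixingSubgroup := QuotientGroup.mk g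
  apply hne q
  rw [hg _ ⟨q, rfl⟩]
  have h2 : g⁻¹ * q.out ∈ N.fixingSubgroup := QuotientGroup.eq.1 (QuotientGroup.out_eq' q).symm
  have h3 := conj_dep hN (g := g) a.2 h2 (hs q)
  rw [mul_inv_cancel_left] at h3
  exact h3.symm

theorem ex_Vg (e : H ≃ₜ* H') (hH : IsOpen (H : Set Gal(Ω/ℚ))) (hH' : IsOpen (H' : Set Gal(Ω/ℚ)))
    {N : IntermediateField ℚ Ω} [FiniteDimensional ℚ N] (hN : N.fixingSubgroup.Normal)
    (hNH : N.fixingSubgroup ≤ H) (hNH' : N.fixingSubgroup ≤ H') :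
    ∃ g : Gal(Ω/ℚ), (Vg e hN hNH g).FiniteIndex := by
  haveI := Subgroup.quotient_finite_of_isOpen _ (open_fixing N)
  haveI := Fintype.ofFinite (Gal(Ω/ℚ) ⧸ N.fixingSubgroup)
  obtain ⟨q, -, hq⟩ := Subgroup.exists_finiteIndex_of_leftCoset_cover
    (s := (Finset.univ : Finset (Gal(Ω/ℚ) ⧸ N.fixingSubgroup))) (g := fun _ => (1 : N.fixingSubgroup))
    (H := fun q => Vg e hN hNH q.out) (by
      rw [Set.eq_univ_iff_forall]
      intro a
      obtain ⟨q, hq⟩ := cover_Vg e hH hH' hN hNH hNH' a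
      simp only [one_smul, Set.mem_iUnion]
      exact ⟨q, Finset.mem_univ _, hq⟩)
  exact ⟨_, hq⟩

theorem delta_fix (e : H ≃ₜ* H') {N : IntermediateField ℚ Ω} (hN : N.fixingSubgroup.Normal)
    (hNH : N.fixingSubgroup ≤ H) {g : Gal(Ω/ℚ)} (h : H) {a b : N.fixingSubgroup}
    (ha : a ∈ Vg e hN hNH g) (hb : b ∈ Vg e hN hNH g) (hab : (b : Gal(Ω/ℚ)) = h * a * (h : Gal(Ω/ℚ))⁻¹) {t : Ω} (ht0 : t ≠ 0)
    (ht : t ^ 2 ∈ N) : (a : Gal(Ω/ℚ)) (((h : Gal(Ω/ℚ))⁻¹ * g⁻¹ * e h * g)⁻¹ t / t) = ((h : Gal(Ω/ℚ))⁻¹ * g⁻¹ * e h * g)⁻¹ t / t := by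
  set δ := (h : Gal(Ω/ℚ))⁻¹ * g⁻¹ * e h * g with hδ
  have h1 := hb ((g * h : Gal(Ω/ℚ)) t) (sq_mem hN _ ht)
  have e1 : (⟨b, hNH b.2⟩ : H) = h * ⟨a, hNH a.2⟩ * h⁻¹ := Subtype.ext hab
  rw [e1, map_mul, map_mul, map_inv, Subgroup.coe_mul, Subgroup.coe_mul, Subgroup.coe_inv, hab] at h1
  have h2 := ha (((e h : Gal(Ω/ℚ))⁻¹ * (g * h)) t) (sq_mem hN _ ht)
  have h3 : (e h : Gal(Ω/ℚ)) ((e ⟨a, hNH a.2⟩ : Gal(Ω/ℚ)) (((e h : Gal(Ω/ℚ))⁻¹ * (g * h)) t)) =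
      (g * (h * a * (h : Gal(Ω/ℚ))⁻¹) * g⁻¹) ((g * h : Gal(Ω/ℚ)) t) := by
    rw [← h1]
    simp only [← AlgEquiv.mul_apply]; congr 1
  rw [h2] at h3
  have h4 : (a : Gal(Ω/ℚ)) (δ⁻¹ t) = δ⁻¹ ((a : Gal(Ω/ℚ)) t) := by
    have h5 := congrArg (g⁻¹ * (e h : Gal(Ω/ℚ))⁻¹ : Gal(Ω/ℚ)) h3
    calc (a : Gal(Ω/ℚ)) (δ⁻¹ t) = (g⁻¹ * (e h : Gal(Ω/ℚ))⁻¹ : Gal(Ω/ℚ)) ((e h : Gal(Ω/ℚ)) ((g * a * g⁻¹ : Gal(Ω/ℚ)) (((e h : Gal(Ω/ℚ))⁻¹ * (g * h)) t))) := by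
          simp only [← AlgEquiv.mul_apply]; congr 1; rw [hδ]; group
      _ = _ := h5
      _ = δ⁻¹ ((a : Gal(Ω/ℚ)) t) := by
          simp only [← AlgEquiv.mul_apply]; congr 1; rw [hδ]; group
  rw [map_div₀, h4]
  rcases sgn a.2 ht with h6 | h6
  · rw [h6]
  · rw [h6, map_neg, neg_div_neg_eq]

theorem delta_mem (e : H ≃ₜ* H') {N : IntermediateField ℚ Ω} [FiniteDimensional ℚ N] (hN : N.fixingSubgroup.Normal)
    (hNH : N.fixingSubgroup ≤ H) {g : Gal(Ω/ℚ)} (hg : (Vg e hN hNH g).FiniteIndex) (h : H) :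
    (h : Gal(Ω/ℚ))⁻¹ * g⁻¹ * e h * g ∈ N.fixingSubgroup := by
  by_contra hδ
  set δ := (h : Gal(Ω/ℚ))⁻¹ * g⁻¹ * e h * g with hδd
  let c : N.fixingSubgroup →* N.fixingSubgroup := (MulAut.conjNormal (h : Gal(Ω/ℚ))).toMonoidHom
  have hcs : Function.Surjective c := (MulAut.conjNormal (H := N.fixingSubgroup) (h : Gal(Ω/ℚ))).surjective
  have hc : ∀ a, ((c a : N.fixingSubgroup) : Gal(Ω/ℚ)) = h * a * (h : Gal(Ω/ℚ))⁻¹ := fun a => MulAut.conjNormal_apply _ _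
  let V0 : Subgroup N.fixingSubgroup := Vg e hN hNH g ⊓ (Vg e hN hNH g).comap c
  have hV0 : V0.index ≠ 0 := by
    apply Subgroup.index_inf_ne_zero hg.index_ne_zero
    rw [Subgroup.index_comap_of_surjective _ hcs]
    exact hg.index_ne_zero
  let V : Subgroup Gal(Ω/ℚ) := V0.map N.fixingSubgroup.subtype
  have hV : V.index ≠ 0 := by
    rw [Subgroup.index_map_subtype]
    exact mul_ne_zero hV0 (fi_of_open (open_fixing N))
  haveI := fd_of_index hV
  have hfix : ∀ t : Ω, t ≠ 0 → t ^ 2 ∈ N → δ⁻¹ t / t ∈ fx V := by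
    intro t ht0 ht
    refine mem_fix.2 ?_
    rintro _ ⟨a, ha, rfl⟩
    obtain ⟨ha1, ha2⟩ := Subgroup.mem_inf.1 ha
    exact delta_fix e hN hNH h ha1 (Subgroup.mem_comap.1 ha2) (hc a) ht0 ht
  obtain ⟨A, p, hA, -, -, hAE⟩ := ex_split (fx V ⊔ N) ∅
  rw [IntermediateField.fixingSubgroup_sup] at hAE
  have hAN : Dec A ≤ N.fixingSubgroup := hAE.trans inf_le_right
  have hAV : Dec A ≤ (fx V).fixingSubgroup := hAE.trans inf_le_left
  have hns : ¬ Same N A (δ • A) := by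
    intro hs
    obtain ⟨u, hu, huA⟩ := trans hA.ne_top (hA.smul δ).ne_top (closed_fixing N) (by rwa [fix_fixing])
    have h1 : u⁻¹ * δ ∈ Dec A := by
      rw [MulAction.mem_stabilizer_iff, mul_smul, ← huA, inv_smul_smul]
    have h2 := mul_mem hu (hAN h1)
    rw [mul_inv_cancel_left] at h2
    exact hδ h2
  obtain ⟨π, hπ, hπ0, hπ1, hk⟩ := hA.unif N
  obtain ⟨x, hx, hx1, hx2⟩ := approx hA.ne_top (hA.smul δ).ne_top hns hπ hπ0
  have hv1 : A.valuation (x / π) = 1 := eq_one_of_sub_lt (map_one _) hx1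
  have hv2 : A.valuation (δ⁻¹ x) = 1 := by
    rw [smul_lt, map_sub, map_one] at hx2
    exact eq_one_of_sub_lt (map_one _) hx2
  have hvx : A.valuation x = A.valuation π := by
    rw [map_div₀] at hv1
    exact (div_eq_one_iff_eq (v_pos hπ0).ne').1 hv1
  have hx0 : x ≠ 0 := by
    rintro rfl
    rw [map_zero] at hvx
    exact (v_pos (A := A) hπ0).ne hvx
  obtain ⟨t, ht⟩ := ex_root x (n := 2) (by norm_num)
  have ht0 : t ≠ 0 := by rintro rfl; exact hx0 (by rw [← ht]; simp)
  have hy := hfix t ht0 (by rw [ht]; exact hx)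
  have hy0 : δ⁻¹ t / t ≠ 0 := div_ne_zero (by simpa using ht0) ht0
  obtain ⟨d, hd, hd0, hdv, -⟩ := hA.im_val N (y := δ⁻¹ t / t)
    (mem_fix.2 fun u hu => mem_fixing.1 (hAV (Subgroup.mem_inf.1 hu).1) _ hy) hy0
  obtain ⟨k, hk⟩ := hk d hd hd0
  have h1 : A.valuation π ^ (-1 : ℤ) = A.valuation π ^ (k * 2) := by
    rw [zpow_mul, ← hk, hdv]
    have : A.valuation (δ⁻¹ t / t) ^ (2 : ℤ) = A.valuation (δ⁻¹ x / x) := by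
      rw [← ht, map_pow δ⁻¹, ← div_pow, map_pow A.valuation]
      rfl
    rw [this, map_div₀, hv2, hvx, zpow_neg_one, one_div]
  have := zpow_right_injective₀ (v_pos hπ0) hπ1.ne h1
  omega

theorem main_emb (e : H ≃ₜ* H') (hH : IsOpen (H : Set Gal(Ω/ℚ))) (hH' : IsOpen (H' : Set Gal(Ω/ℚ))) :
    ∃ g : Gal(Ω/ℚ), ∀ x ∈ fx H, g x ∈ fx H' := by
  haveI := fd_of_index (fi_of_open hH)
  haveI := fd_of_index (fi_of_open hH')
  obtain ⟨N, hFN, hNf, hN, -⟩ := ex_normal (fx H ⊔ fx H')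
  have hNH : N.fixingSubgroup ≤ H := by
    rw [← fixing_fix (H.isClosed_of_isOpen hH)]
    exact fun u hu => mem_fixing.2 fun x hx => mem_fixing.1 hu x (hFN ((le_sup_left : fx H ≤ _) hx))
  have hNH' : N.fixingSubgroup ≤ H' := by
    rw [← fixing_fix (H'.isClosed_of_isOpen hH')]
    exact fun u hu => mem_fixing.2 fun x hx => mem_fixing.1 hu x (hFN ((le_sup_right : fx H' ≤ _) hx))
  obtain ⟨g, hg⟩ := ex_Vg e hH hH' hN hNH hNH'
  refine ⟨g, fun x hx => mem_fix.2 fun u hu => ?_⟩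
  let h : H := e.symm ⟨u, hu⟩
  have heh : (e h : Gal(Ω/ℚ)) = u := by
    have : e h = ⟨u, hu⟩ := e.apply_symm_apply _
    rw [this]
  have h1 := mul_mem h.2 (hNH (delta_mem e hN hNH hg h))
  rw [heh] at h1
  have h2 : (h : Gal(Ω/ℚ)) * ((h : Gal(Ω/ℚ))⁻¹ * g⁻¹ * u * g) = g⁻¹ * u * g := by group
  rw [h2] at h1
  have h3 := mem_fix.1 hx _ h1
  calc u (g x) = g ((g⁻¹ * u * g) x) := by
        simp only [← AlgEquiv.mul_apply]; congr 1; group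
    _ = g x := by rw [h3]

end NU


namespace NU
open Polynomial
open scoped Pointwise NumberField
set_option linter.unusedSectionVars false
set_option linter.style.haveILetI false
set_option linter.unusedVariables false

theorem contL {G k L : Type*} [Group G] [TopologicalSpace G] [IsTopologicalGroup G] [Field k] [Field L] [Algebra k L]
    (f : G →* Gal(L/k)) (h : ∀ x : L, {g | f g x = x} ∈ nhds (1 : G)) : Continuous f := by
  apply continuous_of_continuousAt_one f
  intro U hU
  rw [map_one, krullTopology_mem_nhds_one_iff] at hU
  obtain ⟨E, hE, hEU⟩ := hU
  obtain ⟨S, hS⟩ := IntermediateField.essFiniteType_iff.1 (haveI := hE; (inferInstance : Algebra.EssFiniteType k E))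
  have h1 : (⋂ s ∈ S, {g | f g s = s}) ∈ nhds (1 : G) := (Filter.biInter_finset_mem S).2 fun s _ => h s
  rw [Filter.mem_map]
  refine Filter.mem_of_superset h1 fun g hg => hEU ?_
  have hg' : ∀ s ∈ S, f g s = s := fun s hs => Set.mem_iInter₂.1 hg s hs
  change f g ∈ E.fixingSubgroup
  rw [← hS, ← Subgroup.zpowers_le, ← IntermediateField.le_iff_le, IntermediateField.adjoin_le_iff]
  intro s hs
  rw [SetLike.mem_coe, IntermediateField.mem_fixedField_iff]
  intro v hv
  have : Subgroup.zpowers (f g) ≤ MulAction.stabilizer Gal(L/k) s := by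
    rw [Subgroup.zpowers_le]; exact hg' s hs
  exact this hv

theorem alg_of {K L : Type*} [Field K] [NumberField K] [Field L] [CharZero L] [Algebra K L] [Algebra.IsAlgebraic K L] :
    Algebra.IsAlgebraic ℚ L := Algebra.IsAlgebraic.trans ℚ K L

theorem ex_iso (L Ω : Type*) [Field L] [CharZero L] [IsAlgClosed L] [Algebra.IsAlgebraic ℚ L] [Field Ω] [CharZero Ω]
    [IsAlgClosed Ω] [Algebra.IsAlgebraic ℚ Ω] : Nonempty (L ≃+* Ω) := by
  haveI : IsAlgClosure ℚ L := ⟨inferInstance, inferInstance⟩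
  haveI : IsAlgClosure ℚ Ω := ⟨inferInstance, inferInstance⟩
  exact ⟨(IsAlgClosure.equiv ℚ L Ω).toRingEquiv⟩

variable {Ω : Type*} [Field Ω] [CharZero Ω] [Algebra.IsAlgebraic ℚ Ω] [IsAlgClosed Ω]

theorem transport {K L : Type*} [Field K] [NumberField K] [Field L] [CharZero L] [Algebra K L] [Algebra.IsAlgebraic K L]
    (ι : L ≃+* Ω) : ∃ H : Subgroup Gal(Ω/ℚ), IsOpen (H : Set Gal(Ω/ℚ)) ∧ Nonempty (Gal(L/K) ≃ₜ* H) ∧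
      Nonempty (K ≃+* fx H) := by
  let j : K →+* Ω := (ι : L →+* Ω).comp (algebraMap K L)
  have hj : ∀ k, j k = ι (algebraMap K L k) := fun k => rfl
  let jA : K →ₐ[ℚ] Ω := j.toRatAlgHom
  let F : IntermediateField ℚ Ω := jA.fieldRange
  have hF : ∀ x, x ∈ F ↔ ∃ k, j k = x := fun x => Iff.rfl
  haveI : FiniteDimensional ℚ F := by
    exact (AlgEquiv.ofInjectiveField jA).toLinearEquiv.finiteDimensional
  let r : L ≃+* L → Gal(Ω/ℚ) := fun σ => AlgEquiv.ofRingEquiv (f := (ι.symm.trans σ).trans ι) fun q => by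
    rw [eq_ratCast, map_ratCast]
  have hr : ∀ σ x, r σ x = ι (σ (ι.symm x)) := fun σ x => rfl
  let T : Gal(L/K) ≃* F.fixingSubgroup :=
    { toFun := fun σ => ⟨r σ, mem_fixing.2 (by
        intro x hx
        obtain ⟨k, rfl⟩ := (hF x).1 hx
        rw [hr, hj, RingEquiv.symm_apply_apply]
        exact congrArg ι (σ.commutes k))⟩
      invFun := fun τ => AlgEquiv.ofRingEquiv (f := (ι.trans (τ : Gal(Ω/ℚ)).toRingEquiv).trans ι.symm) fun k => by
        have := mem_fixing.1 τ.2 (j k) ((hF _).2 ⟨k, rfl⟩)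
        change ι.symm ((τ : Gal(Ω/ℚ)) (ι (algebraMap K L k))) = _
        rw [← hj, this, hj, RingEquiv.symm_apply_apply]
      left_inv := by
        intro σ
        ext x
        change ι.symm (ι (σ (ι.symm (ι x)))) = σ x
        simp
      right_inv := by
        intro τ
        apply Subtype.ext
        ext x
        change ι (ι.symm ((τ : Gal(Ω/ℚ)) (ι (ι.symm x)))) = (τ : Gal(Ω/ℚ)) x
        simp
      map_mul' := by
        intro σ τ
        apply Subtype.ext
        ext x
        change ι (σ (τ (ι.symm x))) = ι (σ (ι.symm (ι (τ (ι.symm x)))))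
        simp }
  have hT : ∀ σ x, (T σ : Gal(Ω/ℚ)) x = ι (σ (ι.symm x)) := fun σ x => rfl
  have hTs : ∀ τ x, T.symm τ x = ι.symm ((τ : Gal(Ω/ℚ)) (ι x)) := fun τ x => rfl
  refine ⟨F.fixingSubgroup, open_fixing F, ⟨{ T with continuous_toFun := ?_, continuous_invFun := ?_ }⟩, ?_⟩
  · apply Continuous.subtype_mk (f := fun σ => (T σ : Gal(Ω/ℚ))) (p := fun x => x ∈ F.fixingSubgroup)
    refine contL (F.fixingSubgroup.subtype.comp T.toMonoidHom) fun x => ?_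
    have h1 : IsOpen (MulAction.stabilizer Gal(L/K) (ι.symm x) : Set Gal(L/K)) := stabilizer_isOpen_of_isIntegral (K := K) _
    refine Filter.mem_of_superset (h1.mem_nhds (one_mem _)) fun σ hσ => ?_
    have hσ' : σ (ι.symm x) = ι.symm x := hσ
    change ι (σ (ι.symm x)) = x
    rw [hσ', RingEquiv.apply_symm_apply]
  · refine contL T.symm.toMonoidHom fun x => ?_
    have h1 : IsOpen ((fun τ : F.fixingSubgroup => (τ : Gal(Ω/ℚ))) ⁻¹' (MulAction.stabilizer Gal(Ω/ℚ) (ι x) : Set Gal(Ω/ℚ))) :=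
      (open_stab (ι x)).preimage continuous_subtype_val
    refine Filter.mem_of_superset (h1.mem_nhds (one_mem (MulAction.stabilizer Gal(Ω/ℚ) (ι x)))) fun τ hτ => ?_
    have hτ' : (τ : Gal(Ω/ℚ)) (ι x) = ι x := hτ
    change ι.symm ((τ : Gal(Ω/ℚ)) (ι x)) = x
    rw [hτ', RingEquiv.symm_apply_apply]
  · rw [fx, fix_fixing]
    exact ⟨(AlgEquiv.ofInjectiveField jA).toRingEquiv⟩

theorem iso_of_emb {K K' : Type*} [Field K] [NumberField K] [Field K'] [NumberField K'] (f : K →+* K') (g : K' →+* K) :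
    Nonempty (K ≃+* K') := by
  have h1 : Function.Surjective (f.comp g).toRatAlgHom.toLinearMap :=
    LinearMap.injective_iff_surjective.1 (f.comp g).injective
  have h2 : Function.Surjective f := fun y => by
    obtain ⟨x, hx⟩ := h1 y
    exact ⟨g x, hx⟩
  exact ⟨RingEquiv.ofBijective f ⟨f.injective, h2⟩⟩

theorem emb_of {H H' : Subgroup Gal(Ω/ℚ)} (e : H ≃ₜ* H') (hH : IsOpen (H : Set Gal(Ω/ℚ)))
    (hH' : IsOpen (H' : Set Gal(Ω/ℚ))) : Nonempty (fx H →+* fx H') := by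
  obtain ⟨g, hg⟩ := main_emb e hH hH'
  exact ⟨((g : Ω →+* Ω).comp (algebraMap (fx H) Ω)).codRestrict (fx H').toSubfield fun x => hg x x.2⟩

theorem final {K K' L L' : Type*} [Field K] [NumberField K] [Field K'] [NumberField K'] [Field L] [CharZero L]
    [IsAlgClosed L] [Algebra K L] [Algebra.IsAlgebraic K L] [Field L'] [CharZero L']
    [IsAlgClosed L'] [Algebra K' L'] [Algebra.IsAlgebraic K' L'] (e : Gal(L/K) ≃ₜ* Gal(L'/K')) :
    Nonempty (K ≃+* K') := by
  haveI : Algebra.IsAlgebraic ℚ L := alg_of (K := K)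
  haveI : Algebra.IsAlgebraic ℚ L' := alg_of (K := K')
  obtain ⟨ι⟩ := ex_iso L' L
  obtain ⟨H, hH, ⟨e1⟩, ⟨i1⟩⟩ := transport (K := K) (RingEquiv.refl L)
  obtain ⟨H', hH', ⟨e2⟩, ⟨i2⟩⟩ := transport (K := K') ι
  let E : H ≃ₜ* H' := (e1.symm.trans e).trans e2
  obtain ⟨f⟩ := emb_of E hH hH'
  obtain ⟨g⟩ := emb_of E.symm hH' hH
  exact iso_of_emb ((i2.symm : fx H' →+* K').comp (f.comp (i1 : K →+* fx H)))
    ((i1.symm : fx H →+* K).comp (g.comp (i2 : K' →+* fx H')))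

end NU

theorem stmt_1 (K K' : Type) [Field K] [NumberField K] [Field K'] [NumberField K']
    (e : (AlgebraicClosure K ≃ₐ[K] AlgebraicClosure K) ≃*
      (AlgebraicClosure K' ≃ₐ[K'] AlgebraicClosure K'))
    (he : Continuous e) (he' : Continuous e.symm) :
    Nonempty (K ≃+* K') := by
  haveI : CharZero (AlgebraicClosure K) := charZero_of_injective_algebraMap (algebraMap K (AlgebraicClosure K)).injective
  haveI : CharZero (AlgebraicClosure K') :=
    charZero_of_injective_algebraMap (algebraMap K' (AlgebraicClosure K')).injective
  exact NU.final (L := AlgebraicClosure K) (L' := AlgebraicClosure K')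
    { e with continuous_toFun := he, continuous_invFun := he' }
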